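/- Let p > 2, let q satisfy 2/p + 2/q = 1, and let b > 1/2. There exists a constant C > 0 such that for every Schwartz function F : ℝ³ → ℂ the function u defined by its space-time Fourier transform û(ξ,η,τ) = ⟨(ξ,η)⟩^{1/p} ⟨τ − φ(ξ,η)⟩^{−b} F(ξ,η,τ) satisfies (∫_ℝ ‖u(·,·,t)‖_{L^q(ℝ²)}^p dt)^{1/p} ≤ C ‖F‖_{L²(ℝ³)}, where φ(ξ,η) = ξ³ − 3ξη², ⟨x⟩ = (1 + |x|²)^{1/2} and |(ξ,η)| = √(ξ² + η²). -/

import Mathlib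

open MeasureTheory

/-- The phase function of the linearized Novikov-Veselov equation. -/
def phiNV (ξ η : ℝ) : ℝ := ξ ^ 3 - 3 * ξ * η ^ 2

/-- The function with space-time Fourier transform
`⟨(ξ,η)⟩^{1/p} ⟨τ − φ(ξ,η)⟩^{−b} F(ξ,η,τ)`. -/
noncomputable def transferFn (p b : ℝ) (F : ℝ × ℝ × ℝ → ℂ) (t : ℝ) : ℝ × ℝ → ℂ :=
  fun v => (2 * Real.pi : ℂ)⁻¹ ^ 3 *
    ∫ w : ℝ × ℝ × ℝ, Complex.exp (Complex.I * (v.1 * w.1 + v.2 * w.2.1 + t * w.2.2)) *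
      ((Real.sqrt (1 + w.1 ^ 2 + w.2.1 ^ 2) ^ (1 / p) : ℝ) : ℂ) *
      ((Real.sqrt (1 + (w.2.2 - phiNV w.1 w.2.1) ^ 2) ^ (-b) : ℝ) : ℂ) * F w

theorem lintegral_comp_abs_real (f : ℝ → ENNReal) :
    ∫⁻ s : ℝ, f |s| = 2 * ∫⁻ s in Set.Ioi (0 : ℝ), f s := by
  have h1 : ∫⁻ s in Set.Ioi (0 : ℝ), f |s| = ∫⁻ s in Set.Ioi (0 : ℝ), f s :=
    setLIntegral_congr_fun measurableSet_Ioi fun s hs => by rw [abs_of_pos hs]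
  have h2 : ∫⁻ s in Set.Iic (0 : ℝ), f |s| = ∫⁻ s in Set.Ioi (0 : ℝ), f s := by
    have := (Measure.measurePreserving_neg (volume : Measure ℝ)).setLIntegral_comp_preimage_emb
      (MeasurableEquiv.neg ℝ).measurableEmbedding (fun s => f |s|) (Set.Iio 0)
    rw [setLIntegral_congr Iio_ae_eq_Iic.symm, ← this, ← h1]
    simp
  rw [← lintegral_add_compl (fun s => f |s|) (measurableSet_Iic (a := (0 : ℝ))), h2,
    Set.compl_Iic, h1, two_mul]

theorem lintegral_rpow_neg_near {θ ρ : ℝ} (h1 : θ < 1) (hρ : 0 < ρ) :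
    ∫⁻ s : ℝ, (if |s| < ρ then ENNReal.ofReal (|s| ^ (-θ)) else 0)
      = ENNReal.ofReal (2 / (1 - θ) * ρ ^ (1 - θ)) := by
  rw [lintegral_comp_abs_real (fun s => if s < ρ then ENNReal.ofReal (s ^ (-θ)) else 0)]
  have h : ∫⁻ s in Set.Ioi (0 : ℝ), (if s < ρ then ENNReal.ofReal (s ^ (-θ)) else 0)
      = ∫⁻ s in Set.Ioo (0 : ℝ) ρ, ENNReal.ofReal (s ^ (-θ)) := by
    rw [← lintegral_indicator measurableSet_Ioi, ← lintegral_indicator measurableSet_Ioo]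
    congr 1 with s
    by_cases h0 : 0 < s <;> by_cases h2 : s < ρ <;> simp [Set.indicator, h0, h2]
  rw [h, setLIntegral_congr Ioo_ae_eq_Ioc, ← ofReal_integral_eq_lintegral_ofReal,
    ← intervalIntegral.integral_of_le hρ.le, integral_rpow (Or.inl (by linarith))]
  · rw [Real.zero_rpow (by linarith), sub_zero, show -θ + 1 = 1 - θ by ring, div_mul_eq_mul_div,
      mul_div_assoc, ENNReal.ofReal_mul zero_le_two]
    simp
  · exact (intervalIntegral.intervalIntegrable_rpow' (by linarith)).1
  · filter_upwards [ae_restrict_mem measurableSet_Ioc] with s hs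
    exact Real.rpow_nonneg hs.1.le _

theorem lintegral_rpow_neg_far {ρ : ℝ} (hρ : 0 < ρ) :
    ∫⁻ s : ℝ, (if ρ ≤ |s| then ENNReal.ofReal (|s| ^ (-2 : ℝ)) else 0)
      = ENNReal.ofReal (2 * ρ⁻¹) := by
  rw [lintegral_comp_abs_real (fun s => if ρ ≤ s then ENNReal.ofReal (s ^ (-2 : ℝ)) else 0)]
  have h : ∫⁻ s in Set.Ioi (0 : ℝ), (if ρ ≤ s then ENNReal.ofReal (s ^ (-2 : ℝ)) else 0)
      = ∫⁻ s in Set.Ici ρ, ENNReal.ofReal (s ^ (-2 : ℝ)) := by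
    rw [← lintegral_indicator measurableSet_Ioi, ← lintegral_indicator measurableSet_Ici]
    congr 1 with s
    by_cases h2 : ρ ≤ s
    · simp [Set.indicator, h2, hρ.trans_le h2]
    · simp [Set.indicator, h2]
  rw [h, setLIntegral_congr Ioi_ae_eq_Ici.symm, ← ofReal_integral_eq_lintegral_ofReal,
    integral_Ioi_rpow_of_lt (by norm_num) hρ]
  · rw [ENNReal.ofReal_mul zero_le_two]
    norm_num
    rw [Real.rpow_neg_one]
  · exact integrableOn_Ioi_rpow_of_lt (by norm_num) hρ
  · filter_upwards [ae_restrict_mem measurableSet_Ioi] with s hs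
    exact Real.rpow_nonneg (hρ.trans hs).le _

theorem lintegral_truncated_riesz_le {θ : ℝ} (h0 : 0 < θ) (h1 : θ < 1) {n : ℝ → ℝ}
    (hn : Measurable n) (hn0 : ∀ t, 0 ≤ n t) {A : ℝ} (hA : 0 < A)
    (hnA : ∫⁻ t, ENNReal.ofReal (n t ^ (2 / (2 - θ))) = ENNReal.ofReal (A ^ (2 / (2 - θ))))
    (t : ℝ) {a : ℝ} (ha : 0 < a) :
    ∫⁻ s, (if n s ≤ a then ENNReal.ofReal (n s * |t - s| ^ (-θ)) else 0) ≤
      ENNReal.ofReal ((2 / (1 - θ) + 2) *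
        (a ^ (2 / (2 - θ) - 1) * A ^ (2 - 2 / (2 - θ)))) := by
  set r := 2 / (2 - θ) with hr
  have h2θ : 0 < 2 - θ := by linarith
  have hr0 : 0 < r := by positivity
  set ρ := (A / a) ^ r with hρ
  have hρ0 : 0 < ρ := by positivity
  have near : ∫⁻ s : ℝ, (if |t - s| < ρ then ENNReal.ofReal (a * |t - s| ^ (-θ)) else 0) =
      ENNReal.ofReal (2 / (1 - θ) * (a ^ (r - 1) * A ^ (2 - r))) := by
    have e := lintegral_sub_left_eq_self (μ := (volume : Measure ℝ))
      (fun s => if |s| < ρ then ENNReal.ofReal (a * |s| ^ (-θ)) else 0) t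
    rw [e]
    have : ∀ s : ℝ, (if |s| < ρ then ENNReal.ofReal (a * |s| ^ (-θ)) else 0) =
        ENNReal.ofReal a * (if |s| < ρ then ENNReal.ofReal (|s| ^ (-θ)) else 0) := by
      intro s; split_ifs <;> simp [ENNReal.ofReal_mul ha.le]
    simp_rw [this]
    rw [lintegral_const_mul' _ _ ENNReal.ofReal_ne_top, lintegral_rpow_neg_near h1 hρ0,
      ← ENNReal.ofReal_mul ha.le]
    congr 1
    have : ρ ^ (1 - θ) = A ^ (2 - r) / a ^ (2 - r) := by
      rw [hρ, ← Real.rpow_mul (by positivity), ← Real.div_rpow hA.le ha.le]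
      congr 1; rw [hr]; field_simp; ring
    have k : a ^ (r - 1) = a / a ^ (2 - r) := by
      rw [show r - 1 = 1 - (2 - r) by ring, Real.rpow_sub ha, Real.rpow_one]
    rw [this, k]
    ring
  have far : ∫⁻ s : ℝ, (if ρ ≤ |t - s| then ENNReal.ofReal (n s * |t - s| ^ (-θ)) else 0) ≤
      ENNReal.ofReal (2 * (a ^ (r - 1) * A ^ (2 - r))) := by
    have hq : r.HolderConjugate (2 / θ) := by
      refine ⟨?_, hr0, by positivity⟩
      rw [hr]; field_simp; ring
    have hm2 : Measurable fun s : ℝ => if ρ ≤ |t - s| then ENNReal.ofReal (|t - s| ^ (-θ)) else 0 :=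
      Measurable.ite (measurableSet_le measurable_const (by fun_prop)) (by fun_prop) measurable_const
    have := ENNReal.lintegral_mul_le_Lp_mul_Lq volume hq (f := fun s => ENNReal.ofReal (n s))
      (g := fun s => if ρ ≤ |t - s| then ENNReal.ofReal (|t - s| ^ (-θ)) else 0)
      (by fun_prop) hm2.aemeasurable
    have e1 : ∀ s, ((fun s => ENNReal.ofReal (n s)) * (fun s : ℝ => if ρ ≤ |t - s| then
        ENNReal.ofReal (|t - s| ^ (-θ)) else 0)) s =
        (if ρ ≤ |t - s| then ENNReal.ofReal (n s * |t - s| ^ (-θ)) else 0) := by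
      intro s; simp only [Pi.mul_apply]; split_ifs <;> simp [ENNReal.ofReal_mul (hn0 s)]
    simp_rw [e1] at this
    refine this.trans ?_
    have e2 : ∀ s, (ENNReal.ofReal (n s)) ^ r = ENNReal.ofReal (n s ^ r) := fun s =>
      ENNReal.ofReal_rpow_of_nonneg (hn0 s) hr0.le
    have e3 : ∀ s, (if ρ ≤ |t - s| then ENNReal.ofReal (|t - s| ^ (-θ)) else 0) ^ (2 / θ) =
        if ρ ≤ |t - s| then ENNReal.ofReal (|t - s| ^ (-2 : ℝ)) else 0 := by
      intro s
      split_ifs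
      · rw [ENNReal.ofReal_rpow_of_nonneg (by positivity) (by positivity),
          ← Real.rpow_mul (abs_nonneg _)]
        congr 2; field_simp
      · rw [ENNReal.zero_rpow_of_pos (by positivity)]
    simp_rw [e2, e3]
    have e := lintegral_sub_left_eq_self (μ := (volume : Measure ℝ))
      (fun s => if ρ ≤ |s| then ENNReal.ofReal (|s| ^ (-2 : ℝ)) else 0) t
    rw [hnA, e, lintegral_rpow_neg_far hρ0, ENNReal.ofReal_rpow_of_nonneg (by positivity)
      (by positivity), ENNReal.ofReal_rpow_of_nonneg (by positivity) (by positivity),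
      ← ENNReal.ofReal_mul (by positivity)]
    apply ENNReal.ofReal_le_ofReal
    rw [← Real.rpow_mul hA.le, mul_one_div_cancel hr0.ne', Real.rpow_one,
      Real.mul_rpow zero_le_two (by positivity)]
    have k1 : (2 : ℝ) ^ (1 / (2 / θ)) ≤ 2 := by
      conv_rhs => rw [← Real.rpow_one 2]
      apply Real.rpow_le_rpow_of_exponent_le one_le_two
      rw [one_div_div]; linarith
    have k2 : ρ⁻¹ ^ (1 / (2 / θ)) = a ^ (r - 1) / A ^ (r - 1) := by
      rw [hρ, ← Real.inv_rpow (by positivity), inv_div, ← Real.rpow_mul (by positivity),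
        ← Real.div_rpow ha.le hA.le]
      congr 1; rw [hr]; field_simp; ring
    have k3 : A ^ (2 - r) = A / A ^ (r - 1) := by
      rw [show 2 - r = 1 - (r - 1) by ring, Real.rpow_sub hA, Real.rpow_one]
    rw [k2, k3]
    calc A * (2 ^ (1 / (2 / θ)) * (a ^ (r - 1) / A ^ (r - 1)))
        = 2 ^ (1 / (2 / θ)) * (a ^ (r - 1) * (A / A ^ (r - 1))) := by ring
      _ ≤ _ := by gcongr
  rw [add_mul, ENNReal.ofReal_add (by have : 0 < 1 - θ := by linarith
                                      positivity) (by positivity), ← near]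
  refine le_trans ?_ (add_le_add le_rfl far)
  rw [← lintegral_add_left]
  · apply lintegral_mono
    intro s
    rcases lt_or_ge (|t - s|) ρ with h | h
    · simp only [h, if_true, not_le.mpr h, if_false, add_zero]
      split_ifs
      · gcongr
      · exact zero_le
    · simp only [h, if_true, not_lt.mpr h, if_false, zero_add]
      split_ifs
      · exact le_rfl
      · exact zero_le
  · exact Measurable.ite (measurableSet_lt (by fun_prop) measurable_const) (by fun_prop)
      measurable_const

theorem hardy_littlewood_sobolev_diag {θ : ℝ} (h0 : 0 < θ) (h1 : θ < 1) {n : ℝ → ℝ}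
    (hn : Measurable n) (hn0 : ∀ t, 0 ≤ n t)
    (hfin : ∫⁻ t, ENNReal.ofReal (n t ^ (2 / (2 - θ))) ≠ ⊤) :
    ∫⁻ t, ∫⁻ s, ENNReal.ofReal (n t * n s * |t - s| ^ (-θ)) ≤
      ENNReal.ofReal (2 * (2 / (1 - θ) + 2)) *
        (∫⁻ t, ENNReal.ofReal (n t ^ (2 / (2 - θ)))) ^ (2 - θ) := by
  set r := 2 / (2 - θ) with hr
  have h2θ : 0 < 2 - θ := by linarith
  have h1θ : 0 < 1 - θ := by linarith
  have hr0 : 0 < r := by positivity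
  set I := ∫⁻ t, ENNReal.ofReal (n t ^ r) with hI
  rcases eq_or_ne I 0 with hI0 | hI0
  · have hz : ∀ᵐ t, n t = 0 := by
      have := (lintegral_eq_zero_iff (by fun_prop)).1 hI0
      filter_upwards [this] with t ht
      have h3 : n t ^ r ≤ 0 := by simpa using ht
      by_contra hne
      exact absurd (Real.rpow_pos_of_pos (lt_of_le_of_ne (hn0 t) (Ne.symm hne)) r) (not_lt.2 h3)
    have : ∫⁻ t, ∫⁻ s, ENNReal.ofReal (n t * n s * |t - s| ^ (-θ)) = 0 := by
      rw [lintegral_congr_ae (g := fun _ => 0), lintegral_zero]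
      filter_upwards [hz] with t ht
      simp [ht]
    rw [this]; exact zero_le
  set A := I.toReal ^ (1 / r) with hA
  have hIpos : 0 < I.toReal := ENNReal.toReal_pos hI0 hfin
  have hA0 : 0 < A := by positivity
  have hIA : I = ENNReal.ofReal (A ^ r) := by
    rw [hA, ← Real.rpow_mul hIpos.le, one_div_mul_cancel hr0.ne', Real.rpow_one,
      ENNReal.ofReal_toReal hfin]
  set k : ℝ → ℝ → ENNReal := fun t s =>
    if n s ≤ n t then ENNReal.ofReal (n t * n s * |t - s| ^ (-θ)) else 0 with hk
  have hkm : Measurable (Function.uncurry k) :=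
    Measurable.ite (measurableSet_le (by fun_prop) (by fun_prop)) (by fun_prop) measurable_const
  have hkt : ∀ t, Measurable (k t) := fun t => hkm.comp (measurable_const.prodMk measurable_id)
  have step1 : ∫⁻ t, ∫⁻ s, ENNReal.ofReal (n t * n s * |t - s| ^ (-θ)) ≤
      2 * ∫⁻ t, ∫⁻ s, k t s := by
    have : ∫⁻ t, ∫⁻ s, k s t = ∫⁻ t, ∫⁻ s, k t s :=
      lintegral_lintegral_swap (hkm.comp measurable_swap).aemeasurable
    rw [two_mul]
    nth_rewrite 2 [← this]
    rw [← lintegral_add_left (f := fun t => ∫⁻ s, k t s) hkm.lintegral_prod_right']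
    apply lintegral_mono
    intro t
    change _ ≤ (∫⁻ s, k t s) + ∫⁻ s, k s t
    rw [← lintegral_add_left (hkt t)]
    apply lintegral_mono
    intro s
    simp only [hk]
    rcases le_total (n s) (n t) with h | h
    · simp [h]
    · simp only [h, if_true]
      rw [abs_sub_comm s t, mul_comm (n s)]
      exact le_add_self
  refine step1.trans ?_
  have step2 : ∀ t, ∫⁻ s, k t s ≤ ENNReal.ofReal ((2 / (1 - θ) + 2) * A ^ (2 - r)) *
      ENNReal.ofReal (n t ^ r) := by
    intro t
    rcases (hn0 t).eq_or_lt with h | h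
    · simp [hk, ← h]
    have e : ∀ s, k t s = ENNReal.ofReal (n t) *
        (if n s ≤ n t then ENNReal.ofReal (n s * |t - s| ^ (-θ)) else 0) := by
      intro s; simp only [hk]; split_ifs
      · rw [mul_assoc, ENNReal.ofReal_mul h.le]
      · simp
    simp_rw [e]
    rw [lintegral_const_mul' _ _ ENNReal.ofReal_ne_top]
    refine (mul_le_mul_right (lintegral_truncated_riesz_le h0 h1 hn hn0 hA0 hIA t h) _).trans ?_
    rw [← ENNReal.ofReal_mul h.le, ← ENNReal.ofReal_mul (by positivity)]
    apply ENNReal.ofReal_le_ofReal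
    rw [← hr, Real.rpow_sub h, Real.rpow_one]
    apply le_of_eq
    field_simp
  refine (mul_le_mul_right (lintegral_mono step2) 2).trans ?_
  rw [lintegral_const_mul' _ _ ENNReal.ofReal_ne_top, ← hI, hIA,
    ENNReal.ofReal_rpow_of_nonneg (by positivity) h2θ.le, ← ENNReal.ofReal_mul (by positivity),
    ← ENNReal.ofReal_mul (by positivity), ← ENNReal.ofReal_ofNat 2,
    ← ENNReal.ofReal_mul (by positivity)]
  apply ENNReal.ofReal_le_ofReal
  rw [← Real.rpow_mul hA0.le, show r * (2 - θ) = (2 - r) + r by rw [hr]; field_simp; ring,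
    Real.rpow_add hA0]
  apply le_of_eq
  ring

theorem norm_oscillatory_integral_le_boundary {c d M : ℝ} (hc : 0 < c) (hcd : c ≤ d)
    {ψ ψ₁ ψ₂ : ℝ → ℝ} {a a₁ : ℝ → ℂ}
    (hψ : ∀ ξ > 0, HasDerivAt ψ (ψ₁ ξ) ξ) (hψ₁ : ∀ ξ > 0, HasDerivAt ψ₁ (ψ₂ ξ) ξ)
    (hψ₂ : ContinuousOn ψ₂ (Set.Ioi 0)) (ha : ∀ ξ > 0, HasDerivAt a (a₁ ξ) ξ)
    (ha₁ : ContinuousOn a₁ (Set.Ioi 0)) (hab : ∀ ξ > 0, ‖a ξ‖ ≤ √ξ)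
    (ha₁b : ∀ ξ > 0, ‖a₁ ξ‖ ≤ M / √ξ)
    (hpos : ∀ ξ ∈ Set.Icc c d, 0 ≤ ψ₂ ξ) (hne : ∀ ξ ∈ Set.Icc c d, ψ₁ ξ ≠ 0) :
    ‖∫ ξ in c..d, a ξ * Complex.exp (Complex.I * ψ ξ)‖ ≤
      2 * (√c / |ψ₁ c| + √d / |ψ₁ d|) + (M + 1 / 2) * ∫ ξ in c..d, 1 / (√ξ * |ψ₁ ξ|) := by
  have hsub : Set.uIcc c d = Set.Icc c d := Set.uIcc_of_le hcd
  have hp : ∀ ξ ∈ Set.Icc c d, 0 < ξ := fun ξ h => hc.trans_le h.1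
  have hss : Set.Icc c d ⊆ Set.Ioi 0 := fun ξ h => hp ξ h
  have cψ : ContinuousOn ψ (Set.Icc c d) := fun ξ h => (hψ ξ (hp ξ h)).continuousAt.continuousWithinAt
  have cψ₁ : ContinuousOn ψ₁ (Set.Icc c d) :=
    fun ξ h => (hψ₁ ξ (hp ξ h)).continuousAt.continuousWithinAt
  have ca : ContinuousOn a (Set.Icc c d) := fun ξ h => (ha ξ (hp ξ h)).continuousAt.continuousWithinAt
  have cψ₂ := hψ₂.mono hss
  have ca₁ := ha₁.mono hss
  have hneC : ∀ ξ ∈ Set.Icc c d, (ψ₁ ξ : ℂ) ≠ 0 := fun ξ h => by exact_mod_cast hne ξ h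
  have cψC : ContinuousOn (fun ξ => (ψ ξ : ℂ)) (Set.Icc c d) :=
    Complex.continuous_ofReal.comp_continuousOn cψ
  have cψ₁C : ContinuousOn (fun ξ => (ψ₁ ξ : ℂ)) (Set.Icc c d) :=
    Complex.continuous_ofReal.comp_continuousOn cψ₁
  have cψ₂C : ContinuousOn (fun ξ => (ψ₂ ξ : ℂ)) (Set.Icc c d) :=
    Complex.continuous_ofReal.comp_continuousOn cψ₂
  have csq : ContinuousOn (fun ξ : ℝ => √ξ) (Set.Icc c d) := Real.continuous_sqrt.continuousOn
  have cexp : ContinuousOn (fun ξ => Complex.exp (Complex.I * ψ ξ)) (Set.Icc c d) := by fun_prop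
  have hsq : ∀ ξ ∈ Set.Icc c d, √ξ ≠ 0 := fun ξ h => (Real.sqrt_pos.2 (hp ξ h)).ne'
  set u : ℝ → ℂ := fun ξ => a ξ / (Complex.I * ψ₁ ξ) with hu
  set u' : ℝ → ℂ := fun ξ => (a₁ ξ * (Complex.I * ψ₁ ξ) - a ξ * (Complex.I * ψ₂ ξ)) /
    (Complex.I * ψ₁ ξ) ^ 2 with hu'
  have cu' : ContinuousOn u' (Set.Icc c d) := by
    refine ContinuousOn.div (by fun_prop) (by fun_prop) fun ξ h => ?_
    exact pow_ne_zero _ (mul_ne_zero Complex.I_ne_zero (hneC ξ h))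
  have du : ∀ ξ ∈ Set.uIcc c d, HasDerivAt u (u' ξ) ξ := by
    intro ξ h
    rw [hsub] at h
    exact (ha ξ (hp ξ h)).div ((hψ₁ ξ (hp ξ h)).ofReal_comp.const_mul Complex.I)
      (mul_ne_zero Complex.I_ne_zero (hneC ξ h))
  have dv : ∀ ξ ∈ Set.uIcc c d, HasDerivAt (fun ξ => Complex.exp (Complex.I * ψ ξ))
      (Complex.exp (Complex.I * ψ ξ) * (Complex.I * ψ₁ ξ)) ξ := by
    intro ξ h
    rw [hsub] at h
    exact ((hψ ξ (hp ξ h)).ofReal_comp.const_mul Complex.I).cexp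
  have ibp := intervalIntegral.integral_mul_deriv_eq_deriv_mul du dv
    (cu'.intervalIntegrable_of_Icc hcd)
    (ContinuousOn.intervalIntegrable_of_Icc hcd (by fun_prop))
  have e1 : ∫ ξ in c..d, a ξ * Complex.exp (Complex.I * ψ ξ) =
      ∫ ξ in c..d, u ξ * (Complex.exp (Complex.I * ψ ξ) * (Complex.I * ψ₁ ξ)) := by
    apply intervalIntegral.integral_congr
    intro ξ h
    rw [hsub] at h
    have := hneC ξ h
    simp only [hu]
    field_simp
  have nexp : ∀ ξ : ℝ, ‖Complex.exp (Complex.I * ψ ξ)‖ = 1 := fun ξ => by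
    rw [mul_comm]; exact Complex.norm_exp_ofReal_mul_I _
  have nu : ∀ ξ ∈ Set.Icc c d, ‖u ξ‖ ≤ √ξ / |ψ₁ ξ| := by
    intro ξ h
    simp only [hu, norm_div, norm_mul, Complex.norm_I, one_mul, Complex.norm_real, Real.norm_eq_abs]
    gcongr
    exact hab ξ (hp ξ h)
  set F' : ℝ → ℝ := fun ξ => (1 / (2 * √ξ) * ψ₁ ξ - √ξ * ψ₂ ξ) / ψ₁ ξ ^ 2 with hF'
  have cF' : ContinuousOn F' (Set.Icc c d) := by
    refine ContinuousOn.div ?_ (by fun_prop) fun ξ h => pow_ne_zero _ (hne ξ h)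
    refine ContinuousOn.sub (ContinuousOn.mul (ContinuousOn.div (by fun_prop) (by fun_prop) ?_)
      (by fun_prop)) (by fun_prop)
    exact fun ξ h => mul_ne_zero two_ne_zero (hsq ξ h)
  have dF : ∀ ξ ∈ Set.uIcc c d, HasDerivAt (fun ξ => √ξ / ψ₁ ξ) (F' ξ) ξ := by
    intro ξ h
    rw [hsub] at h
    exact (Real.hasDerivAt_sqrt (hp ξ h).ne').div (hψ₁ ξ (hp ξ h)) (hne ξ h)
  have ftc := intervalIntegral.integral_eq_sub_of_hasDerivAt dF (cF'.intervalIntegrable_of_Icc hcd)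
  have cw : ContinuousOn (fun ξ => 1 / (√ξ * |ψ₁ ξ|)) (Set.Icc c d) :=
    ContinuousOn.div (by fun_prop) (by fun_prop) fun ξ h =>
      mul_ne_zero (hsq ξ h) (abs_ne_zero.2 (hne ξ h))
  have nu' : ∀ ξ ∈ Set.Icc c d, ‖u' ξ * Complex.exp (Complex.I * ψ ξ)‖ ≤
      (M + 1 / 2) * (1 / (√ξ * |ψ₁ ξ|)) - F' ξ := by
    intro ξ h
    have h0 := hp ξ h
    have hs := Real.sqrt_pos.2 h0
    have hab' : 0 < |ψ₁ ξ| := abs_pos.2 (hne ξ h)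
    rw [norm_mul, nexp, mul_one]
    have k1 : ‖u' ξ‖ ≤ ‖a₁ ξ‖ / |ψ₁ ξ| + ‖a ξ‖ * ψ₂ ξ / |ψ₁ ξ| ^ 2 := by
      simp only [hu']
      rw [sub_div]
      refine (norm_sub_le _ _).trans (le_of_eq ?_)
      simp only [norm_div, norm_mul, norm_pow, Complex.norm_I, one_mul, Complex.norm_real,
        Real.norm_eq_abs, abs_of_nonneg (hpos ξ h)]
      field_simp
    have k2 : ‖a₁ ξ‖ / |ψ₁ ξ| ≤ M * (1 / (√ξ * |ψ₁ ξ|)) := by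
      calc ‖a₁ ξ‖ / |ψ₁ ξ| ≤ M / √ξ / |ψ₁ ξ| := by gcongr; exact ha₁b ξ h0
        _ = _ := by field_simp
    have k3 : ‖a ξ‖ * ψ₂ ξ / |ψ₁ ξ| ^ 2 ≤ √ξ * ψ₂ ξ / ψ₁ ξ ^ 2 := by
      rw [sq_abs]; have := hpos ξ h; gcongr; exact hab ξ h0
    have k4 : F' ξ = 1 / (2 * √ξ * ψ₁ ξ) - √ξ * ψ₂ ξ / ψ₁ ξ ^ 2 := by
      simp only [hF']; have := hne ξ h; field_simp
    have k5 : 1 / (2 * √ξ * ψ₁ ξ) ≤ 1 / 2 * (1 / (√ξ * |ψ₁ ξ|)) := by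
      have : 1 / 2 * (1 / (√ξ * |ψ₁ ξ|)) = |1 / (2 * √ξ * ψ₁ ξ)| := by
        rw [abs_div, abs_mul, abs_one, abs_of_pos (by positivity : 0 < 2 * √ξ)]; field_simp
      rw [this]; exact le_abs_self _
    linarith
  rw [e1, ibp]
  have nint : ‖∫ ξ in c..d, u' ξ * Complex.exp (Complex.I * ψ ξ)‖ ≤
      (M + 1 / 2) * (∫ ξ in c..d, 1 / (√ξ * |ψ₁ ξ|)) - (√d / ψ₁ d - √c / ψ₁ c) := by
    rw [← ftc, ← intervalIntegral.integral_const_mul, ← intervalIntegral.integral_sub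
      ((cw.intervalIntegrable_of_Icc hcd).const_mul _) (cF'.intervalIntegrable_of_Icc hcd)]
    refine (intervalIntegral.norm_integral_le_integral_norm hcd).trans ?_
    apply intervalIntegral.integral_mono_on hcd
    · exact ContinuousOn.intervalIntegrable_of_Icc hcd (by fun_prop)
    · exact ContinuousOn.intervalIntegrable_of_Icc hcd (by fun_prop)
    · exact nu'
  have hc' : c ∈ Set.Icc c d := ⟨le_rfl, hcd⟩
  have hd' : d ∈ Set.Icc c d := ⟨hcd, le_rfl⟩
  have b1 := nu c hc'
  have b2 := nu d hd'
  have q1 : √c / ψ₁ c ≤ √c / |ψ₁ c| := by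
    rw [← abs_of_nonneg (Real.sqrt_nonneg c), ← abs_div, abs_of_nonneg (Real.sqrt_nonneg c)]
    exact le_abs_self _
  have q2 : -(√d / ψ₁ d) ≤ √d / |ψ₁ d| := by
    rw [← abs_of_nonneg (Real.sqrt_nonneg d), ← abs_div, abs_of_nonneg (Real.sqrt_nonneg d)]
    exact neg_le_abs _
  refine (norm_sub_le _ _).trans ?_
  refine (add_le_add (norm_sub_le _ _) nint).trans ?_
  simp only [norm_mul, nexp, mul_one]
  linarith

theorem exists_critical_point {α β : ℝ} (hαβ : α ≤ β) {h : ℝ → ℝ}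
    (hc : ContinuousOn h (Set.Icc α β))
    (hmono : MonotoneOn (fun ξ => h ξ - 3 * ξ ^ 2) (Set.Icc α β)) :
    ∃ ξ₀ ∈ Set.Icc α β, (∀ ξ ∈ Set.Icc α β, ξ₀ < ξ → 3 * (ξ ^ 2 - ξ₀ ^ 2) ≤ h ξ) ∧
      (∀ ξ ∈ Set.Icc α β, ξ < ξ₀ → h ξ ≤ -(3 * (ξ₀ ^ 2 - ξ ^ 2))) := by
  have hα : α ∈ Set.Icc α β := ⟨le_rfl, hαβ⟩
  have hβ : β ∈ Set.Icc α β := ⟨hαβ, le_rfl⟩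
  rcases le_or_gt 0 (h α) with h1 | h1
  · refine ⟨α, hα, fun ξ hξ hlt => ?_, fun ξ hξ hlt => absurd hξ.1 (not_le.2 hlt)⟩
    have := hmono hα hξ hlt.le
    simp only at this; linarith
  rcases le_or_gt (h β) 0 with h2 | h2
  · refine ⟨β, hβ, fun ξ hξ hlt => absurd hξ.2 (not_le.2 hlt), fun ξ hξ hlt => ?_⟩
    have := hmono hξ hβ hlt.le
    simp only at this; linarith
  obtain ⟨ξ₀, hξ₀, hz⟩ := intermediate_value_Icc hαβ hc ⟨h1.le, h2.le⟩
  refine ⟨ξ₀, hξ₀, fun ξ hξ hlt => ?_, fun ξ hξ hlt => ?_⟩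
  · have := hmono hξ₀ hξ hlt.le
    simp only at this; linarith
  · have := hmono hξ hξ₀ hlt.le
    simp only at this; linarith

theorem norm_oscillatory_integral_le {α β M : ℝ} (hα : 0 < α) (hαβ : α ≤ β) (hM : 0 ≤ M)
    {ψ ψ₁ ψ₂ : ℝ → ℝ} {a a₁ : ℝ → ℂ}
    (hψ : ∀ ξ > 0, HasDerivAt ψ (ψ₁ ξ) ξ) (hψ₁ : ∀ ξ > 0, HasDerivAt ψ₁ (ψ₂ ξ) ξ)
    (hψ₂ : ContinuousOn ψ₂ (Set.Ioi 0)) (ha : ∀ ξ > 0, HasDerivAt a (a₁ ξ) ξ)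
    (ha₁ : ContinuousOn a₁ (Set.Ioi 0)) (hab : ∀ ξ > 0, ‖a ξ‖ ≤ √ξ)
    (ha₁b : ∀ ξ > 0, ‖a₁ ξ‖ ≤ M / √ξ) (hlow : ∀ ξ > 0, 6 * ξ ≤ ψ₂ ξ) :
    ‖∫ ξ in α..β, a ξ * Complex.exp (Complex.I * ψ ξ)‖ ≤ 7 + 2 * M := by
  have cψ₁ : ContinuousOn ψ₁ (Set.Icc α β) :=
    fun ξ h => (hψ₁ ξ (hα.trans_le h.1)).continuousAt.continuousWithinAt
  have dm : ∀ ξ > 0, HasDerivAt (fun ξ => ψ₁ ξ - 3 * ξ ^ 2) (ψ₂ ξ - 3 * (2 * ξ)) ξ := by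
    intro ξ h
    have := (hψ₁ ξ h).sub ((hasDerivAt_pow 2 ξ).const_mul 3)
    convert! this using 1
    norm_num
  have hmono : MonotoneOn (fun ξ => ψ₁ ξ - 3 * ξ ^ 2) (Set.Icc α β) := by
    apply monotoneOn_of_deriv_nonneg (convex_Icc α β)
    · fun_prop
    · intro ξ h
      rw [interior_Icc] at h
      exact (dm ξ (hα.trans h.1)).differentiableAt.differentiableWithinAt
    · intro ξ h
      rw [interior_Icc] at h
      rw [(dm ξ (hα.trans h.1)).deriv]
      linarith [hlow ξ (hα.trans h.1)]
  obtain ⟨ξ₀, hξ₀, hR, hL⟩ := exists_critical_point hαβ cψ₁ hmono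
  have hξ₀p : 0 < ξ₀ := hα.trans_le hξ₀.1
  set m := max 1 ξ₀ with hm
  have hm1 : 1 ≤ m := le_max_left _ _
  have hm0 : 0 < m := by linarith
  have hsm : 0 < √m := Real.sqrt_pos.2 hm0
  have hsm1 : 1 ≤ √m := by rw [← Real.sqrt_one]; exact Real.sqrt_le_sqrt hm1
  set r := 1 / √m with hr
  have hr0 : 0 < r := by positivity
  have hr1 : r ≤ 1 := by rw [hr, div_le_one hsm]; exact hsm1
  have hsmm : √m * √m = m := Real.mul_self_sqrt hm0.le
  have hrm : r * √m = 1 := by rw [hr]; field_simp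
  have kR : ∀ ξ, ξ₀ + r ≤ ξ → m ≤ ξ + ξ₀ := by
    intro ξ h
    rcases le_total 1 ξ₀ with h1 | h1
    · rw [hm, max_eq_right h1]; linarith
    · have : m = 1 := max_eq_left h1
      have : r = 1 := by rw [hr, this]; simp
      linarith
  have kL : ∀ ξ, 0 < ξ → ξ ≤ ξ₀ - r → m ≤ ξ₀ := by
    intro ξ h0 h
    rcases le_total 1 ξ₀ with h1 | h1
    · rw [hm, max_eq_right h1]
    · have : m = 1 := max_eq_left h1
      have : r = 1 := by rw [hr, this]; simp
      linarith
  have bd : ∀ ξ, 0 < ξ → m ≤ ξ + ξ₀ → r ≤ |ξ - ξ₀| → 3 * (|ξ - ξ₀| * (ξ + ξ₀)) ≤ |ψ₁ ξ| →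
      √ξ / |ψ₁ ξ| ≤ 1 / 3 := by
    intro ξ h0 h1 h2 h3
    have h4 : 3 * (r * (√m * √ξ)) ≤ |ψ₁ ξ| := by
      refine le_trans ?_ h3
      have : √m * √ξ ≤ ξ + ξ₀ := by
        have e1 : √m ≤ √(ξ + ξ₀) := Real.sqrt_le_sqrt h1
        have e2 : √ξ ≤ √(ξ + ξ₀) := Real.sqrt_le_sqrt (by linarith)
        calc √m * √ξ ≤ √(ξ + ξ₀) * √(ξ + ξ₀) := by gcongr
          _ = _ := Real.mul_self_sqrt (by linarith)
      gcongr
    rw [← mul_assoc r, hrm, one_mul] at h4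
    have hs := Real.sqrt_pos.2 h0
    rw [div_le_div_iff₀ (by linarith) (by norm_num)]
    linarith
  have signR : ∀ ξ ∈ Set.Icc α β, ξ₀ < ξ → 3 * (|ξ - ξ₀| * (ξ + ξ₀)) ≤ |ψ₁ ξ| := by
    intro ξ h h1
    have := hR ξ h h1
    rw [abs_of_pos (by linarith : 0 < ξ - ξ₀)]
    refine le_trans (le_of_eq (by ring)) (this.trans (le_abs_self _))
  have signL : ∀ ξ ∈ Set.Icc α β, ξ < ξ₀ → 3 * (|ξ - ξ₀| * (ξ + ξ₀)) ≤ |ψ₁ ξ| := by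
    intro ξ h h1
    have := hL ξ h h1
    rw [abs_of_neg (by linarith : ξ - ξ₀ < 0)]
    have h2 : 3 * (ξ₀ ^ 2 - ξ ^ 2) ≤ -ψ₁ ξ := by linarith
    refine le_trans (le_of_eq (by ring)) (h2.trans (neg_le_abs _))
  set c₁ := max α (ξ₀ - r) with hc₁
  set c₂ := min β (ξ₀ + r) with hc₂
  have l1 : α ≤ c₁ := le_max_left _ _
  have l2 : c₁ ≤ ξ₀ := max_le hξ₀.1 (by linarith)
  have l3 : ξ₀ ≤ c₂ := le_min hξ₀.2 (by linarith)
  have l4 : c₂ ≤ β := min_le_left _ _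
  have cG : ContinuousOn (fun ξ => a ξ * Complex.exp (Complex.I * ψ ξ)) (Set.Ioi 0) := by
    intro ξ h
    have h1 := (ha ξ h).continuousAt
    have h2 : ContinuousAt (fun ξ => (ψ ξ : ℂ)) ξ := (hψ ξ h).ofReal_comp.continuousAt
    exact (h1.mul (h2.const_mul Complex.I).cexp).continuousWithinAt
  have ii : ∀ x y : ℝ, 0 < x → x ≤ y → IntervalIntegrable
      (fun ξ => a ξ * Complex.exp (Complex.I * ψ ξ)) volume x y := fun x y hx hxy =>
    (cG.mono fun z hz => hx.trans_le hz.1).intervalIntegrable_of_Icc hxy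
  have hc₁0 : 0 < c₁ := hα.trans_le l1
  have hc₂0 : 0 < c₂ := hξ₀p.trans_le l3
  have split : ∫ ξ in α..β, a ξ * Complex.exp (Complex.I * ψ ξ) =
      (∫ ξ in α..c₁, a ξ * Complex.exp (Complex.I * ψ ξ)) +
      (∫ ξ in c₁..c₂, a ξ * Complex.exp (Complex.I * ψ ξ)) +
      ∫ ξ in c₂..β, a ξ * Complex.exp (Complex.I * ψ ξ) := by
    rw [intervalIntegral.integral_add_adjacent_intervals (ii _ _ hα l1)
      (ii _ _ hc₁0 (l2.trans l3)), intervalIntegral.integral_add_adjacent_intervals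
      (ii _ _ hα (l1.trans (l2.trans l3))) (ii _ _ hc₂0 l4)]
  have mid : ‖∫ ξ in c₁..c₂, a ξ * Complex.exp (Complex.I * ψ ξ)‖ ≤ 3 := by
    have h1 : ∀ ξ ∈ Set.uIoc c₁ c₂, ‖a ξ * Complex.exp (Complex.I * ψ ξ)‖ ≤ 3 / 2 * √m := by
      intro ξ h
      rw [Set.uIoc_of_le (l2.trans l3)] at h
      have h0 : 0 < ξ := hc₁0.trans h.1
      rw [norm_mul, mul_comm Complex.I, Complex.norm_exp_ofReal_mul_I, mul_one]
      refine (hab ξ h0).trans ?_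
      have : ξ ≤ 2 * m := by
        have := h.2.trans (min_le_right β (ξ₀ + r))
        have : ξ₀ ≤ m := le_max_right _ _
        linarith
      rw [show 3 / 2 * √m = √((3 / 2) ^ 2 * m) by
        rw [Real.sqrt_mul (by positivity), Real.sqrt_sq (by positivity)]]
      exact Real.sqrt_le_sqrt (by linarith)
    refine (intervalIntegral.norm_integral_le_of_norm_le_const h1).trans ?_
    have : |c₂ - c₁| ≤ 2 * r := by
      rw [abs_of_nonneg (by linarith)]
      have := le_max_right α (ξ₀ - r)
      have := min_le_right β (ξ₀ + r)
      linarith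
    calc 3 / 2 * √m * |c₂ - c₁| ≤ 3 / 2 * √m * (2 * r) := by gcongr
      _ = 3 * (r * √m) := by ring
      _ ≤ 3 := by rw [hrm]; norm_num
  have left : ‖∫ ξ in α..c₁, a ξ * Complex.exp (Complex.I * ψ ξ)‖ ≤ 5 / 3 + 2 / 3 * M := by
    rcases l1.eq_or_lt with h | h
    · rw [← h]; simp; positivity
    have hce : c₁ = ξ₀ - r := by
      rcases max_choice α (ξ₀ - r) with h' | h'
      · exact absurd h' h.ne'
      · exact h'
    have hmξ : m ≤ ξ₀ := kL c₁ hc₁0 hce.le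
    have hmξ' : ξ₀ ≤ m := le_max_right _ _
    have ins : ∀ ξ ∈ Set.Icc α c₁, ξ ∈ Set.Icc α β ∧ 0 < ξ ∧ ξ < ξ₀ ∧ r ≤ |ξ - ξ₀| := by
      intro ξ hξ
      have : ξ ≤ ξ₀ - r := hξ.2.trans hce.le
      refine ⟨⟨hξ.1, by linarith [hξ₀.2]⟩, hα.trans_le hξ.1, by linarith, ?_⟩
      rw [abs_of_neg (by linarith)]; linarith
    have hb : ∀ ξ ∈ Set.Icc α c₁, √ξ / |ψ₁ ξ| ≤ 1 / 3 := fun ξ hξ => by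
      obtain ⟨i1, i2, i3, i4⟩ := ins ξ hξ
      exact bd ξ i2 (by linarith) i4 (signL ξ i1 i3)
    have hlo : ∀ ξ ∈ Set.Icc α c₁, 3 * (r * m) ≤ |ψ₁ ξ| := fun ξ hξ => by
      obtain ⟨i1, i2, i3, i4⟩ := ins ξ hξ
      refine le_trans ?_ (signL ξ i1 i3)
      gcongr
      linarith
    have hlo0 : 0 < 3 * (r * m) := by positivity
    have hne : ∀ ξ ∈ Set.Icc α c₁, ψ₁ ξ ≠ 0 := fun ξ hξ =>
      abs_pos.1 (hlo0.trans_le (hlo ξ hξ))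
    refine (norm_oscillatory_integral_le_boundary (M := M) hα l1 hψ hψ₁ hψ₂ ha ha₁ hab ha₁b
      (fun ξ hξ => ?_) hne).trans ?_
    · obtain ⟨i1, i2, i3, i4⟩ := ins ξ hξ
      linarith [hlow ξ i2]
    have hint : ∫ ξ in α..c₁, 1 / (√ξ * |ψ₁ ξ|) ≤ 2 / 3 := by
      have dS : ∀ ξ ∈ Set.uIcc α c₁, HasDerivAt (fun ξ => 2 / (3 * (r * m)) * √ξ)
          (2 / (3 * (r * m)) * (1 / (2 * √ξ))) ξ := by
        intro ξ hξ
        rw [Set.uIcc_of_le l1] at hξ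
        exact (Real.hasDerivAt_sqrt (ins ξ hξ).2.1.ne').const_mul _
      have cS : IntervalIntegrable (fun ξ => 2 / (3 * (r * m)) * (1 / (2 * √ξ))) volume α c₁ := by
        apply ContinuousOn.intervalIntegrable_of_Icc l1
        refine ContinuousOn.mul (by fun_prop) (ContinuousOn.div (by fun_prop) (by fun_prop) ?_)
        exact fun ξ hξ => mul_ne_zero two_ne_zero (Real.sqrt_pos.2 (ins ξ hξ).2.1).ne'
      have ftc := intervalIntegral.integral_eq_sub_of_hasDerivAt dS cS
      have hle : ∫ ξ in α..c₁, 1 / (√ξ * |ψ₁ ξ|) ≤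
          ∫ ξ in α..c₁, 2 / (3 * (r * m)) * (1 / (2 * √ξ)) := by
        apply intervalIntegral.integral_mono_on l1 _ cS
        · intro ξ hξ
          have hs := Real.sqrt_pos.2 (ins ξ hξ).2.1
          calc 1 / (√ξ * |ψ₁ ξ|) ≤ 1 / (√ξ * (3 * (r * m))) := by gcongr; exact hlo ξ hξ
            _ = _ := by field_simp
        · apply ContinuousOn.intervalIntegrable_of_Icc l1
          refine ContinuousOn.div (by fun_prop) (ContinuousOn.mul (by fun_prop)
            (cψ₁.mono fun ξ hξ => (ins ξ hξ).1).abs) fun ξ hξ =>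
            mul_ne_zero (Real.sqrt_pos.2 (ins ξ hξ).2.1).ne' (abs_ne_zero.2 (hne ξ hξ))
      rw [ftc] at hle
      refine hle.trans ?_
      have e1 : √c₁ ≤ √m := Real.sqrt_le_sqrt (by linarith)
      have e2 : r * m = √m := by
        calc r * m = r * √m * √m := by rw [mul_assoc, hsmm]
          _ = √m := by rw [hrm, one_mul]
      rw [e2]
      calc 2 / (3 * √m) * √c₁ - 2 / (3 * √m) * √α ≤ 2 / (3 * √m) * √m := by
            have : 0 ≤ 2 / (3 * √m) * √α := by positivity
            have : 2 / (3 * √m) * √c₁ ≤ 2 / (3 * √m) * √m := by gcongr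
            linarith
        _ = 2 / 3 := by field_simp
    have h1 := hb α ⟨le_rfl, l1⟩
    have h2 := hb c₁ ⟨l1, le_rfl⟩
    have h3 : (M + 1 / 2) * ∫ ξ in α..c₁, 1 / (√ξ * |ψ₁ ξ|) ≤ (M + 1 / 2) * (2 / 3) := by gcongr
    linarith
  have right : ‖∫ ξ in c₂..β, a ξ * Complex.exp (Complex.I * ψ ξ)‖ ≤ 5 / 3 + 2 / 3 * M := by
    rcases l4.eq_or_lt with h | h
    · rw [← h]; simp; positivity
    have hce : c₂ = ξ₀ + r := by
      rcases min_choice β (ξ₀ + r) with h' | h'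
      · exact absurd h' h.ne
      · exact h'
    have ins : ∀ ξ ∈ Set.Icc c₂ β, ξ ∈ Set.Icc α β ∧ 0 < ξ ∧ ξ₀ < ξ ∧ r ≤ |ξ - ξ₀| ∧
        m ≤ ξ + ξ₀ ∧ r ≤ ξ - ξ₀ := by
      intro ξ hξ
      have : ξ₀ + r ≤ ξ := hce.ge.trans hξ.1
      refine ⟨⟨by linarith [hξ₀.1], hξ.2⟩, hc₂0.trans_le hξ.1, by linarith, ?_, kR ξ this,
        by linarith⟩
      rw [abs_of_pos (by linarith)]; linarith
    have hb : ∀ ξ ∈ Set.Icc c₂ β, √ξ / |ψ₁ ξ| ≤ 1 / 3 := fun ξ hξ => by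
      obtain ⟨i1, i2, i3, i4, i5, i6⟩ := ins ξ hξ
      exact bd ξ i2 i5 i4 (signR ξ i1 i3)
    have hlo : ∀ ξ ∈ Set.Icc c₂ β, 3 * ((ξ - ξ₀) * m) ≤ |ψ₁ ξ| := fun ξ hξ => by
      obtain ⟨i1, i2, i3, i4, i5, i6⟩ := ins ξ hξ
      refine le_trans ?_ (signR ξ i1 i3)
      rw [abs_of_pos (by linarith : 0 < ξ - ξ₀)]
      have : 0 < ξ - ξ₀ := by linarith
      gcongr
    have hne : ∀ ξ ∈ Set.Icc c₂ β, ψ₁ ξ ≠ 0 := fun ξ hξ => by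
      obtain ⟨i1, i2, i3, i4, i5, i6⟩ := ins ξ hξ
      have : 0 < ξ - ξ₀ := by linarith
      exact abs_pos.1 ((by positivity : 0 < 3 * ((ξ - ξ₀) * m)).trans_le (hlo ξ hξ))
    refine (norm_oscillatory_integral_le_boundary (M := M) hc₂0 l4 hψ hψ₁ hψ₂ ha ha₁ hab ha₁b
      (fun ξ hξ => ?_) hne).trans ?_
    · obtain ⟨i1, i2, i3, i4⟩ := ins ξ hξ
      linarith [hlow ξ i2]
    have hint : ∫ ξ in c₂..β, 1 / (√ξ * |ψ₁ ξ|) ≤ 2 / 3 := by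
      have dS : ∀ ξ ∈ Set.uIcc c₂ β, HasDerivAt (fun ξ => -(2 / (3 * m)) * (√(ξ - ξ₀))⁻¹)
          (-(2 / (3 * m)) * (-(1 / (2 * √(ξ - ξ₀))) / √(ξ - ξ₀) ^ 2)) ξ := by
        intro ξ hξ
        rw [Set.uIcc_of_le l4] at hξ
        obtain ⟨i1, i2, i3, i4, i5, i6⟩ := ins ξ hξ
        have hp : 0 < ξ - ξ₀ := by linarith
        exact ((((hasDerivAt_id ξ).sub_const ξ₀).sqrt hp.ne').inv
          (Real.sqrt_pos.2 hp).ne').const_mul _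
      have cS : IntervalIntegrable (fun ξ => -(2 / (3 * m)) *
          (-(1 / (2 * √(ξ - ξ₀))) / √(ξ - ξ₀) ^ 2)) volume c₂ β := by
        apply ContinuousOn.intervalIntegrable_of_Icc l4
        refine ContinuousOn.mul (by fun_prop) (ContinuousOn.div (ContinuousOn.neg
          (ContinuousOn.div (by fun_prop) (by fun_prop) ?_)) (by fun_prop) ?_)
        · intro ξ hξ
          obtain ⟨i1, i2, i3, i4, i5, i6⟩ := ins ξ hξ
          exact mul_ne_zero two_ne_zero (Real.sqrt_pos.2 (by linarith)).ne'
        · intro ξ hξ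
          obtain ⟨i1, i2, i3, i4, i5, i6⟩ := ins ξ hξ
          exact pow_ne_zero _ (Real.sqrt_pos.2 (by linarith)).ne'
      have ftc := intervalIntegral.integral_eq_sub_of_hasDerivAt dS cS
      have hle : ∫ ξ in c₂..β, 1 / (√ξ * |ψ₁ ξ|) ≤
          ∫ ξ in c₂..β, -(2 / (3 * m)) * (-(1 / (2 * √(ξ - ξ₀))) / √(ξ - ξ₀) ^ 2) := by
        apply intervalIntegral.integral_mono_on l4 _ cS
        · intro ξ hξ
          obtain ⟨i1, i2, i3, i4, i5, i6⟩ := ins ξ hξ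
          have hp : 0 < ξ - ξ₀ := by linarith
          have hs := Real.sqrt_pos.2 hp
          calc 1 / (√ξ * |ψ₁ ξ|) ≤ 1 / (√(ξ - ξ₀) * (3 * ((ξ - ξ₀) * m))) := by
                gcongr
                · linarith
                · exact hlo ξ hξ
            _ = _ := by rw [Real.sq_sqrt hp.le]; field_simp
        · apply ContinuousOn.intervalIntegrable_of_Icc l4
          refine ContinuousOn.div (by fun_prop) (ContinuousOn.mul (by fun_prop)
            (cψ₁.mono fun ξ hξ => (ins ξ hξ).1).abs) fun ξ hξ =>
            mul_ne_zero (Real.sqrt_pos.2 (ins ξ hξ).2.1).ne' (abs_ne_zero.2 (hne ξ hξ))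
      rw [ftc] at hle
      refine hle.trans ?_
      have hcr : c₂ - ξ₀ = r := by linarith
      rw [hcr]
      have e0 : 0 ≤ 2 / (3 * m) * (√(β - ξ₀))⁻¹ := by positivity
      have e1 : (√r)⁻¹ ≤ m := by
        have : (√r)⁻¹ = √(√m) := by
          rw [hr, Real.sqrt_div zero_le_one, Real.sqrt_one, one_div, inv_inv]
        rw [this]
        calc √√m ≤ √m := by
              rw [Real.sqrt_le_left hsm.le]; nlinarith
          _ ≤ m := by nlinarith
      have e2 : 2 / (3 * m) * (√r)⁻¹ ≤ 2 / (3 * m) * m := by gcongr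
      have e3 : 2 / (3 * m) * m = 2 / 3 := by field_simp
      linarith
    have h1 := hb c₂ ⟨le_rfl, l4⟩
    have h2 := hb β ⟨l4, le_rfl⟩
    have h3 : (M + 1 / 2) * ∫ ξ in c₂..β, 1 / (√ξ * |ψ₁ ξ|) ≤ (M + 1 / 2) * (2 / 3) := by gcongr
    linarith
  rw [split]
  refine (norm_add_le _ _).trans ?_
  have := norm_add_le (∫ ξ in α..c₁, a ξ * Complex.exp (Complex.I * ψ ξ))
    (∫ ξ in c₁..c₂, a ξ * Complex.exp (Complex.I * ψ ξ))
  linarith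

theorem norm_airy_type_integral_le_one {α β x A B y : ℝ} (hα : 0 < α) (hαβ : α ≤ β)
    (hA : 0 ≤ A) (hB : 0 ≤ B) :
    ‖∫ ξ in α..β, (√ξ * Complex.exp (Complex.I * (y * Real.log ξ) - A / ξ)) *
      Complex.exp (Complex.I * ((ξ ^ 3 + x * ξ + B / ξ : ℝ) : ℂ))‖ ≤ 10 + 2 * |y| := by
  have key := norm_oscillatory_integral_le (α := α) (β := β) (M := 3 / 2 + |y|) hα hαβ
    (by positivity)
    (ψ := fun ξ => ξ ^ 3 + x * ξ + B / ξ) (ψ₁ := fun ξ => 3 * ξ ^ 2 + x - B / ξ ^ 2)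
    (ψ₂ := fun ξ => 6 * ξ + 2 * B / ξ ^ 3)
    (a := fun ξ => √ξ * Complex.exp (Complex.I * (y * Real.log ξ) - A / ξ))
    (a₁ := fun ξ => ((1 / (2 * √ξ) : ℝ) : ℂ) *
      Complex.exp (Complex.I * (y * Real.log ξ) - A / ξ) +
      √ξ * (Complex.exp (Complex.I * (y * Real.log ξ) - A / ξ) *
        (Complex.I * (y * ((ξ⁻¹ : ℝ) : ℂ)) - ((-A / ξ ^ 2 : ℝ) : ℂ))))
    ?_ ?_ ?_ ?_ ?_ ?_ ?_ ?_
  · refine key.trans (by linarith)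
  · intro ξ h
    have h1 := ((hasDerivAt_pow 3 ξ).add ((hasDerivAt_id ξ).const_mul x)).add
      ((hasDerivAt_const ξ B).div (hasDerivAt_id ξ) h.ne')
    convert! h1 using 1
    simp; ring
  · intro ξ h
    have h1 := (((hasDerivAt_pow 2 ξ).const_mul 3).add_const x).sub
      ((hasDerivAt_const ξ B).div (hasDerivAt_pow 2 ξ) (pow_ne_zero 2 h.ne'))
    convert! h1 using 1
    have : ξ ≠ 0 := h.ne'
    norm_num; field_simp; ring
  · apply ContinuousOn.add (by fun_prop)
    exact ContinuousOn.div (by fun_prop) (by fun_prop) fun ξ h => pow_ne_zero 3 (ne_of_gt h)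
  · intro ξ h
    have hA' : HasDerivAt (fun ξ : ℝ => ((A / ξ : ℝ) : ℂ)) ((-A / ξ ^ 2 : ℝ) : ℂ) ξ := by
      have h1 := ((hasDerivAt_const ξ A).div (hasDerivAt_id ξ) (ne_of_gt h)).ofReal_comp
      convert! h1 using 1
      simp
    have hl := (((Real.hasDerivAt_log (ne_of_gt h)).ofReal_comp.const_mul (y : ℂ)).const_mul
      Complex.I).sub hA'
    have h2 := (Real.hasDerivAt_sqrt (ne_of_gt h)).ofReal_comp.mul hl.cexp
    convert! h2 using 1
    · ext ξ; simp
    · simp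
  · have c0 : ∀ ξ ∈ Set.Ioi (0 : ℝ), ξ ≠ 0 := fun ξ h => ne_of_gt h
    have c1 : ContinuousOn (fun ξ : ℝ => (Real.log ξ : ℂ)) (Set.Ioi 0) :=
      Complex.continuous_ofReal.comp_continuousOn (Real.continuousOn_log.mono c0)
    have c2 : ContinuousOn (fun ξ : ℝ => (A : ℂ) / ξ) (Set.Ioi 0) :=
      ContinuousOn.div (by fun_prop) (by fun_prop) fun ξ h => by exact_mod_cast c0 ξ h
    have c3 : ContinuousOn (fun ξ : ℝ => ((ξ⁻¹ : ℝ) : ℂ)) (Set.Ioi 0) :=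
      Complex.continuous_ofReal.comp_continuousOn (continuousOn_id.inv₀ c0)
    have c4 : ContinuousOn (fun ξ : ℝ => ((-A / ξ ^ 2 : ℝ) : ℂ)) (Set.Ioi 0) :=
      Complex.continuous_ofReal.comp_continuousOn
        (ContinuousOn.div (by fun_prop) (by fun_prop) fun ξ h => pow_ne_zero 2 (c0 ξ h))
    have c5 : ContinuousOn (fun ξ : ℝ => ((1 / (2 * √ξ) : ℝ) : ℂ)) (Set.Ioi 0) :=
      Complex.continuous_ofReal.comp_continuousOn
        (ContinuousOn.div (by fun_prop) (by fun_prop)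
          fun ξ h => mul_ne_zero two_ne_zero (Real.sqrt_pos.2 h).ne')
    have c6 : ContinuousOn (fun ξ : ℝ => ((√ξ : ℝ) : ℂ)) (Set.Ioi 0) := by fun_prop
    fun_prop
  · intro ξ h
    have h1 : ‖Complex.exp (Complex.I * (y * Real.log ξ) - A / ξ)‖ ≤ 1 := by
      rw [Complex.norm_exp, Real.exp_le_one_iff]
      have : (Complex.I * (y * Real.log ξ) - A / ξ : ℂ).re = -(A / ξ) := by
        rw [← Complex.ofReal_div, ← Complex.ofReal_mul]; simp
      rw [this]
      have : 0 ≤ A / ξ := div_nonneg hA (le_of_lt h)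
      linarith
    rw [norm_mul, Complex.norm_real, Real.norm_of_nonneg (Real.sqrt_nonneg _)]
    exact mul_le_of_le_one_right (Real.sqrt_nonneg _) h1
  · intro ξ h
    have hs := Real.sqrt_pos.2 h
    have hss : √ξ * √ξ = ξ := Real.mul_self_sqrt (le_of_lt h)
    have hAξ : 0 ≤ A / ξ := div_nonneg hA (le_of_lt h)
    have hE : ‖Complex.exp (Complex.I * (y * Real.log ξ) - A / ξ)‖ = Real.exp (-(A / ξ)) := by
      rw [Complex.norm_exp]
      congr 1
      rw [← Complex.ofReal_div, ← Complex.ofReal_mul]; simp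
    have hE1 : Real.exp (-(A / ξ)) ≤ 1 := by rw [Real.exp_le_one_iff]; linarith
    have hE2 : A / ξ * Real.exp (-(A / ξ)) ≤ 1 := by
      rw [Real.exp_neg, ← div_eq_mul_inv, div_le_one (Real.exp_pos _)]
      linarith [Real.add_one_le_exp (A / ξ)]
    refine (norm_add_le _ _).trans ?_
    rw [norm_mul, norm_mul, norm_mul, hE, Complex.norm_real, Complex.norm_real, Real.norm_of_nonneg
      (by positivity : 0 ≤ 1 / (2 * √ξ)), Real.norm_of_nonneg hs.le]
    have h3 : ‖Complex.I * (y * ((ξ⁻¹ : ℝ) : ℂ)) - ((-A / ξ ^ 2 : ℝ) : ℂ)‖ ≤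
        |y| / ξ + A / ξ / ξ := by
      refine (norm_sub_le _ _).trans (le_of_eq ?_)
      rw [norm_mul, norm_mul, Complex.norm_I, Complex.norm_real, Complex.norm_real,
        Complex.norm_real, Real.norm_eq_abs, Real.norm_eq_abs, Real.norm_eq_abs, abs_div, abs_neg,
        abs_of_nonneg hA, abs_inv, abs_of_pos h, abs_of_nonneg (by positivity : 0 ≤ ξ ^ 2)]
      field_simp
    calc 1 / (2 * √ξ) * Real.exp (-(A / ξ)) + √ξ * (Real.exp (-(A / ξ)) *
          ‖Complex.I * (y * ((ξ⁻¹ : ℝ) : ℂ)) - ((-A / ξ ^ 2 : ℝ) : ℂ)‖)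
        ≤ 1 / (2 * √ξ) * Real.exp (-(A / ξ)) + √ξ * (Real.exp (-(A / ξ)) *
          (|y| / ξ + A / ξ / ξ)) := by gcongr
      _ = 1 / (2 * √ξ) * Real.exp (-(A / ξ)) + (√ξ / ξ) * (|y| * Real.exp (-(A / ξ)) +
          (A / ξ * Real.exp (-(A / ξ)))) := by ring
      _ ≤ 1 / (2 * √ξ) * 1 + (√ξ / ξ) * (|y| * 1 + 1) := by gcongr
      _ = (3 / 2 + |y|) / √ξ := by
          have : √ξ / ξ = 1 / √ξ := by
            rw [div_eq_div_iff (ne_of_gt h) hs.ne', hss, one_mul]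
          rw [this]; field_simp; ring
  · intro ξ h
    have : 0 ≤ 2 * B / ξ ^ 3 := div_nonneg (by positivity) (pow_nonneg (le_of_lt h) 3)
    linarith

theorem norm_airy_type_integral_le_of_pos {α β x A B y t : ℝ} (hα : 0 < α) (hαβ : α ≤ β)
    (hA : 0 ≤ A) (hB : 0 ≤ B) (ht : 0 < t) :
    ‖∫ ξ in α..β, (√ξ * Complex.exp (Complex.I * (y * Real.log ξ) - A / ξ)) *
      Complex.exp (Complex.I * ((t * ξ ^ 3 + x * ξ + B / ξ : ℝ) : ℂ))‖ ≤
      (10 + 2 * |y|) / √t := by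
  set s := t ^ (1 / 3 : ℝ) with hs
  have hs0 : 0 < s := by positivity
  have hs3 : s ^ 3 = t := by
    rw [hs, ← Real.rpow_natCast, ← Real.rpow_mul ht.le]; norm_num
  have key := norm_airy_type_integral_le_one (α := s * α) (β := s * β) (x := x / s) (A := A * s)
    (B := B * s) (y := y) (by positivity) (by gcongr) (by positivity) (by positivity)
  rw [← intervalIntegral.smul_integral_comp_mul_left, norm_smul,
    Real.norm_of_nonneg hs0.le] at key
  have e : ∫ ξ in α..β, (√(s * ξ) * Complex.exp (Complex.I * (y * Real.log (s * ξ)) -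
      ((A * s : ℝ) : ℂ) / ((s * ξ : ℝ) : ℂ))) * Complex.exp (Complex.I *
        (((s * ξ) ^ 3 + x / s * (s * ξ) + B * s / (s * ξ) : ℝ) : ℂ)) =
      (√s * Complex.exp (Complex.I * (y * Real.log s))) *
      ∫ ξ in α..β, (√ξ * Complex.exp (Complex.I * (y * Real.log ξ) - A / ξ)) *
      Complex.exp (Complex.I * ((t * ξ ^ 3 + x * ξ + B / ξ : ℝ) : ℂ)) := by
    rw [← intervalIntegral.integral_const_mul]
    apply intervalIntegral.integral_congr
    intro ξ h
    rw [Set.uIcc_of_le hαβ] at h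
    have h0 : 0 < ξ := hα.trans_le h.1
    have p1 : (s * ξ) ^ 3 + x / s * (s * ξ) + B * s / (s * ξ) = t * ξ ^ 3 + x * ξ + B / ξ := by
      rw [← hs3]; field_simp
    have p2 : ((A * s : ℝ) : ℂ) / ((s * ξ : ℝ) : ℂ) = A / ξ := by
      have : (s : ℂ) ≠ 0 := by exact_mod_cast hs0.ne'
      have : (ξ : ℂ) ≠ 0 := by exact_mod_cast h0.ne'
      push_cast; field_simp
    simp only [p1, p2]
    rw [Real.sqrt_mul hs0.le, Real.log_mul hs0.ne' h0.ne']
    have : Complex.exp (Complex.I * (y * ((Real.log s + Real.log ξ : ℝ) : ℂ)) - A / ξ) =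
        Complex.exp (Complex.I * (y * Real.log s)) *
          Complex.exp (Complex.I * (y * Real.log ξ) - A / ξ) := by
      rw [← Complex.exp_add]; congr 1; push_cast; ring
    rw [this]
    push_cast
    ring
  rw [e, norm_mul, norm_mul, Complex.norm_real, Real.norm_of_nonneg (Real.sqrt_nonneg s),
    ← Complex.ofReal_mul, mul_comm Complex.I, Complex.norm_exp_ofReal_mul_I, mul_one,
    ← mul_assoc] at key
  have hst : s * √s = √t := by
    rw [← hs3, show s ^ 3 = s ^ 2 * s by ring, Real.sqrt_mul (by positivity),
      Real.sqrt_sq hs0.le]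
  rw [hst] at key
  rw [le_div_iff₀ (Real.sqrt_pos.2 ht), mul_comm]
  exact key

theorem norm_airy_type_integral_le {α β x A B y t : ℝ} (hα : 0 < α) (hαβ : α ≤ β)
    (hA : 0 ≤ A) (hB : 0 ≤ t * B) (ht : t ≠ 0) :
    ‖∫ ξ in α..β, (√ξ * Complex.exp (Complex.I * (y * Real.log ξ) - A / ξ)) *
      Complex.exp (-(Complex.I * ((t * ξ ^ 3 + x * ξ + B / ξ : ℝ) : ℂ)))‖ ≤
      (10 + 2 * |y|) / √|t| := by
  rcases lt_or_gt_of_ne ht with h | h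
  · have hB' : 0 ≤ -B := by nlinarith
    have key := norm_airy_type_integral_le_of_pos (x := -x) (y := y) hα hαβ hA hB'
      (neg_pos.2 h)
    rw [abs_of_neg h]
    convert! key using 5 with ξ
    rw [← mul_neg, ← Complex.ofReal_neg]
    congr 3
    ring
  · have hB' : 0 ≤ B := by nlinarith
    have key := norm_airy_type_integral_le_of_pos (x := x) (y := -y) hα hαβ hA hB' h
    rw [abs_of_pos h]
    rw [abs_neg, ← Complex.norm_conj, intervalIntegral.integral_of_le hαβ, ← integral_conj] at key
    rw [intervalIntegral.integral_of_le hαβ]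
    refine le_of_eq_of_le (congrArg norm (integral_congr_ae (ae_of_all _ fun ξ => ?_))) key
    beta_reduce
    rw [map_mul, map_mul, Complex.conj_ofReal, ← Complex.exp_conj, ← Complex.exp_conj]
    simp

theorem cpow_half_ofReal_mul {c : ℝ} (hc : 0 < c) {w : ℂ} (hw : w ≠ 0) :
    ((c : ℂ) * w) ^ (1 / 2 : ℂ) = (√c : ℂ) * w ^ (1 / 2 : ℂ) := by
  have hc' : (c : ℂ) ≠ 0 := by exact_mod_cast hc.ne'
  rw [Complex.cpow_def_of_ne_zero (mul_ne_zero hc' hw), Complex.cpow_def_of_ne_zero hw,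
    Complex.log_ofReal_mul hc hw, add_mul, Complex.exp_add]
  congr 1
  rw [Real.sqrt_eq_rpow, Complex.ofReal_cpow hc.le, Complex.cpow_def_of_ne_zero hc',
    Complex.ofReal_log hc.le]
  norm_num

theorem integral_gaussian_slice {δ t y v₁ v₂ ξ : ℝ} (hδ : 0 < δ) (ht : t ≠ 0) (hξ : 0 < ξ) :
    ∫ η : ℝ, Complex.exp (-(δ * ξ * η ^ 2 : ℝ) - Complex.I * (t * phiNV ξ η : ℝ) +
      (1 + Complex.I * y) * Real.log ξ - Complex.I * (v₁ * ξ + v₂ * η : ℝ)) =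
    (Real.pi / (δ - 3 * t * Complex.I)) ^ (1 / 2 : ℂ) *
      ((√ξ * Complex.exp (Complex.I * (y * Real.log ξ) -
        (v₂ ^ 2 * δ / (4 * (δ ^ 2 + 9 * t ^ 2)) : ℝ) / ξ)) *
      Complex.exp (-(Complex.I * ((t * ξ ^ 3 + v₁ * ξ +
        (3 * t * v₂ ^ 2 / (4 * (δ ^ 2 + 9 * t ^ 2))) / ξ : ℝ) : ℂ)))) := by
  set w : ℂ := δ - 3 * t * Complex.I with hw
  have hre : w.re = δ := by simp [hw]
  have hw0 : w ≠ 0 := fun h => by rw [h] at hre; simp at hre; exact hδ.ne hre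
  have hξ0 : (ξ : ℂ) ≠ 0 := by exact_mod_cast hξ.ne'
  have h1 := integral_cexp_quadratic (b := -(w * ξ)) (by simp [hre]; positivity)
    (-(Complex.I * v₂)) (-(Complex.I * (t * ξ ^ 3 + v₁ * ξ)) +
      (1 + Complex.I * y) * Real.log ξ)
  have h2 : (Real.pi / -(-(w * ξ)) : ℂ) ^ (1 / 2 : ℂ) =
      (√(1 / ξ) : ℂ) * (Real.pi / w) ^ (1 / 2 : ℂ) := by
    rw [← cpow_half_ofReal_mul (by positivity) (div_ne_zero (by
      exact_mod_cast Real.pi_pos.ne') hw0)]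
    congr 1
    push_cast
    field_simp
  have h3 : Complex.exp (Real.log ξ : ℂ) = ξ := by
    rw [← Complex.ofReal_exp, Real.exp_log hξ]
  have h4 : (√(1 / ξ) : ℂ) * ξ = √ξ := by
    have hs := Real.sqrt_pos.2 hξ
    have : √(1 / ξ) * ξ = √ξ := by
      rw [Real.sqrt_div zero_le_one, Real.sqrt_one]
      field_simp
      exact (Real.sq_sqrt hξ.le).symm
    exact_mod_cast this
  have h5 : (-(Complex.I * v₂)) ^ 2 / (4 * -(w * ξ)) =
      (v₂ ^ 2 * δ / (4 * (δ ^ 2 + 9 * t ^ 2)) : ℝ) / ξ +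
        Complex.I * ((3 * t * v₂ ^ 2 / (4 * (δ ^ 2 + 9 * t ^ 2))) / ξ : ℝ) := by
    have e : ((δ : ℂ) ^ 2 + 9 * t ^ 2) = w * (δ + 3 * t * Complex.I) := by
      rw [hw]; ring_nf; rw [Complex.I_sq]; ring
    have hD : ((δ : ℂ) ^ 2 + 9 * t ^ 2) ≠ 0 := by
      have : δ ^ 2 + 9 * t ^ 2 ≠ 0 := by positivity
      exact_mod_cast this
    have e3 : 1 / w = (δ + 3 * t * Complex.I) / ((δ : ℂ) ^ 2 + 9 * t ^ 2) := by
      rw [div_eq_div_iff hw0 hD, e]; ring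
    have : (-(Complex.I * v₂)) ^ 2 / (4 * -(w * ξ)) = (1 / w) * (v₂ ^ 2 / (4 * ξ)) := by
      rw [neg_sq, mul_pow, Complex.I_sq]; field_simp
    rw [this, e3]
    push_cast
    field_simp
  have e : ∀ η : ℝ, Complex.exp (-(δ * ξ * η ^ 2 : ℝ) - Complex.I * (t * phiNV ξ η : ℝ) +
      (1 + Complex.I * y) * Real.log ξ - Complex.I * (v₁ * ξ + v₂ * η : ℝ)) =
      Complex.exp (-(w * ξ) * η ^ 2 + -(Complex.I * v₂) * η + (-(Complex.I * (t * ξ ^ 3 + v₁ * ξ)) +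
      (1 + Complex.I * y) * Real.log ξ)) := by
    intro η
    congr 1
    rw [hw, phiNV]
    push_cast
    ring
  simp_rw [e]
  rw [h1, h2, h5, ← h4]
  have h6 : ∀ X Y : ℂ, Complex.exp X = ξ * Complex.exp Y ↔ Complex.exp X =
      Complex.exp (Real.log ξ + Y) := by
    intro X Y
    rw [Complex.exp_add, h3]
  have h7 : ∀ X Y Z W : ℂ, X = ξ * (Y * Z) → (√(1 / ξ) : ℂ) * W * X =
      W * ((√(1 / ξ) * ξ) * Y * Z) := by
    intro X Y Z W h
    rw [h]; ring
  apply h7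
  rw [← Complex.exp_add, h6]
  congr 1
  push_cast
  ring

theorem integrable_gaussian_strip {α β δ : ℝ} (hα : 0 < α) (hδ : 0 < δ) :
    Integrable (fun k : ℝ × ℝ => Real.exp (-(δ * k.1 * k.2 ^ 2)))
      (volume.restrict (Set.Ioc α β ×ˢ Set.univ)) := by
  have h1 : Integrable (fun η : ℝ => Real.exp (-(δ * α) * η ^ 2)) :=
    integrable_exp_neg_mul_sq (by positivity)
  have h2 : Integrable (fun _ : ℝ => (1 : ℝ)) (volume.restrict (Set.Ioc α β)) :=
    integrableOn_const (by simp)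
  have h3 := h2.mul_prod h1
  rw [Measure.volume_eq_prod, ← Measure.prod_restrict, Measure.restrict_univ]
  refine h3.mono' (by fun_prop) ?_
  have : ∀ᵐ k : ℝ × ℝ ∂((volume.restrict (Set.Ioc α β)).prod volume), k.1 ∈ Set.Ioc α β :=
    Measure.quasiMeasurePreserving_fst.ae (ae_restrict_mem measurableSet_Ioc)
  filter_upwards [this] with k hk
  rw [Real.norm_of_nonneg (Real.exp_pos _).le, one_mul]
  apply Real.exp_le_exp.2
  have := mul_le_mul_of_nonneg_right hk.1.le (mul_nonneg hδ.le (sq_nonneg k.2))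
  linarith

/-- The dispersive estimate with derivative gain for the truncated and regularised propagator. -/
theorem norm_integral_strip_le {α β δ t y : ℝ} {v : ℝ × ℝ} (hα : 0 < α) (hαβ : α ≤ β) (hδ : 0 < δ)
    (ht : t ≠ 0) :
    ‖∫ k in Set.Ioc α β ×ˢ Set.univ, Complex.exp (-(δ * k.1 * k.2 ^ 2 : ℝ) -
      Complex.I * (t * phiNV k.1 k.2 : ℝ) + (1 + Complex.I * y) * Real.log k.1 -
        Complex.I * (v.1 * k.1 + v.2 * k.2 : ℝ))‖ ≤ (20 + 4 * |y|) / |t| := by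
  have hint : Integrable (fun k : ℝ × ℝ => Complex.exp (-(δ * k.1 * k.2 ^ 2 : ℝ) -
      Complex.I * (t * phiNV k.1 k.2 : ℝ) + (1 + Complex.I * y) * Real.log k.1 -
        Complex.I * (v.1 * k.1 + v.2 * k.2 : ℝ)))
      (volume.restrict (Set.Ioc α β ×ˢ Set.univ)) := by
    refine ((integrable_gaussian_strip hα hδ).const_mul β).mono' ?_ ?_
    · unfold phiNV
      exact Measurable.aestronglyMeasurable (by fun_prop)
    · filter_upwards [ae_restrict_mem (measurableSet_Ioc.prod MeasurableSet.univ)] with k hk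
      have h0 : 0 < k.1 := hα.trans hk.1.1
      rw [Complex.norm_exp]
      have : (-(δ * k.1 * k.2 ^ 2 : ℝ) -
        Complex.I * (t * phiNV k.1 k.2 : ℝ) + (1 + Complex.I * y) * Real.log k.1 -
        Complex.I * (v.1 * k.1 + v.2 * k.2 : ℝ) : ℂ).re = -(δ * k.1 * k.2 ^ 2) + Real.log k.1 := by
        simp only [Complex.add_re, Complex.sub_re, Complex.mul_re, Complex.ofReal_re,
          Complex.ofReal_im, Complex.I_re, Complex.I_im, Complex.neg_re, Complex.one_re,
          Complex.add_im, Complex.mul_im, Complex.one_im]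
        ring
      rw [this, Real.exp_add, Real.exp_log h0, mul_comm]
      gcongr
      exact hk.1.2
  rw [Measure.volume_eq_prod] at hint ⊢
  rw [setIntegral_prod _ hint]
  set A := v.2 ^ 2 * δ / (4 * (δ ^ 2 + 9 * t ^ 2)) with hA
  set B := 3 * t * v.2 ^ 2 / (4 * (δ ^ 2 + 9 * t ^ 2)) with hB
  rw [setIntegral_congr_fun measurableSet_Ioc (g := fun ξ : ℝ =>
    (Real.pi / (δ - 3 * t * Complex.I)) ^ (1 / 2 : ℂ) *
      ((√ξ * Complex.exp (Complex.I * (y * Real.log ξ) - A / ξ)) *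
      Complex.exp (-(Complex.I * ((t * ξ ^ 3 + v.1 * ξ + B / ξ : ℝ) : ℂ)))))
    (fun ξ hξ => by
      have := integral_gaussian_slice (y := y) (v₁ := v.1) (v₂ := v.2) hδ ht (hα.trans hξ.1)
      simpa only [Measure.restrict_univ] using this)]
  rw [integral_const_mul, ← intervalIntegral.integral_of_le hαβ, norm_mul]
  have h1 := norm_airy_type_integral_le (x := v.1) (y := y) (A := A) (B := B) hα hαβ
    (by positivity) (by
      rw [hB, mul_div_assoc', show t * (3 * t * v.2 ^ 2) = 3 * (t * v.2) ^ 2 by ring]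
      positivity) ht
  have ht' : 0 < |t| := abs_pos.2 ht
  have h2 : ‖(Real.pi / (δ - 3 * t * Complex.I) : ℂ) ^ (1 / 2 : ℂ)‖ ≤ 2 / √|t| := by
    have e := Complex.norm_cpow_real (Real.pi / (δ - 3 * t * Complex.I)) (1 / 2)
    push_cast at e
    rw [e, ← Real.sqrt_eq_rpow, norm_div, Complex.norm_real, Real.norm_of_nonneg Real.pi_pos.le]
    have hn : 3 * |t| ≤ ‖(δ - 3 * t * Complex.I : ℂ)‖ := by
      have := Complex.abs_im_le_norm (δ - 3 * t * Complex.I : ℂ)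
      simpa [abs_mul] using this
    have : Real.pi / ‖(δ - 3 * t * Complex.I : ℂ)‖ ≤ 2 ^ 2 / |t| := by
      rw [div_le_div_iff₀ (by linarith) ht']
      nlinarith [Real.pi_le_four]
    refine (Real.sqrt_le_sqrt this).trans ?_
    rw [Real.sqrt_div (by positivity), Real.sqrt_sq (by norm_num)]
  calc _ ≤ 2 / √|t| * ((10 + 2 * |y|) / √|t|) := by gcongr
    _ = (20 + 4 * |y|) / |t| := by
      rw [div_mul_div_comm, Real.mul_self_sqrt ht'.le]; ring

section Expansion

variable {K X Y : Type*} [MeasurableSpace K] [MeasurableSpace X] [MeasurableSpace Y]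
  {μ : Measure K} {ν : Measure X} {ρ : Measure Y}

theorem integrable_prod_mul_conj [SFinite μ] [SFinite ν] [SFinite ρ] {m : K → ℂ} (hm : Integrable m μ) {E : K → X → ℂ}
    {G : K → Y → ℂ} (hE : Measurable (Function.uncurry E)) (hG : Measurable (Function.uncurry G))
    {a : X → ℝ} {b : Y → ℝ} (ha : Integrable a ν) (hb : Integrable b ρ)
    (hEa : ∀ k x, ‖E k x‖ ≤ a x) (hGb : ∀ k y, ‖G k y‖ ≤ b y) :
    Integrable (fun z : K × (X × Y) => m z.1 * (E z.1 z.2.1 * (starRingEnd ℂ) (G z.1 z.2.2)))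
      (μ.prod (ν.prod ρ)) := by
  refine (hm.norm.mul_prod (ha.mul_prod hb)).mono' ?_ (ae_of_all _ fun z => ?_)
  · refine (hm.aestronglyMeasurable.comp_fst).mul (Measurable.aestronglyMeasurable ?_)
    have h1 : Measurable fun z : K × (X × Y) => E z.1 z.2.1 :=
      hE.comp (measurable_fst.prodMk (measurable_fst.comp measurable_snd))
    have h2 : Measurable fun z : K × (X × Y) => G z.1 z.2.2 :=
      hG.comp (measurable_fst.prodMk (measurable_snd.comp measurable_snd))
    exact h1.mul (Complex.continuous_conj.measurable.comp h2)
  · rw [norm_mul, norm_mul, RCLike.norm_conj]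
    have h1 := hEa z.1 z.2.1
    have h2 := hGb z.1 z.2.2
    have h3 : 0 ≤ a z.2.1 := (norm_nonneg _).trans h1
    gcongr

theorem integral_mul_integral_mul_conj_integral [SFinite μ] [SFinite ν] [SFinite ρ] {m : K → ℂ} (hm : Integrable m μ) {E : K → X → ℂ}
    {G : K → Y → ℂ} (hE : Measurable (Function.uncurry E)) (hG : Measurable (Function.uncurry G))
    {a : X → ℝ} {b : Y → ℝ} (ha : Integrable a ν) (hb : Integrable b ρ)
    (hEa : ∀ k x, ‖E k x‖ ≤ a x) (hGb : ∀ k y, ‖G k y‖ ≤ b y) :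
    ∫ k, m k * ((∫ x, E k x ∂ν) * (starRingEnd ℂ) (∫ y, G k y ∂ρ)) ∂μ =
      ∫ z : X × Y, ∫ k, m k * (E k z.1 * (starRingEnd ℂ) (G k z.2)) ∂μ ∂(ν.prod ρ) := by
  have e : ∀ k, m k * ((∫ x, E k x ∂ν) * (starRingEnd ℂ) (∫ y, G k y ∂ρ)) =
      ∫ z : X × Y, m k * (E k z.1 * (starRingEnd ℂ) (G k z.2)) ∂(ν.prod ρ) := by
    intro k
    rw [integral_const_mul, ← integral_conj,
      integral_prod_mul (E k) (fun y => (starRingEnd ℂ) (G k y))]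
  simp_rw [e]
  exact integral_integral_swap (f := fun k (z : X × Y) => m k * (E k z.1 * (starRingEnd ℂ) (G k z.2)))
    (integrable_prod_mul_conj hm hE hG ha hb hEa hGb)

end Expansion

/-- The Fourier transform on the plane, with angular frequency. -/
noncomputable def planeFourier (f : ℝ × ℝ → ℂ) (k : ℝ × ℝ) : ℂ :=
  ∫ v : ℝ × ℝ, f v * Complex.exp (-(Complex.I * (v.1 * k.1 + v.2 * k.2 : ℝ)))

theorem norm_exp_neg_I_mul (r : ℝ) : ‖Complex.exp (-(Complex.I * (r : ℂ)))‖ = 1 := by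
  rw [Complex.norm_exp]; simp

theorem conj_exp_neg_I_mul (r : ℝ) :
    (starRingEnd ℂ) (Complex.exp (-(Complex.I * (r : ℂ)))) = Complex.exp (Complex.I * (r : ℂ)) := by
  rw [← Complex.exp_conj]; simp

theorem measurable_planeFourier {f : ℝ × ℝ → ℂ} (hf : Measurable f) :
    Measurable (planeFourier f) := by
  have h : StronglyMeasurable (Function.uncurry fun (k v : ℝ × ℝ) =>
      f v * Complex.exp (-(Complex.I * (v.1 * k.1 + v.2 * k.2 : ℝ)))) := by
    apply Measurable.stronglyMeasurable
    unfold Function.uncurry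
    fun_prop
  exact h.integral_prod_right.measurable

theorem norm_planeFourier_le (f : ℝ × ℝ → ℂ) (k : ℝ × ℝ) :
    ‖planeFourier f k‖ ≤ ∫ v, ‖f v‖ := by
  refine (norm_integral_le_integral_norm _).trans (le_of_eq ?_)
  simp_rw [norm_mul, norm_exp_neg_I_mul, mul_one]

/-- Pairing two Fourier transforms against an integrable multiplier. -/
theorem integral_mul_planeFourier_mul_conj {m : ℝ × ℝ → ℂ} (hm : Integrable m) {f g : ℝ × ℝ → ℂ}
    (hf : Measurable f) (hg : Measurable g) (hfi : Integrable f) (hgi : Integrable g) :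
    ∫ k, m k * (planeFourier f k * (starRingEnd ℂ) (planeFourier g k)) =
      ∫ z : (ℝ × ℝ) × (ℝ × ℝ), f z.1 * (starRingEnd ℂ) (g z.2) *
        ∫ k : ℝ × ℝ, m k * Complex.exp (-(Complex.I *
          ((z.1.1 - z.2.1) * k.1 + (z.1.2 - z.2.2) * k.2 : ℝ))) := by
  unfold planeFourier
  rw [integral_mul_integral_mul_conj_integral hm (a := fun x => ‖f x‖) (b := fun x => ‖g x‖)
    (by unfold Function.uncurry; fun_prop) (by unfold Function.uncurry; fun_prop)
    hfi.norm hgi.norm (fun k x => by rw [norm_mul, norm_exp_neg_I_mul, mul_one])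
    (fun k x => by rw [norm_mul, norm_exp_neg_I_mul, mul_one])]
  congr 1
  ext z
  rw [← integral_const_mul]
  congr 1
  ext k
  rw [map_mul, conj_exp_neg_I_mul]
  have : Complex.exp (-(Complex.I * ((z.1.1 - z.2.1) * k.1 + (z.1.2 - z.2.2) * k.2 : ℝ))) =
    Complex.exp (-(Complex.I * (z.1.1 * k.1 + z.1.2 * k.2 : ℝ))) *
      Complex.exp (Complex.I * (z.2.1 * k.1 + z.2.2 * k.2 : ℝ)) := by
    rw [← Complex.exp_add]; congr 1; push_cast; ring
  rw [this]; ring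

theorem integral_gaussian_plane {ε : ℝ} (hε : 0 < ε) (v : ℝ × ℝ) :
    ∫ k : ℝ × ℝ, ((Real.exp (-ε * k.1 ^ 2) * Real.exp (-ε * k.2 ^ 2) : ℝ) : ℂ) *
      Complex.exp (-(Complex.I * (v.1 * k.1 + v.2 * k.2 : ℝ))) =
      ((Real.pi / ε * (Real.exp (-(1 / (4 * ε)) * v.1 ^ 2) *
        Real.exp (-(1 / (4 * ε)) * v.2 ^ 2)) : ℝ) : ℂ) := by
  have h1 : ∀ a : ℝ, ∫ x : ℝ, Complex.exp (-ε * x ^ 2 + -(Complex.I * a) * x + 0) =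
      ((√(Real.pi / ε) * Real.exp (-(1 / (4 * ε)) * a ^ 2) : ℝ) : ℂ) := by
    intro a
    have := integral_cexp_quadratic (b := -(ε : ℂ)) (by simpa using hε) (-(Complex.I * a)) 0
    rw [this, neg_neg, Real.sqrt_eq_rpow, Complex.ofReal_mul, Complex.ofReal_cpow (by positivity),
      Complex.ofReal_exp]
    push_cast
    congr 2
    rw [neg_sq, mul_pow, Complex.I_sq]
    have : (ε : ℂ) ≠ 0 := by exact_mod_cast hε.ne'
    field_simp
    ring
  have e : ∀ k : ℝ × ℝ, ((Real.exp (-ε * k.1 ^ 2) * Real.exp (-ε * k.2 ^ 2) : ℝ) : ℂ) *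
      Complex.exp (-(Complex.I * (v.1 * k.1 + v.2 * k.2 : ℝ))) =
      Complex.exp (-ε * k.1 ^ 2 + -(Complex.I * v.1) * k.1 + 0) *
      Complex.exp (-ε * k.2 ^ 2 + -(Complex.I * v.2) * k.2 + 0) := by
    intro k
    push_cast
    simp only [← Complex.exp_add]
    congr 1
    ring
  simp_rw [e]
  rw [Measure.volume_eq_prod, integral_prod_mul (fun x : ℝ => Complex.exp (-ε * x ^ 2 + -(Complex.I * v.1) * x + 0))
    (fun x : ℝ => Complex.exp (-ε * x ^ 2 + -(Complex.I * v.2) * x + 0)), h1, h1, ← Complex.ofReal_mul]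
  congr 1
  have := Real.mul_self_sqrt (show 0 ≤ Real.pi / ε by positivity)
  linear_combination (Real.exp (-(1 / (4 * ε)) * v.1 ^ 2) * Real.exp (-(1 / (4 * ε)) * v.2 ^ 2)) * this

theorem lintegral_gaussian_plane {ε : ℝ} (hε : 0 < ε) :
    ∫⁻ v : ℝ × ℝ, ENNReal.ofReal (Real.pi / ε * (Real.exp (-(1 / (4 * ε)) * v.1 ^ 2) *
        Real.exp (-(1 / (4 * ε)) * v.2 ^ 2))) = ENNReal.ofReal ((2 * Real.pi) ^ 2) := by
  have h1 : Integrable fun x : ℝ => Real.exp (-(1 / (4 * ε)) * x ^ 2) :=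
    integrable_exp_neg_mul_sq (by positivity)
  rw [Measure.volume_eq_prod, ← ofReal_integral_eq_lintegral_ofReal
    ((h1.mul_prod h1).const_mul (Real.pi / ε))
    (ae_of_all _ fun v => by positivity), integral_const_mul,
    integral_prod_mul (fun x : ℝ => Real.exp (-(1 / (4 * ε)) * x ^ 2))
      (fun x : ℝ => Real.exp (-(1 / (4 * ε)) * x ^ 2)), integral_gaussian,
    Real.mul_self_sqrt (by positivity)]
  congr 1
  field_simp
  ring

theorem lintegral_ofReal_mul_enorm_sq_eq {K : Type*} [MeasurableSpace K] {μ : Measure K}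
    {m : K → ℝ} (hm : Integrable m μ) (hm0 : ∀ k, 0 ≤ m k) {S : K → ℂ} (hS : Measurable S) {B : ℝ}
    (hB : ∀ k, ‖S k‖ ≤ B) :
    ∫⁻ k, ENNReal.ofReal (m k) * ‖S k‖ₑ ^ 2 ∂μ =
      ‖∫ k, (m k : ℂ) * (S k * (starRingEnd ℂ) (S k)) ∂μ‖ₑ := by
  have e : ∀ k, (m k : ℂ) * (S k * (starRingEnd ℂ) (S k)) = ((m k * ‖S k‖ ^ 2 : ℝ) : ℂ) := by
    intro k
    rw [Complex.mul_conj, Complex.normSq_eq_norm_sq]; push_cast; ring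
  have h0 : ∀ k, 0 ≤ m k * ‖S k‖ ^ 2 := fun k => mul_nonneg (hm0 k) (by positivity)
  simp_rw [e]
  have hi : Integrable (fun k => m k * ‖S k‖ ^ 2) μ := by
    refine (hm.mul_const (B ^ 2)).mono' ?_ (ae_of_all _ fun k => ?_)
    · exact hm.aestronglyMeasurable.mul (hS.norm.pow_const 2).aestronglyMeasurable
    · rw [Real.norm_of_nonneg (h0 k)]
      have := hB k
      have := hm0 k
      gcongr
  rw [integral_complex_ofReal, ← ofReal_norm, Complex.norm_real,
    Real.norm_of_nonneg (integral_nonneg h0),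
    ofReal_integral_eq_lintegral_ofReal hi (ae_of_all _ h0)]
  congr 1
  ext k
  rw [ENNReal.ofReal_mul (hm0 k), ENNReal.ofReal_pow (norm_nonneg _), ofReal_norm]

theorem lintegral_gaussian_mul_planeFourier_sq_le {f : ℝ × ℝ → ℂ} (hf : Measurable f)
    (hfi : Integrable f) {ε : ℝ} (hε : 0 < ε) :
    ∫⁻ k : ℝ × ℝ, ENNReal.ofReal (Real.exp (-ε * k.1 ^ 2) * Real.exp (-ε * k.2 ^ 2)) *
      ‖planeFourier f k‖ₑ ^ 2 ≤ ENNReal.ofReal ((2 * Real.pi) ^ 2) * ∫⁻ v, ‖f v‖ₑ ^ 2 := by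
  set γ : ℝ × ℝ → ℝ := fun k => Real.exp (-ε * k.1 ^ 2) * Real.exp (-ε * k.2 ^ 2) with hγ
  set g : ℝ × ℝ → ENNReal := fun v => ENNReal.ofReal (Real.pi / ε *
    (Real.exp (-(1 / (4 * ε)) * v.1 ^ 2) * Real.exp (-(1 / (4 * ε)) * v.2 ^ 2))) with hg
  have hgm : Measurable g := by rw [hg]; fun_prop
  have h1 : Integrable fun x : ℝ => Real.exp (-ε * x ^ 2) := integrable_exp_neg_mul_sq hε
  have hγi : Integrable γ := h1.mul_prod h1
  have h2 := integral_mul_planeFourier_mul_conj (m := fun k => (γ k : ℂ)) hγi.ofReal hf hf hfi hfi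
  have h3 := lintegral_ofReal_mul_enorm_sq_eq hγi (fun k => by positivity)
    (measurable_planeFourier hf) (norm_planeFourier_le f)
  have h4 : ∀ u : ℝ × ℝ, ∫ k : ℝ × ℝ, (γ k : ℂ) * Complex.exp (-(Complex.I *
          (u.1 * k.1 + u.2 * k.2 : ℝ))) = _ := fun u => integral_gaussian_plane hε u
  have hS : ∀ w : ℝ × ℝ, ∫⁻ x, g (x - w) = ENNReal.ofReal ((2 * Real.pi) ^ 2) := fun w => by
    rw [lintegral_sub_right_eq_self]; exact lintegral_gaussian_plane hε
  have hS' : ∀ w : ℝ × ℝ, ∫⁻ x, g (w - x) = ENNReal.ofReal ((2 * Real.pi) ^ 2) := fun w => by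
    rw [lintegral_sub_left_eq_self]; exact lintegral_gaussian_plane hε
  have hn : Measurable fun v => ‖f v‖ₑ := hf.enorm
  rw [h3, h2]
  calc _ ≤ ∫⁻ z : (ℝ × ℝ) × (ℝ × ℝ), ‖f z.1‖ₑ * ‖f z.2‖ₑ * g (z.1 - z.2) := by
        refine (enorm_integral_le_lintegral_enorm _).trans (lintegral_mono fun z => le_of_eq ?_)
        have := h4 (z.1 - z.2)
        simp only [Prod.fst_sub, Prod.snd_sub] at this
        rw [this, enorm_mul, enorm_mul]
        congr 2
        · simp [← ofReal_norm]
        · rw [← ofReal_norm, Complex.norm_real, Real.norm_of_nonneg (by positivity)]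
          rfl
    _ ≤ ∫⁻ z : (ℝ × ℝ) × (ℝ × ℝ), (‖f z.1‖ₑ ^ 2 / 2 * g (z.1 - z.2) +
          ‖f z.2‖ₑ ^ 2 / 2 * g (z.1 - z.2)) := by
        refine lintegral_mono fun z => ?_
        rw [← add_mul, ← ENNReal.add_div]
        refine mul_le_mul' ?_ le_rfl
        rw [ENNReal.le_div_iff_mul_le (by simp) (by simp)]
        calc _ = 2 * ‖f z.1‖ₑ * ‖f z.2‖ₑ := by ring
          _ ≤ _ := by
            simp only [enorm_eq_nnnorm]
            exact_mod_cast two_mul_le_add_sq ‖f z.1‖₊ ‖f z.2‖₊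
    _ = ENNReal.ofReal ((2 * Real.pi) ^ 2) * ∫⁻ v, ‖f v‖ₑ ^ 2 := by
        rw [lintegral_add_left (by fun_prop), Measure.volume_eq_prod, lintegral_prod _ (by fun_prop),
          lintegral_prod_symm _ (by fun_prop)]
        have e1 : ∀ x : ℝ × ℝ, ∫⁻ y : ℝ × ℝ, ‖f x‖ₑ ^ 2 / 2 * g (x - y) =
            ‖f x‖ₑ ^ 2 / 2 * ENNReal.ofReal ((2 * Real.pi) ^ 2) := fun x => by
          rw [lintegral_const_mul _ (by fun_prop), hS']
        have e2 : ∀ y : ℝ × ℝ, ∫⁻ x : ℝ × ℝ, ‖f y‖ₑ ^ 2 / 2 * g (x - y) =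
            ‖f y‖ₑ ^ 2 / 2 * ENNReal.ofReal ((2 * Real.pi) ^ 2) := fun x => by
          rw [lintegral_const_mul _ (by fun_prop), hS]
        simp_rw [e1, e2]
        rw [← lintegral_add_left (by fun_prop), ← lintegral_const_mul _ (by fun_prop)]
        congr 1
        ext x
        rw [← add_mul, ENNReal.add_halves, mul_comm]

/-- Bessel's inequality for the Fourier transform of an integrable function on the plane. -/
theorem lintegral_planeFourier_sq_le {f : ℝ × ℝ → ℂ} (hf : Measurable f) (hfi : Integrable f) :
    ∫⁻ k, ‖planeFourier f k‖ₑ ^ 2 ≤ ENNReal.ofReal ((2 * Real.pi) ^ 2) * ∫⁻ v, ‖f v‖ₑ ^ 2 := by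
  have hm := measurable_planeFourier hf
  set ε : ℕ → ℝ := fun n => 1 / ((n : ℝ) + 1) with hεd
  have hε : Filter.Tendsto ε Filter.atTop (nhds 0) := tendsto_one_div_add_atTop_nhds_zero_nat
  have e : ∀ k : ℝ × ℝ, ‖planeFourier f k‖ₑ ^ 2 = Filter.liminf (fun n : ℕ =>
      ENNReal.ofReal (Real.exp (-ε n * k.1 ^ 2) * Real.exp (-ε n * k.2 ^ 2)) *
      ‖planeFourier f k‖ₑ ^ 2) Filter.atTop := by
    intro k
    symm
    apply Filter.Tendsto.liminf_eq
    have h1 : Filter.Tendsto (fun n => Real.exp (-ε n * k.1 ^ 2) * Real.exp (-ε n * k.2 ^ 2))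
        Filter.atTop (nhds (Real.exp (-0 * k.1 ^ 2) * Real.exp (-0 * k.2 ^ 2))) := by
      have c : Continuous fun e : ℝ => Real.exp (-e * k.1 ^ 2) * Real.exp (-e * k.2 ^ 2) := by
        fun_prop
      exact (c.tendsto 0).comp hε
    have h2 := ENNReal.Tendsto.mul_const (b := ‖planeFourier f k‖ₑ ^ 2)
      (ENNReal.tendsto_ofReal h1) (Or.inr (by simp))
    simpa using h2
  rw [lintegral_congr e]
  refine (lintegral_liminf_le fun n => by fun_prop).trans ?_
  refine Filter.liminf_le_of_le (by isBoundedDefault) fun b hb => ?_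
  obtain ⟨n, hn⟩ := hb.exists
  exact hn.trans (lintegral_gaussian_mul_planeFourier_sq_le hf hfi (by positivity))

theorem norm_exp_mul_ofReal_le {L M : ℝ} (h : |L| ≤ M) (z : ℂ) {R : ℝ} (hz : |z.re| ≤ R) :
    ‖Complex.exp (z * L)‖ ≤ Real.exp (R * M) := by
  rw [Complex.norm_exp]
  apply Real.exp_le_exp.2
  have : (z * L : ℂ).re = z.re * L := by simp
  rw [this]
  calc z.re * L ≤ |z.re * L| := le_abs_self _
    _ = |z.re| * |L| := abs_mul _ _
    _ ≤ R * M := mul_le_mul hz h (abs_nonneg _) ((abs_nonneg _).trans hz)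

theorem differentiable_integral_mul_exp {Ω : Type*} [MeasurableSpace Ω] {μ : Measure Ω}
    {c : Ω → ℂ} (hc : Integrable c μ) {L : Ω → ℝ} (hL : Measurable L) {M : ℝ} (hM : ∀ ω, |L ω| ≤ M) :
    Differentiable ℂ fun z : ℂ => ∫ ω, c ω * Complex.exp (z * L ω) ∂μ := by
  intro z₀
  have hmeas : ∀ z : ℂ, AEStronglyMeasurable (fun ω => Complex.exp (z * L ω)) μ := fun z =>
    Measurable.aestronglyMeasurable (by fun_prop)
  have hLm : AEStronglyMeasurable (fun ω => (L ω : ℂ)) μ :=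
    Measurable.aestronglyMeasurable (by fun_prop)
  have h := hasDerivAt_integral_of_dominated_loc_of_deriv_le (μ := μ) (𝕜 := ℂ)
    (F := fun z ω => c ω * Complex.exp (z * L ω))
    (F' := fun z ω => c ω * (Complex.exp (z * L ω) * L ω)) (x₀ := z₀)
    (s := Metric.ball z₀ 1) (bound := fun ω => ‖c ω‖ * (Real.exp ((‖z₀‖ + 1) * M) * M))
    (Metric.ball_mem_nhds z₀ one_pos)
    (Filter.Eventually.of_forall fun z => hc.aestronglyMeasurable.mul (hmeas z))
    ?_ (hc.aestronglyMeasurable.mul ((hmeas z₀).mul hLm)) ?_ (hc.norm.mul_const _) ?_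
  · exact h.2.differentiableAt
  · refine (hc.norm.mul_const (Real.exp (‖z₀‖ * M))).mono'
      (hc.aestronglyMeasurable.mul (hmeas z₀)) (ae_of_all _ fun ω => ?_)
    rw [norm_mul]
    gcongr
    exact norm_exp_mul_ofReal_le (hM ω) z₀ (Complex.abs_re_le_norm z₀)
  · refine ae_of_all _ fun ω z hz => ?_
    rw [norm_mul, norm_mul, Complex.norm_real, Real.norm_eq_abs]
    have h1 : |z.re| ≤ ‖z₀‖ + 1 := by
      have h2 : ‖z - z₀‖ < 1 := by rwa [← dist_eq_norm]
      have h3 := norm_le_norm_add_norm_sub' z z₀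
      linarith [Complex.abs_re_le_norm z]
    have := norm_exp_mul_ofReal_le (hM ω) z h1
    have := hM ω
    gcongr
  · refine ae_of_all _ fun ω z _ => ?_
    have h1 : HasDerivAt (fun z : ℂ => z * (L ω : ℂ)) (L ω : ℂ) z := by
      simpa using (hasDerivAt_id z).mul_const (L ω : ℂ)
    exact h1.cexp.const_mul (c ω)

/-- Cauchy-Schwarz and Bessel. -/
theorem norm_integral_mul_planeFourier_mul_conj_le {m : ℝ × ℝ → ℂ} (hm : ∀ k, ‖m k‖ ≤ 1)
    {f g : ℝ × ℝ → ℂ} (hf : Measurable f) (hg : Measurable g) (hfi : Integrable f)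
    (hgi : Integrable g) (hf2 : Integrable fun v => ‖f v‖ ^ 2)
    (hg2 : Integrable fun v => ‖g v‖ ^ 2) :
    ‖∫ k, m k * (planeFourier f k * (starRingEnd ℂ) (planeFourier g k))‖ ≤
      (2 * Real.pi) ^ 2 * (√(∫ v, ‖f v‖ ^ 2) * √(∫ v, ‖g v‖ ^ 2)) := by
  have key : ∀ {h : ℝ × ℝ → ℂ}, Measurable h → Integrable h → Integrable (fun v => ‖h v‖ ^ 2) →
      (∫⁻ k, ‖planeFourier h k‖ₑ ^ (2 : ℝ)) ^ (1 / 2 : ℝ) ≤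
        ENNReal.ofReal (2 * Real.pi * √(∫ v, ‖h v‖ ^ 2)) := by
    intro h hh hhi hh2
    have h1 := lintegral_planeFourier_sq_le hh hhi
    have h2 : ∫⁻ v, ‖h v‖ₑ ^ 2 = ENNReal.ofReal (∫ v, ‖h v‖ ^ 2) := by
      rw [ofReal_integral_eq_lintegral_ofReal hh2 (ae_of_all _ fun k => by positivity)]
      congr 1
      ext v
      rw [ENNReal.ofReal_pow (norm_nonneg _), ofReal_norm]
    rw [h2, ← ENNReal.ofReal_mul (by positivity)] at h1
    have h0 : 0 ≤ ∫ v, ‖h v‖ ^ 2 := integral_nonneg fun v => by positivity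
    have h3 : (2 * Real.pi) ^ 2 * ∫ v, ‖h v‖ ^ 2 = (2 * Real.pi * √(∫ v, ‖h v‖ ^ 2)) ^ 2 := by
      rw [mul_pow _ (√ _), Real.sq_sqrt h0]
    rw [h3, ENNReal.ofReal_pow (by positivity)] at h1
    simp only [ENNReal.rpow_ofNat]
    calc _ ≤ (ENNReal.ofReal (2 * Real.pi * √(∫ v, ‖h v‖ ^ 2)) ^ 2) ^ (1 / 2 : ℝ) := by gcongr
      _ = _ := by
        rw [← ENNReal.rpow_natCast, ← ENNReal.rpow_mul]; norm_num
  rw [← ENNReal.ofReal_le_ofReal_iff (by positivity), ofReal_norm]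
  calc _ ≤ ∫⁻ k, ‖planeFourier f k‖ₑ * ‖planeFourier g k‖ₑ := by
        refine (enorm_integral_le_lintegral_enorm _).trans (lintegral_mono fun k => ?_)
        rw [enorm_mul, enorm_mul, RCLike.enorm_conj]
        refine mul_le_of_le_one_left (by positivity) ?_
        rw [← ofReal_norm]
        exact ENNReal.ofReal_le_one.2 (hm k)
    _ ≤ (∫⁻ k, ‖planeFourier f k‖ₑ ^ (2 : ℝ)) ^ (1 / 2 : ℝ) *
          (∫⁻ k, ‖planeFourier g k‖ₑ ^ (2 : ℝ)) ^ (1 / 2 : ℝ) :=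
        ENNReal.lintegral_mul_le_Lp_mul_Lq _ Real.HolderConjugate.two_two
          (measurable_planeFourier hf).enorm.aemeasurable
          (measurable_planeFourier hg).enorm.aemeasurable
    _ ≤ _ := by
        refine (mul_le_mul' (key hf hfi hf2) (key hg hgi hg2)).trans (le_of_eq ?_)
        rw [← ENNReal.ofReal_mul (by positivity)]
        congr 1
        ring

theorem norm_integral_mul_planeFourier_mul_conj_le_of_kernel {m : ℝ × ℝ → ℂ} (hm : Integrable m)
    {D : ℝ} (hD : ∀ v : ℝ × ℝ, ‖∫ k : ℝ × ℝ, m k * Complex.exp (-(Complex.I *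
      (v.1 * k.1 + v.2 * k.2 : ℝ)))‖ ≤ D)
    {f g : ℝ × ℝ → ℂ} (hf : Measurable f) (hg : Measurable g) (hfi : Integrable f)
    (hgi : Integrable g) :
    ‖∫ k, m k * (planeFourier f k * (starRingEnd ℂ) (planeFourier g k))‖ ≤
      D * ((∫ v, ‖f v‖) * ∫ v, ‖g v‖) := by
  rw [integral_mul_planeFourier_mul_conj hm hf hg hfi hgi, ← integral_prod_mul,
    ← integral_const_mul, ← Measure.volume_eq_prod]
  refine norm_integral_le_of_norm_le ((hfi.norm.mul_prod hgi.norm).const_mul D)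
    (ae_of_all _ fun z => ?_)
  rw [norm_mul, norm_mul, RCLike.norm_conj, mul_comm]
  have := hD (z.1 - z.2)
  simp only [Prod.fst_sub, Prod.snd_sub] at this
  gcongr

/-- The analytic family through `f` used in complex interpolation. -/
noncomputable def analyticFamily (r : ℝ) (f : ℝ × ℝ → ℂ) (z : ℂ) (v : ℝ × ℝ) : ℂ :=
  f v * ((‖f v‖ ^ (r / 2 - 1) : ℝ) : ℂ) * Complex.exp (z * ((r / 2 * Real.log ‖f v‖ : ℝ) : ℂ))

theorem measurable_analyticFamily {r : ℝ} {f : ℝ × ℝ → ℂ} (hf : Measurable f) (z : ℂ) :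
    Measurable (analyticFamily r f z) := by
  unfold analyticFamily
  fun_prop

theorem norm_analyticFamily {r : ℝ} {f : ℝ × ℝ → ℂ} {v : ℝ × ℝ} (hv : f v ≠ 0) (z : ℂ) :
    ‖analyticFamily r f z v‖ = ‖f v‖ ^ (r / 2 * (1 + z.re)) := by
  have h0 : 0 < ‖f v‖ := norm_pos_iff.2 hv
  have e : (z * ((r / 2 * Real.log ‖f v‖ : ℝ) : ℂ)).re = Real.log ‖f v‖ * (z.re * (r / 2)) := by
    simp only [Complex.mul_re, Complex.ofReal_re, Complex.ofReal_im]; ring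
  rw [analyticFamily, norm_mul, norm_mul, Complex.norm_real, Complex.norm_exp, e,
    Real.norm_of_nonneg (by positivity), ← Real.rpow_def_of_pos h0]
  nth_rw 1 [← Real.rpow_one ‖f v‖]
  rw [← Real.rpow_add h0, ← Real.rpow_add h0]
  congr 1
  ring

theorem norm_analyticFamily_of_re_eq_zero {r : ℝ} (hr : 0 < r) (f : ℝ × ℝ → ℂ) {z : ℂ}
    (hz : z.re = 0) (v : ℝ × ℝ) : ‖analyticFamily r f z v‖ ^ 2 = ‖f v‖ ^ r := by
  by_cases hv : f v = 0
  · simp [analyticFamily, hv, hr.ne']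
  · rw [norm_analyticFamily hv, hz, ← Real.rpow_natCast, ← Real.rpow_mul (norm_nonneg _)]
    congr 1
    push_cast
    ring

theorem norm_analyticFamily_of_re_eq_one {r : ℝ} (hr : 0 < r) (f : ℝ × ℝ → ℂ) {z : ℂ}
    (hz : z.re = 1) (v : ℝ × ℝ) : ‖analyticFamily r f z v‖ = ‖f v‖ ^ r := by
  by_cases hv : f v = 0
  · simp [analyticFamily, hv, hr.ne']
  · rw [norm_analyticFamily hv, hz]
    congr 1
    ring

theorem analyticFamily_apply_eq {θ : ℝ} (hθ : 0 < θ) (f : ℝ × ℝ → ℂ) :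
    analyticFamily (2 / (1 + θ)) f θ = f := by
  ext v
  by_cases hv : f v = 0
  · simp [analyticFamily, hv]
  · have h0 : 0 < ‖f v‖ := norm_pos_iff.2 hv
    have e : ((‖f v‖ ^ (2 / (1 + θ) / 2 - 1) : ℝ) : ℂ) *
        Complex.exp (θ * ((2 / (1 + θ) / 2 * Real.log ‖f v‖ : ℝ) : ℂ)) = 1 := by
      rw [← Complex.ofReal_mul, ← Complex.ofReal_exp, ← Complex.ofReal_mul,
        Real.rpow_def_of_pos h0, ← Real.exp_add]
      have : Real.log ‖f v‖ * (2 / (1 + θ) / 2 - 1) + θ * (2 / (1 + θ) / 2 * Real.log ‖f v‖) = 0 := by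
        have : 1 + θ ≠ 0 := by positivity
        field_simp
        ring
      rw [this]; simp
    rw [analyticFamily, mul_assoc, e, mul_one]

theorem abs_log_norm_le {f : ℝ × ℝ → ℂ} {l u : ℝ} (hl : 0 < l) {v : ℝ × ℝ}
    (h : f v = 0 ∨ l ≤ ‖f v‖ ∧ ‖f v‖ ≤ u) : |Real.log ‖f v‖| ≤ max |Real.log l| |Real.log u| := by
  rcases h with h | ⟨h1, h2⟩
  · simp [h]
  · exact abs_le_max_abs_abs (Real.log_le_log hl h1) (Real.log_le_log (hl.trans_le h1) h2)

theorem integrable_analyticFamily {r : ℝ} {f : ℝ × ℝ → ℂ} (hf : Measurable f)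
    (hfi : Integrable f) {l u : ℝ} (hl : 0 < l) (h : ∀ v, f v = 0 ∨ l ≤ ‖f v‖ ∧ ‖f v‖ ≤ u)
    (z : ℂ) : Integrable (analyticFamily r f z) := by
  set M := max |Real.log l| |Real.log u| with hM
  refine (hfi.norm.mul_const (Real.exp (|r / 2 * (1 + z.re) - 1| * M))).mono'
    (measurable_analyticFamily hf z).aestronglyMeasurable (ae_of_all _ fun v => ?_)
  by_cases hv : f v = 0
  · simp [analyticFamily, hv]
  · have h0 : 0 < ‖f v‖ := norm_pos_iff.2 hv
    have h1 := abs_log_norm_le hl (h v)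
    set e := r / 2 * (1 + z.re) - 1 with he
    rw [norm_analyticFamily hv, show r / 2 * (1 + z.re) = 1 + e by rw [he]; ring,
      Real.rpow_add h0, Real.rpow_one, Real.rpow_def_of_pos h0]
    refine mul_le_mul_of_nonneg_left (Real.exp_le_exp.2 ?_) h0.le
    calc Real.log ‖f v‖ * e ≤ |Real.log ‖f v‖ * e| := le_abs_self _
      _ = |e| * |Real.log ‖f v‖| := by rw [abs_mul, mul_comm]
      _ ≤ |e| * M := by gcongr

theorem integrable_norm_rpow {f : ℝ × ℝ → ℂ} (hf : Measurable f)
    (hfi : Integrable f) {l u : ℝ} (hl : 0 < l) (h : ∀ v, f v = 0 ∨ l ≤ ‖f v‖ ∧ ‖f v‖ ≤ u)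
    {r : ℝ} (hr : 0 < r) : Integrable fun v => ‖f v‖ ^ r := by
  have := (integrable_analyticFamily (r := r) hf hfi hl h 1).norm
  simpa only [norm_analyticFamily_of_re_eq_one hr f Complex.one_re] using this

theorem exists_integral_mul_exp_eq {σ : ℝ × ℝ → ℂ} (hσ : Integrable σ) {ℓ : ℝ × ℝ → ℝ}
    (hℓ : Measurable ℓ) {M : ℝ} (hM : ∀ k, |ℓ k| ≤ M) {f g : ℝ × ℝ → ℂ} (hf : Measurable f)
    (hg : Measurable g) (hfi : Integrable f) (hgi : Integrable g) {l u : ℝ} (hl : 0 < l)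
    (hfu : ∀ v, f v = 0 ∨ l ≤ ‖f v‖ ∧ ‖f v‖ ≤ u) (hgu : ∀ v, g v = 0 ∨ l ≤ ‖g v‖ ∧ ‖g v‖ ≤ u)
    {r : ℝ} (hr : 0 < r) :
    ∃ (c : (ℝ × ℝ) × (ℝ × ℝ) × (ℝ × ℝ) → ℂ) (L : (ℝ × ℝ) × (ℝ × ℝ) × (ℝ × ℝ) → ℝ) (N : ℝ),
      Integrable c ∧ Measurable L ∧ (∀ ω, |L ω| ≤ N) ∧ ∀ z : ℂ,
      ∫ k, σ k * Complex.exp (z * ℓ k) * (planeFourier (analyticFamily r f z) k *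
        (starRingEnd ℂ) (planeFourier (analyticFamily r g ((starRingEnd ℂ) z)) k)) =
      ∫ ω, c ω * Complex.exp (z * L ω) := by
  set N := max |Real.log l| |Real.log u| with hN
  have hE : ∀ (h : ℝ × ℝ → ℂ), Measurable h → Measurable (Function.uncurry fun (k v : ℝ × ℝ) =>
      h v * Complex.exp (-(Complex.I * (v.1 * k.1 + v.2 * k.2 : ℝ)))) := by
    intro h hh; unfold Function.uncurry; fun_prop
  have hn : ∀ (h : ℝ × ℝ → ℂ) (k v : ℝ × ℝ),
      ‖h v * Complex.exp (-(Complex.I * (v.1 * k.1 + v.2 * k.2 : ℝ)))‖ ≤ ‖h v‖ := by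
    intro h k v; rw [norm_mul, norm_exp_neg_I_mul, mul_one]
  have hm := fun (h : ℝ × ℝ → ℂ) (hh : Measurable h) (z : ℂ) =>
    measurable_analyticFamily (r := r) hh z
  have hfz := integrable_analyticFamily (r := r) hf hfi hl hfu
  have hgz := integrable_analyticFamily (r := r) hg hgi hl hgu
  refine ⟨_, fun ω => ℓ ω.1 + r / 2 * Real.log ‖f ω.2.1‖ + r / 2 * Real.log ‖g ω.2.2‖,
    M + r / 2 * N + r / 2 * N, integrable_prod_mul_conj hσ (hE _ (hm f hf 0)) (hE _ (hm g hg 0))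
      (hfz 0).norm (hgz 0).norm (hn _) (hn _), by fun_prop, fun ω => ?_, fun z => ?_⟩
  · have h1 := hM ω.1
    have h2 := abs_log_norm_le hl (hfu ω.2.1)
    have h3 := abs_log_norm_le hl (hgu ω.2.2)
    refine (abs_add_three _ _ _).trans ?_
    rw [abs_mul, abs_mul, abs_of_pos (by positivity : 0 < r / 2)]
    gcongr
  · have hσz : Integrable fun k => σ k * Complex.exp (z * ℓ k) := by
      refine hσ.mul_bdd (c := Real.exp (|z.re| * M))
        (Measurable.aestronglyMeasurable (by fun_prop)) (ae_of_all _ fun k => ?_)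
      exact norm_exp_mul_ofReal_le (hM k) z le_rfl
    unfold planeFourier
    rw [integral_mul_integral_mul_conj_integral hσz (hE _ (hm f hf z)) (hE _ (hm g hg _))
      (hfz z).norm (hgz _).norm (hn _) (hn _), ← integral_prod_symm _
      (integrable_prod_mul_conj hσz (hE _ (hm f hf z)) (hE _ (hm g hg _))
      (hfz z).norm (hgz _).norm (hn _) (hn _))]
    refine integral_congr_ae (ae_of_all _ fun ω => ?_)
    simp only [analyticFamily, map_mul, ← Complex.exp_conj, Complex.conj_ofReal, Complex.conj_conj,
      zero_mul, Complex.exp_zero, mul_one]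
    have : Complex.exp (z * ((ℓ ω.1 + r / 2 * Real.log ‖f ω.2.1‖ + r / 2 * Real.log ‖g ω.2.2‖ : ℝ)
        : ℂ)) = Complex.exp (z * ℓ ω.1) * Complex.exp (z * ((r / 2 * Real.log ‖f ω.2.1‖ : ℝ) : ℂ)) *
        Complex.exp (z * ((r / 2 * Real.log ‖g ω.2.2‖ : ℝ) : ℂ)) := by
      rw [← Complex.exp_add, ← Complex.exp_add]; congr 1; push_cast; ring
    rw [this]
    ring

/-- Complex interpolation between Plancherel and a dispersive estimate. -/
theorem norm_integral_mul_planeFourier_mul_conj_le_interpolated {θ A : ℝ} (h0 : 0 < θ) (h1 : θ < 1)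
    (hA : 0 ≤ A) {σ : ℝ × ℝ → ℂ} (hσ : Integrable σ) (hσ1 : ∀ k, ‖σ k‖ ≤ 1) {ℓ : ℝ × ℝ → ℝ}
    (hℓ : Measurable ℓ) {M : ℝ} (hM : ∀ k, |ℓ k| ≤ M)
    (hker : ∀ (y : ℝ) (v : ℝ × ℝ), ‖∫ k : ℝ × ℝ, σ k * Complex.exp ((1 + Complex.I * y) * ℓ k) *
      Complex.exp (-(Complex.I * (v.1 * k.1 + v.2 * k.2 : ℝ)))‖ ≤ A * (5 + |y|))
    {f g : ℝ × ℝ → ℂ} (hf : Measurable f)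
    (hg : Measurable g) (hfi : Integrable f) (hgi : Integrable g) {l u : ℝ} (hl : 0 < l)
    (hfu : ∀ v, f v = 0 ∨ l ≤ ‖f v‖ ∧ ‖f v‖ ≤ u) (hgu : ∀ v, g v = 0 ∨ l ≤ ‖g v‖ ∧ ‖g v‖ ≤ u) :
    ‖∫ k, σ k * Complex.exp (θ * ℓ k) * (planeFourier f k * (starRingEnd ℂ) (planeFourier g k))‖ ≤
      ((2 * Real.pi) ^ 2) ^ (1 - θ) * (18 * A) ^ θ *
        ((∫ v, ‖f v‖ ^ (2 / (1 + θ))) * ∫ v, ‖g v‖ ^ (2 / (1 + θ))) ^ ((1 + θ) / 2) := by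
  set r := 2 / (1 + θ) with hr
  have hr0 : 0 < r := by positivity
  set P := ∫ v, ‖f v‖ ^ r with hP
  set Q := ∫ v, ‖g v‖ ^ r with hQ
  have hP0 : 0 ≤ P := integral_nonneg fun v => by positivity
  have hQ0 : 0 ≤ Q := integral_nonneg fun v => by positivity
  obtain ⟨c, L, N, hc, hL, hN, hΦ⟩ := exists_integral_mul_exp_eq hσ hℓ hM hf hg hfi hgi hl hfu hgu hr0
  set Φ : ℂ → ℂ := fun z => ∫ ω, c ω * Complex.exp (z * L ω) with hΦd
  have hdiff : Differentiable ℂ Φ := differentiable_integral_mul_exp hc hL hN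
  set Ψ : ℂ → ℂ := fun z => Complex.exp (z ^ 2) * Φ z with hΨ
  have hdΨ : Differentiable ℂ Ψ := by
    rw [hΨ]; fun_prop
  have hsq : ∀ z : ℂ, ‖Complex.exp (z ^ 2)‖ = Real.exp (z.re ^ 2 - z.im ^ 2) := by
    intro z; rw [Complex.norm_exp]; congr 1; simp [sq]
  have hmeas := fun (h : ℝ × ℝ → ℂ) (hh : Measurable h) (z : ℂ) =>
    measurable_analyticFamily (r := r) hh z
  have hfz := integrable_analyticFamily (r := r) hf hfi hl hfu
  have hgz := integrable_analyticFamily (r := r) hg hgi hl hgu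
  have hfr := integrable_norm_rpow hf hfi hl hfu hr0
  have hgr := integrable_norm_rpow hg hgi hl hgu hr0
  have key := Complex.HadamardThreeLines.norm_le_interp_of_mem_verticalClosedStrip₀₁' Ψ
    (z := θ) (a := (2 * Real.pi) ^ 2 * (√P * √Q)) (b := 18 * A * (P * Q)) ?_ hdΨ.diffContOnCl
    ?_ ?_ ?_
  · have e : Φ θ = ∫ k, σ k * Complex.exp (θ * ℓ k) *
        (planeFourier f k * (starRingEnd ℂ) (planeFourier g k)) := by
      rw [hΦd]
      beta_reduce
      rw [← hΦ θ, Complex.conj_ofReal, hr, analyticFamily_apply_eq h0, analyticFamily_apply_eq h0]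
    rw [← e]
    have h2 : ‖Φ θ‖ ≤ ‖Ψ θ‖ := by
      rw [hΨ]
      beta_reduce
      rw [norm_mul, hsq]
      refine le_mul_of_one_le_left (norm_nonneg _) (Real.one_le_exp ?_)
      simp; positivity
    refine h2.trans (key.trans (le_of_eq ?_))
    rw [Complex.ofReal_re, Real.mul_rpow (by positivity) (by positivity),
      Real.mul_rpow (by positivity) (by positivity : 0 ≤ P * Q), ← Real.sqrt_mul hP0,
      Real.sqrt_eq_rpow, ← Real.rpow_mul (by positivity)]
    have h3 : (P * Q) ^ ((1 + θ) / 2) = (P * Q) ^ (1 / 2 * (1 - θ)) * (P * Q) ^ θ := by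
      rw [← Real.rpow_add' (by positivity) (by linarith)]
      congr 1
      ring
    rw [h3]
    ring
  · simp only [Complex.HadamardThreeLines.verticalClosedStrip, Set.mem_preimage, Complex.ofReal_re]
    exact ⟨h0.le, h1.le⟩
  · refine ⟨Real.exp 1 * ∫ ω, ‖c ω‖ * Real.exp (1 * N), ?_⟩
    rintro _ ⟨z, hz, rfl⟩
    have hz' : 0 ≤ z.re ∧ z.re ≤ 1 := hz
    rw [Function.comp_apply, hΨ]
    beta_reduce
    rw [norm_mul, hsq]
    refine mul_le_mul (Real.exp_le_exp.2 (by nlinarith [sq_nonneg z.im])) ?_ (norm_nonneg _)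
      (Real.exp_pos _).le
    refine norm_integral_le_of_norm_le (hc.norm.mul_const _) (ae_of_all _ fun ω => ?_)
    rw [norm_mul]
    gcongr
    exact norm_exp_mul_ofReal_le (hN ω) z (by rw [abs_of_nonneg hz'.1]; exact hz'.2)
  · intro z hz
    have hz' : z.re = 0 := hz
    have hz'' : ((starRingEnd ℂ) z).re = 0 := by simpa using hz'
    rw [hΨ]
    beta_reduce
    rw [norm_mul, hsq, hz', hΦd]
    beta_reduce
    rw [← hΦ z]
    have h2 := norm_integral_mul_planeFourier_mul_conj_le
      (m := fun k => σ k * Complex.exp (z * ℓ k)) (fun k => by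
        rw [norm_mul]
        refine mul_le_one₀ (hσ1 k) (norm_nonneg _) ?_
        simpa using norm_exp_mul_ofReal_le (hM k) z (by rw [hz', abs_zero] : |z.re| ≤ 0))
      (hmeas f hf z) (hmeas g hg _) (hfz z) (hgz ((starRingEnd ℂ) z))
      (by simpa only [norm_analyticFamily_of_re_eq_zero hr0 f hz'] using hfr)
      (by simpa only [norm_analyticFamily_of_re_eq_zero hr0 g hz''] using hgr)
    simp only [norm_analyticFamily_of_re_eq_zero hr0 f hz',
      norm_analyticFamily_of_re_eq_zero hr0 g hz''] at h2
    refine (mul_le_of_le_one_left (norm_nonneg _) ?_).trans h2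
    rw [Real.exp_le_one_iff]
    nlinarith [sq_nonneg z.im]
  · intro z hz
    have hz' : z.re = 1 := hz
    have hz'' : ((starRingEnd ℂ) z).re = 1 := by simpa using hz'
    rw [hΨ]
    beta_reduce
    rw [norm_mul, hsq, hz', hΦd]
    beta_reduce
    rw [← hΦ z]
    have hzy : z = 1 + Complex.I * z.im := by
      apply Complex.ext <;> simp [hz']
    have hσz : Integrable fun k => σ k * Complex.exp (z * ℓ k) := by
      refine hσ.mul_bdd (c := Real.exp (|z.re| * M))
        (Measurable.aestronglyMeasurable (by fun_prop)) (ae_of_all _ fun k => ?_)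
      exact norm_exp_mul_ofReal_le (hM k) z le_rfl
    have h2 := norm_integral_mul_planeFourier_mul_conj_le_of_kernel hσz (D := A * (5 + |z.im|))
      (fun v => by
        have := hker z.im v
        rwa [← hzy] at this) (hmeas f hf z) (hmeas g hg _) (hfz z) (hgz ((starRingEnd ℂ) z))
    simp only [norm_analyticFamily_of_re_eq_one hr0 f hz',
      norm_analyticFamily_of_re_eq_one hr0 g hz''] at h2
    have h3 : Real.exp (1 ^ 2 - z.im ^ 2) * (5 + |z.im|) ≤ 18 := by
      have ha := abs_nonneg z.im
      have h4 : 5 + |z.im| ≤ 6 * Real.exp (z.im ^ 2) := by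
        have := Real.add_one_le_exp (z.im ^ 2)
        rw [← sq_abs] at this ⊢
        nlinarith [sq_nonneg (|z.im| - 1)]
      calc Real.exp (1 ^ 2 - z.im ^ 2) * (5 + |z.im|)
          ≤ Real.exp (1 ^ 2 - z.im ^ 2) * (6 * Real.exp (z.im ^ 2)) := by gcongr
        _ = 6 * Real.exp 1 := by
          rw [mul_left_comm, ← Real.exp_add]; norm_num
        _ ≤ 18 := by linarith [Real.exp_one_lt_d9]
    calc _ ≤ Real.exp (1 ^ 2 - z.im ^ 2) * (A * (5 + |z.im|) * (P * Q)) := by gcongr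
      _ = Real.exp (1 ^ 2 - z.im ^ 2) * (5 + |z.im|) * (A * (P * Q)) := by ring
      _ ≤ 18 * (A * (P * Q)) := by gcongr
      _ = 18 * A * (P * Q) := by ring

/-- Rotation of the plane. -/
noncomputable def planeRotation (ω : Circle) : ℝ × ℝ ≃ᵐ ℝ × ℝ :=
  (Complex.measurableEquivRealProd.symm.trans
    (rotation ω).toHomeomorph.toMeasurableEquiv).trans Complex.measurableEquivRealProd

theorem measurePreserving_planeRotation (ω : Circle) :
    MeasurePreserving (planeRotation ω) volume volume :=
  (Complex.volume_preserving_equiv_real_prod.comp (rotation ω).measurePreserving).comp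
    Complex.volume_preserving_equiv_real_prod.symm

theorem planeRotation_apply (ω : Circle) (k : ℝ × ℝ) : planeRotation ω k =
    ((ω : ℂ).re * k.1 - (ω : ℂ).im * k.2, (ω : ℂ).re * k.2 + (ω : ℂ).im * k.1) := by
  have : planeRotation ω k = (((ω : ℂ) * ⟨k.1, k.2⟩).re, ((ω : ℂ) * ⟨k.1, k.2⟩).im) := rfl
  rw [this, Complex.mul_re, Complex.mul_im]

theorem circle_re_sq_add_im_sq (ω : Circle) : (ω : ℂ).re ^ 2 + (ω : ℂ).im ^ 2 = 1 := by
  have := Circle.normSq_coe ω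
  rw [Complex.normSq_apply] at this
  linarith

theorem phiNV_planeRotation {ω : Circle} (hω : (ω : ℂ) ^ 3 = 1) (k : ℝ × ℝ) :
    phiNV (planeRotation ω k).1 (planeRotation ω k).2 = phiNV k.1 k.2 := by
  have e : ∀ z : ℂ, phiNV z.re z.im = (z ^ 3).re := by
    intro z
    rw [phiNV, show z ^ 3 = z * z * z by ring]
    simp only [Complex.mul_re, Complex.mul_im]
    ring
  have h1 : phiNV (planeRotation ω k).1 (planeRotation ω k).2 =
    phiNV ((ω : ℂ) * ⟨k.1, k.2⟩).re ((ω : ℂ) * ⟨k.1, k.2⟩).im := rfl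
  rw [h1, e, mul_pow, hω, one_mul, ← e]

theorem integral_comp_planeRotation_mul_exp (ω : Circle) (H : ℝ × ℝ → ℂ) (v : ℝ × ℝ) :
    ∫ k : ℝ × ℝ, H (planeRotation ω k) *
      Complex.exp (-(Complex.I * (v.1 * k.1 + v.2 * k.2 : ℝ))) =
    ∫ k : ℝ × ℝ, H k * Complex.exp (-(Complex.I *
      ((planeRotation ω v).1 * k.1 + (planeRotation ω v).2 * k.2 : ℝ))) := by
  rw [← (measurePreserving_planeRotation ω).integral_comp (planeRotation ω).measurableEmbedding
    (fun k => H k * Complex.exp (-(Complex.I *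
      ((planeRotation ω v).1 * k.1 + (planeRotation ω v).2 * k.2 : ℝ))))]
  refine integral_congr_ae (ae_of_all _ fun k => ?_)
  beta_reduce
  have : (planeRotation ω v).1 * (planeRotation ω k).1 +
      (planeRotation ω v).2 * (planeRotation ω k).2 = v.1 * k.1 + v.2 * k.2 := by
    rw [planeRotation_apply, planeRotation_apply]
    dsimp only
    linear_combination (v.1 * k.1 + v.2 * k.2) * circle_re_sq_add_im_sq ω
  rw [this]

/-- Truncated and regularised version of the weight `ξ ^ θ` on a vertical strip. -/
noncomputable def stripWeight (θ α β δ : ℝ) : ℝ × ℝ → ℝ :=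
  (Set.Ioc α β ×ˢ Set.univ).indicator fun k => k.1 ^ θ * Real.exp (-(δ * k.1 * k.2 ^ 2))

theorem measurableSet_strip (α β : ℝ) :
    MeasurableSet (Set.Ioc α β ×ˢ (Set.univ : Set ℝ)) :=
  measurableSet_Ioc.prod MeasurableSet.univ

theorem stripWeight_nonneg {θ α β δ : ℝ} (hα : 0 < α) (k : ℝ × ℝ) : 0 ≤ stripWeight θ α β δ k := by
  refine Set.indicator_nonneg (fun k hk => ?_) k
  have : 0 < k.1 := hα.trans hk.1.1
  positivity

theorem measurable_stripWeight (θ α β δ : ℝ) : Measurable (stripWeight θ α β δ) :=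
  Measurable.indicator (by fun_prop) (measurableSet_strip α β)

theorem integrable_stripWeight {θ α β δ : ℝ} (hθ : 0 < θ) (hα : 0 < α) (hδ : 0 < δ) :
    Integrable (stripWeight θ α β δ) := by
  rw [stripWeight, integrable_indicator_iff (measurableSet_strip α β)]
  refine ((integrable_gaussian_strip hα hδ).const_mul (β ^ θ)).mono'
    (Measurable.aestronglyMeasurable (by fun_prop)) ?_
  filter_upwards [ae_restrict_mem (measurableSet_strip α β)] with k hk
  have h0 : 0 < k.1 := hα.trans hk.1.1
  rw [Real.norm_of_nonneg (by positivity)]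
  have := hk.1.2
  gcongr

theorem norm_integral_stripWeight_le {θ α β δ t : ℝ} (h0 : 0 < θ) (h1 : θ < 1) (hα : 0 < α)
    (hαβ : α ≤ β) (hδ : 0 < δ) (ht : t ≠ 0) {ω : Circle} (hω : (ω : ℂ) ^ 3 = 1)
    {f g : ℝ × ℝ → ℂ} (hf : Measurable f)
    (hg : Measurable g) (hfi : Integrable f) (hgi : Integrable g) {l u : ℝ} (hl : 0 < l)
    (hfu : ∀ v, f v = 0 ∨ l ≤ ‖f v‖ ∧ ‖f v‖ ≤ u) (hgu : ∀ v, g v = 0 ∨ l ≤ ‖g v‖ ∧ ‖g v‖ ≤ u) :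
    ‖∫ k, ((stripWeight θ α β δ (planeRotation ω k) : ℝ) : ℂ) *
      Complex.exp (-(Complex.I * (t * phiNV k.1 k.2 : ℝ))) *
        (planeFourier f k * (starRingEnd ℂ) (planeFourier g k))‖ ≤
      ((2 * Real.pi) ^ 2) ^ (1 - θ) * (18 * (4 / |t|)) ^ θ *
        ((∫ v, ‖f v‖ ^ (2 / (1 + θ))) * ∫ v, ‖g v‖ ^ (2 / (1 + θ))) ^ ((1 + θ) / 2) := by
  set S : Set (ℝ × ℝ) := Set.Ioc α β ×ˢ Set.univ with hS
  have hSm : MeasurableSet S := measurableSet_strip α β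
  set σ : ℝ × ℝ → ℂ := S.indicator fun k => Complex.exp (-(δ * k.1 * k.2 ^ 2 : ℝ) -
      Complex.I * (t * phiNV k.1 k.2 : ℝ)) with hσ
  set ℓ : ℝ × ℝ → ℝ := S.indicator fun k => Real.log k.1 with hℓ
  have hφ : Measurable fun k : ℝ × ℝ => phiNV k.1 k.2 := by unfold phiNV; fun_prop
  have hnorm : ∀ k : ℝ × ℝ, ‖Complex.exp (-(δ * k.1 * k.2 ^ 2 : ℝ) -
      Complex.I * (t * phiNV k.1 k.2 : ℝ))‖ = Real.exp (-(δ * k.1 * k.2 ^ 2)) := by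
    intro k
    rw [Complex.norm_exp]
    congr 1
    simp only [Complex.sub_re, Complex.mul_re, Complex.ofReal_re,
      Complex.ofReal_im, Complex.I_re, Complex.I_im, Complex.neg_re]
    ring
  have hσi : Integrable σ := by
    rw [hσ, integrable_indicator_iff hSm]
    refine (integrable_gaussian_strip hα hδ).mono' (Measurable.aestronglyMeasurable (by fun_prop))
      (ae_of_all _ fun k => ?_)
    rw [hnorm]
  have hσ1 : ∀ k, ‖σ k‖ ≤ 1 := by
    intro k
    rw [hσ]
    by_cases hk : k ∈ S
    · rw [Set.indicator_of_mem hk, hnorm, Real.exp_le_one_iff]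
      have : 0 < k.1 := hα.trans hk.1.1
      have : 0 ≤ δ * k.1 * k.2 ^ 2 := by positivity
      linarith
    · rw [Set.indicator_of_notMem hk]; simp
  have hℓM : ∀ k, |ℓ k| ≤ max |Real.log α| |Real.log β| := by
    intro k
    rw [hℓ]
    by_cases hk : k ∈ S
    · rw [Set.indicator_of_mem hk]
      exact abs_le_max_abs_abs (Real.log_le_log hα hk.1.1.le)
        (Real.log_le_log (hα.trans hk.1.1) hk.1.2)
    · rw [Set.indicator_of_notMem hk]; simp
  have hℓm : Measurable ℓ := Measurable.indicator (by fun_prop) hSm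
  have hR := (planeRotation ω).measurable
  have key := norm_integral_mul_planeFourier_mul_conj_le_interpolated (A := 4 / |t|)
    (σ := fun k => σ (planeRotation ω k)) (ℓ := fun k => ℓ (planeRotation ω k)) h0 h1
    (by positivity)
    ((measurePreserving_planeRotation ω).integrable_comp_of_integrable hσi)
    (fun k => hσ1 _) (hℓm.comp hR) (fun k => hℓM _) (fun y v => ?_) hf hg hfi hgi hl hfu hgu
  · refine le_of_eq_of_le (congrArg norm (integral_congr_ae (ae_of_all _ fun k => ?_))) key
    beta_reduce
    congr 1
    set K := planeRotation ω k with hK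
    rw [← phiNV_planeRotation hω k, ← hK, stripWeight, hσ, hℓ, ← hS]
    by_cases hk : K ∈ S
    · have hp : 0 < K.1 := hα.trans hk.1.1
      rw [Set.indicator_of_mem hk, Set.indicator_of_mem hk, Set.indicator_of_mem hk,
        Real.rpow_def_of_pos hp, ← Real.exp_add, Complex.ofReal_exp, ← Complex.exp_add,
        ← Complex.exp_add]
      congr 1
      push_cast
      ring
    · rw [Set.indicator_of_notMem hk, Set.indicator_of_notMem hk]
      simp
  · have e := integral_comp_planeRotation_mul_exp ω
      (fun k => σ k * Complex.exp ((1 + Complex.I * y) * ℓ k)) v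
    rw [e]
    have h2 := norm_integral_strip_le (v := planeRotation ω v) (y := y) hα hαβ hδ ht
    rw [← integral_indicator hSm] at h2
    refine le_of_eq_of_le (congrArg norm (integral_congr_ae (ae_of_all _ fun k => ?_)))
      (h2.trans (le_of_eq (by ring)))
    beta_reduce
    rw [hσ, hℓ]
    by_cases hk : k ∈ S
    · rw [Set.indicator_of_mem hk, Set.indicator_of_mem hk, Set.indicator_of_mem hk,
        ← Complex.exp_add, ← Complex.exp_add]
      congr 1
    · rw [Set.indicator_of_notMem hk, Set.indicator_of_notMem hk,
        Set.indicator_of_notMem hk]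
      simp

theorem integrable_indicator_unit_box :
    Integrable ((Metric.closedBall (0 : ℝ × ℝ) 1).indicator fun _ => (1 : ℝ)) := by
  rw [integrable_indicator_iff measurableSet_closedBall]
  exact integrableOn_const measure_closedBall_lt_top.ne

/-- The low-frequency counterpart of `norm_integral_stripWeight_le`. -/
theorem exists_norm_integral_unit_box_le {θ : ℝ} (h0 : 0 < θ) (h1 : θ < 1) : ∃ C : ℝ, 0 ≤ C ∧
    ∀ (t : ℝ) {f g : ℝ × ℝ → ℂ}, Measurable f →
    Measurable g → Integrable f → Integrable g → ∀ {l u : ℝ}, 0 < l →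
    (∀ v, f v = 0 ∨ l ≤ ‖f v‖ ∧ ‖f v‖ ≤ u) → (∀ v, g v = 0 ∨ l ≤ ‖g v‖ ∧ ‖g v‖ ≤ u) →
    ‖∫ k, (((Metric.closedBall (0 : ℝ × ℝ) 1).indicator (fun _ => (1 : ℝ)) k : ℝ) : ℂ) *
      Complex.exp (-(Complex.I * (t * phiNV k.1 k.2 : ℝ))) *
        (planeFourier f k * (starRingEnd ℂ) (planeFourier g k))‖ ≤
      C * ((∫ v, ‖f v‖ ^ (2 / (1 + θ))) * ∫ v, ‖g v‖ ^ (2 / (1 + θ))) ^ ((1 + θ) / 2) := by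
  set χ : ℝ × ℝ → ℝ := (Metric.closedBall (0 : ℝ × ℝ) 1).indicator fun _ => (1 : ℝ) with hχ
  have hχi : Integrable χ := integrable_indicator_unit_box
  have hχ0 : ∀ k, 0 ≤ χ k := fun k => Set.indicator_nonneg (fun _ _ => zero_le_one) k
  have hχ1 : ∀ k, χ k ≤ 1 := fun k => Set.indicator_le_self' (fun _ _ => zero_le_one) k
  have hφ : Measurable fun k : ℝ × ℝ => phiNV k.1 k.2 := by unfold phiNV; fun_prop
  set A := ∫ k, χ k with hA
  have hA0 : 0 ≤ A := integral_nonneg hχ0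
  refine ⟨((2 * Real.pi) ^ 2) ^ (1 - θ) * (18 * A) ^ θ, by positivity, ?_⟩
  intro t f g hf hg hfi hgi l u hl hfu hgu
  have hn : ∀ k : ℝ × ℝ, ‖(χ k : ℂ) * Complex.exp (-(Complex.I * (t * phiNV k.1 k.2 : ℝ)))‖ = χ k :=
    fun k => by
      rw [norm_mul, norm_exp_neg_I_mul, mul_one, Complex.norm_real, Real.norm_of_nonneg (hχ0 k)]
  have key := norm_integral_mul_planeFourier_mul_conj_le_interpolated (A := A)
    (σ := fun k => (χ k : ℂ) * Complex.exp (-(Complex.I * (t * phiNV k.1 k.2 : ℝ))))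
    (ℓ := fun _ => 0) (M := 0) h0 h1 hA0 ?_ (fun k => (hn k).trans_le (hχ1 k)) measurable_const
    (by simp) (fun y v => ?_) hf hg hfi hgi hl hfu hgu
  · simpa using key
  · refine hχi.mono' (hχi.ofReal.aestronglyMeasurable.mul
      (Measurable.aestronglyMeasurable (by fun_prop))) (ae_of_all _ fun k => (hn k).le)
  · have : ‖∫ k : ℝ × ℝ, (χ k : ℂ) * Complex.exp (-(Complex.I * (t * phiNV k.1 k.2 : ℝ))) *
        Complex.exp ((1 + Complex.I * y) * ((0 : ℝ) : ℂ)) *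
        Complex.exp (-(Complex.I * (v.1 * k.1 + v.2 * k.2 : ℝ)))‖ ≤ A := by
      refine norm_integral_le_of_norm_le hχi (ae_of_all _ fun k => ?_)
      rw [norm_mul, norm_mul, hn, norm_exp_neg_I_mul]
      simp
    exact this.trans (le_mul_of_one_le_right hA0 (by linarith [abs_nonneg y]))

theorem measurable_planeFourier_uncurry {G : ℝ → ℝ × ℝ → ℂ} (hG : Measurable (Function.uncurry G)) :
    Measurable fun x : (ℝ × ℝ) × ℝ => planeFourier (G x.2) x.1 := by
  have h : StronglyMeasurable (Function.uncurry fun (x : (ℝ × ℝ) × ℝ) (v : ℝ × ℝ) =>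
      G x.2 v * Complex.exp (-(Complex.I * (v.1 * x.1.1 + v.2 * x.1.2 : ℝ)))) := by
    apply Measurable.stronglyMeasurable
    have h1 : Measurable fun z : ((ℝ × ℝ) × ℝ) × (ℝ × ℝ) => G z.1.2 z.2 :=
      hG.comp ((measurable_snd.comp measurable_fst).prodMk measurable_snd)
    unfold Function.uncurry
    fun_prop
  exact h.integral_prod_right.measurable

theorem ae_fst_ne_snd : ∀ᵐ z : ℝ × ℝ ∂(volume.prod volume), z.1 ≠ z.2 := by
  have hd : MeasurableSet {z : ℝ × ℝ | z.1 = z.2} :=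
    measurableSet_eq_fun measurable_fst measurable_snd
  have h : (volume.prod volume) {z : ℝ × ℝ | z.1 = z.2} = 0 := by
    rw [Measure.measure_prod_null hd]
    refine ae_of_all _ fun x => ?_
    have : Prod.mk x ⁻¹' {z : ℝ × ℝ | z.1 = z.2} = {x} := by
      ext y; simp [eq_comm]
    change volume (Prod.mk x ⁻¹' {z : ℝ × ℝ | z.1 = z.2}) = 0
    rw [this, Real.volume_singleton]
  exact measure_eq_zero_iff_ae_notMem.1 h

/-- The `T T^*` argument: decay of the truncated propagator combined with the
Hardy-Littlewood-Sobolev inequality in time. -/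
theorem lintegral_weight_mul_enorm_sq_le {θ D : ℝ} (h0 : 0 < θ) (h1 : θ < 1) (hD : 0 ≤ D)
    {W : ℝ → ℝ} (hW : Integrable W) (hW0 : ∀ μ, 0 ≤ W μ) {w : ℝ × ℝ → ℝ} (hw : Integrable w)
    (hw0 : ∀ k, 0 ≤ w k) {φ : ℝ × ℝ → ℝ} (hφ : Measurable φ) {G : ℝ → ℝ × ℝ → ℂ}
    (hG : Measurable (Function.uncurry G)) (hGi : Integrable (Function.uncurry G))
    {n : ℝ → ℝ} (hn : Measurable n) (hn0 : ∀ t, 0 ≤ n t)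
    (hfin : ∫⁻ t, ENNReal.ofReal (n t ^ (2 / (2 - θ))) ≠ ⊤)
    (hdec : ∀ t s : ℝ, t ≠ s →
      ‖∫ μ : ℝ, (W μ : ℂ) * Complex.exp (-(Complex.I * ((t - s) * μ : ℝ)))‖ *
      ‖∫ k, (w k : ℂ) * Complex.exp (-(Complex.I * ((t - s) * φ k : ℝ))) *
        (planeFourier (G t) k * (starRingEnd ℂ) (planeFourier (G s) k))‖ ≤
      D * (n t * n s * |t - s| ^ (-θ))) :
    ∫⁻ z : ℝ × (ℝ × ℝ), ENNReal.ofReal (W z.1 * w z.2) *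
      ‖∫ t : ℝ, Complex.exp (-(Complex.I * (t * (φ z.2 + z.1) : ℝ))) *
        planeFourier (G t) z.2‖ₑ ^ 2 ≤
      ENNReal.ofReal (D * (2 * (2 / (1 - θ) + 2))) *
        (∫⁻ t, ENNReal.ofReal (n t ^ (2 / (2 - θ)))) ^ (2 - θ) := by
  set E : ℝ × (ℝ × ℝ) → ℝ → ℂ := fun z t =>
    Complex.exp (-(Complex.I * (t * (φ z.2 + z.1) : ℝ))) * planeFourier (G t) z.2 with hE
  have hFm := measurable_planeFourier_uncurry hG
  have hEm : Measurable (Function.uncurry E) := by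
    have h2 : Measurable fun x : (ℝ × (ℝ × ℝ)) × ℝ => planeFourier (G x.2) x.1.2 :=
      hFm.comp ((measurable_snd.comp measurable_fst).prodMk measurable_snd)
    rw [hE]
    unfold Function.uncurry
    fun_prop
  have hEa : ∀ z t, ‖E z t‖ ≤ ∫ v, ‖G t v‖ := by
    intro z t
    rw [hE]
    beta_reduce
    rw [norm_mul, norm_exp_neg_I_mul, one_mul]
    exact norm_planeFourier_le _ _
  have ha : Integrable fun t => ∫ v, ‖G t v‖ := hGi.norm.integral_prod_left
  have hm : Integrable (fun z : ℝ × (ℝ × ℝ) => W z.1 * w z.2) := hW.mul_prod hw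
  have hSm : Measurable fun z => ∫ t, E z t := hEm.stronglyMeasurable.integral_prod_right.measurable
  have hSb : ∀ z, ‖∫ t, E z t‖ ≤ ∫ t, ∫ v, ‖G t v‖ := fun z =>
    norm_integral_le_of_norm_le ha (ae_of_all _ fun t => hEa z t)
  rw [lintegral_ofReal_mul_enorm_sq_eq hm (fun z => mul_nonneg (hW0 _) (hw0 _)) hSm hSb,
    integral_mul_integral_mul_conj_integral (m := fun z : ℝ × (ℝ × ℝ) => ((W z.1 * w z.2 : ℝ) : ℂ))
      hm.ofReal hEm hEm ha ha hEa hEa]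
  have e : ∀ z : ℝ × ℝ, ∫ k : ℝ × (ℝ × ℝ), ((W k.1 * w k.2 : ℝ) : ℂ) *
      (E k z.1 * (starRingEnd ℂ) (E k z.2)) =
      (∫ μ : ℝ, (W μ : ℂ) * Complex.exp (-(Complex.I * ((z.1 - z.2) * μ : ℝ)))) *
      ∫ k, (w k : ℂ) * Complex.exp (-(Complex.I * ((z.1 - z.2) * φ k : ℝ))) *
        (planeFourier (G z.1) k * (starRingEnd ℂ) (planeFourier (G z.2) k)) := by
    intro z
    rw [Measure.volume_eq_prod ℝ (ℝ × ℝ), ← integral_prod_mul]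
    refine integral_congr_ae (ae_of_all _ fun k => ?_)
    rw [hE]
    beta_reduce
    rw [map_mul, conj_exp_neg_I_mul]
    have h2 : Complex.exp (-(Complex.I * (z.1 * (φ k.2 + k.1) : ℝ))) *
        Complex.exp (Complex.I * (z.2 * (φ k.2 + k.1) : ℝ)) =
        Complex.exp (-(Complex.I * ((z.1 - z.2) * k.1 : ℝ))) *
        Complex.exp (-(Complex.I * ((z.1 - z.2) * φ k.2 : ℝ))) := by
      rw [← Complex.exp_add, ← Complex.exp_add]; congr 1; push_cast; ring
    push_cast at h2 ⊢
    linear_combination (W k.1 * w k.2 * (planeFourier (G z.1) k.2 *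
      (starRingEnd ℂ) (planeFourier (G z.2) k.2))) * h2
  simp_rw [e]
  refine (enorm_integral_le_lintegral_enorm _).trans ?_
  calc _ ≤ ∫⁻ z : ℝ × ℝ, ENNReal.ofReal D * ENNReal.ofReal (n z.1 * n z.2 * |z.1 - z.2| ^ (-θ))
        ∂(volume.prod volume) := by
        refine lintegral_mono_ae ?_
        filter_upwards [ae_fst_ne_snd] with z hz
        rw [← ofReal_norm, norm_mul, ← ENNReal.ofReal_mul hD]
        exact ENNReal.ofReal_le_ofReal (hdec z.1 z.2 hz)
    _ = ENNReal.ofReal D * ∫⁻ t, ∫⁻ s, ENNReal.ofReal (n t * n s * |t - s| ^ (-θ)) := by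
        rw [lintegral_const_mul _ (by fun_prop), lintegral_prod _ (by fun_prop)]
    _ ≤ ENNReal.ofReal D * (ENNReal.ofReal (2 * (2 / (1 - θ) + 2)) *
          (∫⁻ t, ENNReal.ofReal (n t ^ (2 / (2 - θ)))) ^ (2 - θ)) := by
        gcongr
        exact hardy_littlewood_sobolev_diag h0 h1 hn hn0 hfin
    _ = _ := by rw [← mul_assoc, ← ENNReal.ofReal_mul hD]

theorem integrable_one_add_sq_rpow_neg {b : ℝ} (hb : 1 / 2 < b) :
    Integrable fun μ : ℝ => (1 + μ ^ 2) ^ (-b) := by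
  have h := integrable_rpow_neg_one_add_norm_sq (E := ℝ) (μ := volume) (r := 2 * b)
    (by simp; linarith)
  refine h.congr (ae_of_all _ fun μ => ?_)
  simp only [Real.norm_eq_abs, sq_abs]
  congr 1
  ring

theorem exists_norm_integral_one_add_sq_rpow_neg_le {b θ : ℝ} (hb : 1 / 2 < b) (h0 : 0 < θ)
    (h1 : θ < 1) : ∃ C : ℝ, 0 ≤ C ∧
    (∀ s : ℝ, ‖∫ μ : ℝ, (((1 + μ ^ 2) ^ (-b) : ℝ) : ℂ) *
      Complex.exp (-(Complex.I * (s * μ : ℝ)))‖ ≤ C) ∧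
    ∀ s : ℝ, s ≠ 0 → ‖∫ μ : ℝ, (((1 + μ ^ 2) ^ (-b) : ℝ) : ℂ) *
      Complex.exp (-(Complex.I * (s * μ : ℝ)))‖ ≤ C * |s| ^ (-θ) := by
  have hi := integrable_one_add_sq_rpow_neg hb
  set K := ∫ μ : ℝ, (1 + μ ^ 2) ^ (-b) with hK
  have hK0 : 0 ≤ K := integral_nonneg fun μ => by positivity
  have hb0 : 0 < b := by linarith
  have hn : ∀ s μ : ℝ, ‖(((1 + μ ^ 2) ^ (-b) : ℝ) : ℂ) * Complex.exp (-(Complex.I * (s * μ : ℝ)))‖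
      = (1 + μ ^ 2) ^ (-b) := by
    intro s μ
    rw [norm_mul, norm_exp_neg_I_mul, mul_one, Complex.norm_real, Real.norm_of_nonneg (by positivity)]
  have hbd : ∀ s : ℝ, ‖∫ μ : ℝ, (((1 + μ ^ 2) ^ (-b) : ℝ) : ℂ) *
      Complex.exp (-(Complex.I * (s * μ : ℝ)))‖ ≤ K := fun s =>
    norm_integral_le_of_norm_le hi (ae_of_all _ fun μ => (hn s μ).le)
  have hd : ∀ μ : ℝ, HasDerivAt (fun μ : ℝ => (((1 + μ ^ 2) ^ (-b) : ℝ) : ℂ))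
      ((2 * μ * (-b) * (1 + μ ^ 2) ^ (-b - 1) : ℝ) : ℂ) μ := by
    intro μ
    have h2 : HasDerivAt (fun μ : ℝ => 1 + μ ^ 2) (2 * μ) μ := by
      simpa using (hasDerivAt_pow 2 μ).const_add 1
    exact (h2.rpow_const (Or.inl (by positivity))).ofReal_comp
  have hdn : ∀ μ : ℝ, ‖((2 * μ * (-b) * (1 + μ ^ 2) ^ (-b - 1) : ℝ) : ℂ)‖ ≤
      b * (1 + μ ^ 2) ^ (-b) := by
    intro μ
    have hp : 0 < 1 + μ ^ 2 := by positivity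
    rw [Complex.norm_real, Real.norm_eq_abs, abs_mul, abs_mul, abs_mul, abs_neg, abs_of_pos hb0,
      abs_of_pos (Real.rpow_pos_of_pos hp _), Real.rpow_sub_one hp.ne', abs_two,
      mul_div_assoc', div_le_iff₀ hp]
    have h3 : 2 * |μ| ≤ 1 + μ ^ 2 := by
      rw [← sq_abs]; nlinarith [sq_nonneg (|μ| - 1)]
    have h4 : 0 ≤ b * (1 + μ ^ 2) ^ (-b) := by positivity
    nlinarith
  have hdi : Integrable fun μ : ℝ => ((2 * μ * (-b) * (1 + μ ^ 2) ^ (-b - 1) : ℝ) : ℂ) :=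
    (hi.const_mul b).mono' (Measurable.aestronglyMeasurable (by fun_prop)) (ae_of_all _ hdn)
  have hdec : ∀ s : ℝ, s ≠ 0 → |s| * ‖∫ μ : ℝ, (((1 + μ ^ 2) ^ (-b) : ℝ) : ℂ) *
      Complex.exp (-(Complex.I * (s * μ : ℝ)))‖ ≤ b * K := by
    intro s hs
    have hv : ∀ μ : ℝ, HasDerivAt (fun μ : ℝ => Complex.exp (-(Complex.I * (s * μ : ℝ))))
        (Complex.exp (-(Complex.I * (s * μ : ℝ))) * (-(Complex.I * s))) μ := by
      intro μ
      have h2 : HasDerivAt (fun μ : ℝ => ((s * μ : ℝ) : ℂ)) (s : ℂ) μ := by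
        simpa using ((hasDerivAt_id μ).const_mul s).ofReal_comp
      exact (h2.const_mul Complex.I).neg.cexp
    have hem : ∀ c : ℂ, AEStronglyMeasurable (fun μ : ℝ => Complex.exp (-(Complex.I * (s * μ : ℝ))) * c)
        volume := fun c => Measurable.aestronglyMeasurable (by fun_prop)
    have hparts := integral_mul_deriv_eq_deriv_mul_of_integrable (fun μ _ => hd μ) (fun μ _ => hv μ)
      (by
        refine (hi.mul_const |s|).mono' (hi.ofReal.aestronglyMeasurable.mul (hem _))
          (ae_of_all _ fun μ => ?_)
        rw [Pi.mul_apply, ← mul_assoc, norm_mul, hn, norm_neg, norm_mul, Complex.norm_I, one_mul,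
          Complex.norm_real, Real.norm_eq_abs])
      (by
        refine hdi.norm.mono' (hdi.aestronglyMeasurable.mul (by simpa using hem 1))
          (ae_of_all _ fun μ => ?_)
        rw [Pi.mul_apply, norm_mul, norm_exp_neg_I_mul, mul_one])
      (by
        refine hi.mono' (hi.ofReal.aestronglyMeasurable.mul (by simpa using hem 1))
          (ae_of_all _ fun μ => ?_)
        rw [Pi.mul_apply, hn])
    have e : |s| * ‖∫ μ : ℝ, (((1 + μ ^ 2) ^ (-b) : ℝ) : ℂ) *
        Complex.exp (-(Complex.I * (s * μ : ℝ)))‖ = ‖∫ μ : ℝ, (((1 + μ ^ 2) ^ (-b) : ℝ) : ℂ) *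
        (Complex.exp (-(Complex.I * (s * μ : ℝ))) * (-(Complex.I * s)))‖ := by
      simp_rw [← mul_assoc]
      rw [integral_mul_const, norm_mul, norm_neg, norm_mul, Complex.norm_I, one_mul,
          Complex.norm_real, Real.norm_eq_abs, mul_comm]
    rw [e, hparts, norm_neg, hK, ← integral_const_mul]
    refine norm_integral_le_of_norm_le (hi.const_mul b) (ae_of_all _ fun μ => ?_)
    rw [norm_mul, norm_exp_neg_I_mul, mul_one]
    exact hdn μ
  refine ⟨K * (1 + b), by positivity, fun s => (hbd s).trans (by nlinarith), fun s hs => ?_⟩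
  have hs0 : 0 < |s| := abs_pos.2 hs
  rcases le_total |s| 1 with h | h
  · have : 1 ≤ |s| ^ (-θ) := Real.one_le_rpow_of_pos_of_le_one_of_nonpos hs0 h (by linarith)
    calc _ ≤ K := hbd s
      _ ≤ K * (1 + b) * 1 := by nlinarith
      _ ≤ _ := by gcongr
  · have h2 : |s| ^ (-1 : ℝ) ≤ |s| ^ (-θ) := Real.rpow_le_rpow_of_exponent_le h (by linarith)
    calc _ ≤ b * K * |s| ^ (-1 : ℝ) := by
          rw [Real.rpow_neg_one, ← div_eq_mul_inv, le_div_iff₀ hs0, mul_comm]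
          exact hdec s hs
      _ ≤ K * (1 + b) * |s| ^ (-1 : ℝ) :=
          mul_le_mul_of_nonneg_right (by nlinarith) (by positivity)
      _ ≤ _ := by gcongr

theorem lintegral_le_of_tendsto_of_le {α : Type*} [MeasurableSpace α] {μ : Measure α}
    {f : ℕ → α → ENNReal} (hf : ∀ n, Measurable (f n)) {g : α → ENNReal}
    (h : ∀ x, Filter.Tendsto (fun n => f n x) Filter.atTop (nhds (g x))) {B : ENNReal}
    (hB : ∀ n, ∫⁻ x, f n x ∂μ ≤ B) : ∫⁻ x, g x ∂μ ≤ B := by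
  have e : g = fun x => Filter.liminf (fun n => f n x) Filter.atTop :=
    funext fun x => (h x).liminf_eq.symm
  rw [e]
  refine (lintegral_liminf_le hf).trans ?_
  exact (Filter.liminf_le_liminf (Filter.Eventually.of_forall hB)).trans_eq
    (Filter.liminf_const B)

theorem tendsto_stripWeight {θ : ℝ} (k : ℝ × ℝ) :
    Filter.Tendsto (fun n : ℕ => stripWeight θ (1 / ((n : ℝ) + 1)) ((n : ℝ) + 1) (1 / ((n : ℝ) + 1)) k)
      Filter.atTop (nhds ((Set.Ioi 0 ×ˢ Set.univ).indicator (fun k : ℝ × ℝ => k.1 ^ θ) k)) := by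
  have h1 : Filter.Tendsto (fun n : ℕ => 1 / ((n : ℝ) + 1)) Filter.atTop (nhds 0) :=
    tendsto_one_div_add_atTop_nhds_zero_nat
  have h2 : Filter.Tendsto (fun n : ℕ => (n : ℝ) + 1) Filter.atTop Filter.atTop :=
    Filter.tendsto_atTop_add_const_right _ _ tendsto_natCast_atTop_atTop
  by_cases hk : 0 < k.1
  · have e1 : (Set.Ioi 0 ×ˢ Set.univ).indicator (fun k : ℝ × ℝ => k.1 ^ θ) k = k.1 ^ θ :=
      Set.indicator_of_mem (by simpa using hk) _
    have h3 : Filter.Tendsto (fun n : ℕ => k.1 ^ θ * Real.exp (-(1 / ((n : ℝ) + 1) * k.1 * k.2 ^ 2)))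
        Filter.atTop (nhds (k.1 ^ θ)) := by
      have : Filter.Tendsto (fun n : ℕ => k.1 ^ θ * Real.exp (-(1 / ((n : ℝ) + 1) * k.1 * k.2 ^ 2)))
        Filter.atTop (nhds (k.1 ^ θ * Real.exp (-(0 * k.1 * k.2 ^ 2)))) :=
        (((Real.continuous_exp.tendsto _).comp ((h1.mul_const _).mul_const _).neg).const_mul _)
      simpa using this
    rw [e1]
    refine h3.congr' ?_
    filter_upwards [h1.eventually_lt_const hk, h2.eventually_ge_atTop k.1] with n ha hb
    have hm : k ∈ Set.Ioc (1 / ((n : ℝ) + 1)) ((n : ℝ) + 1) ×ˢ Set.univ := ⟨⟨ha, hb⟩, trivial⟩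
    rw [stripWeight, Set.indicator_of_mem hm]
  · have e1 : (Set.Ioi 0 ×ˢ Set.univ).indicator (fun k : ℝ × ℝ => k.1 ^ θ) k = 0 :=
      Set.indicator_of_notMem (by simpa using hk) _
    rw [e1]
    refine tendsto_const_nhds.congr fun n => ?_
    rw [stripWeight, Set.indicator_of_notMem]
    rintro ⟨⟨ha, -⟩, -⟩
    have : 0 < 1 / ((n : ℝ) + 1) := by positivity
    exact hk (this.trans ha)

/-- The mixed Lebesgue norm in the space variable is measurable in time. -/
theorem measurable_integral_norm_rpow {G : ℝ → ℝ × ℝ → ℂ} (hG : Measurable (Function.uncurry G)) (r s : ℝ) :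
    Measurable fun t => (∫ v, ‖G t v‖ ^ r) ^ s := by
  have h : Measurable (Function.uncurry fun t v => ‖G t v‖ ^ r) := hG.norm.pow_const r
  exact (h.stronglyMeasurable.integral_prod_right).measurable.pow_const s

/-- A function whose nonzero values are bounded above and away from zero in norm. -/
def TwoSidedBounded (f : ℝ × ℝ → ℂ) : Prop :=
  ∃ l > (0 : ℝ), ∃ u : ℝ, ∀ v, f v = 0 ∨ l ≤ ‖f v‖ ∧ ‖f v‖ ≤ u

theorem TwoSidedBounded.exists_common {f g : ℝ × ℝ → ℂ} (hf : TwoSidedBounded f)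
    (hg : TwoSidedBounded g) : ∃ l > (0 : ℝ), ∃ u : ℝ, (∀ v, f v = 0 ∨ l ≤ ‖f v‖ ∧ ‖f v‖ ≤ u) ∧
      ∀ v, g v = 0 ∨ l ≤ ‖g v‖ ∧ ‖g v‖ ≤ u := by
  obtain ⟨l, hl, u, h⟩ := hf
  obtain ⟨l', hl', u', h'⟩ := hg
  exact ⟨min l l', lt_min hl hl', max u u',
    fun v => (h v).imp_right fun x => ⟨(min_le_left _ _).trans x.1, x.2.trans (le_max_left _ _)⟩,
    fun v => (h' v).imp_right fun x => ⟨(min_le_right _ _).trans x.1, x.2.trans (le_max_right _ _)⟩⟩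

section

variable {θ b : ℝ} {G : ℝ → ℝ × ℝ → ℂ}

/-- The space-time Fourier transform, in the frequency variables adapted to the phase `phiNV`. -/
noncomputable def spaceTimeFourier (G : ℝ → ℝ × ℝ → ℂ) (z : ℝ × (ℝ × ℝ)) : ℂ :=
  ∫ t : ℝ, Complex.exp (-(Complex.I * (t * (phiNV z.2.1 z.2.2 + z.1) : ℝ))) * planeFourier (G t) z.2

theorem measurable_spaceTimeFourier (hG : Measurable (Function.uncurry G)) :
    Measurable (spaceTimeFourier G) := by
  have h2 : Measurable fun x : (ℝ × (ℝ × ℝ)) × ℝ => planeFourier (G x.2) x.1.2 :=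
    (measurable_planeFourier_uncurry hG).comp
      ((measurable_snd.comp measurable_fst).prodMk measurable_snd)
  have h : Measurable (Function.uncurry fun (z : ℝ × (ℝ × ℝ)) (t : ℝ) =>
      Complex.exp (-(Complex.I * (t * (phiNV z.2.1 z.2.2 + z.1) : ℝ))) * planeFourier (G t) z.2) := by
    unfold Function.uncurry phiNV
    fun_prop
  exact h.stronglyMeasurable.integral_prod_right.measurable

theorem exists_lintegral_strip_spaceTimeFourier_le (hb : 1 / 2 < b) (h0 : 0 < θ) (h1 : θ < 1) :
    ∃ C : ℝ, 0 ≤ C ∧ ∀ (ω : Circle), (ω : ℂ) ^ 3 = 1 → ∀ G : ℝ → ℝ × ℝ → ℂ,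
      Measurable (Function.uncurry G) → Integrable (Function.uncurry G) →
      (∀ t, Integrable (G t)) → (∀ t, TwoSidedBounded (G t)) →
      ∫⁻ t, ENNReal.ofReal (((∫ v, ‖G t v‖ ^ (2 / (1 + θ))) ^ ((1 + θ) / 2)) ^ (2 / (2 - θ))) ≠ ⊤ →
      ∫⁻ z : ℝ × (ℝ × ℝ), ENNReal.ofReal ((1 + z.1 ^ 2) ^ (-b) *
        (Set.Ioi 0 ×ˢ Set.univ).indicator (fun k : ℝ × ℝ => k.1 ^ θ) (planeRotation ω z.2)) *
        ‖spaceTimeFourier G z‖ₑ ^ 2 ≤ ENNReal.ofReal C *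
        (∫⁻ t, ENNReal.ofReal (((∫ v, ‖G t v‖ ^ (2 / (1 + θ))) ^ ((1 + θ) / 2)) ^ (2 / (2 - θ)))) ^
          (2 - θ) := by
  obtain ⟨K, hK, hK1, -⟩ := exists_norm_integral_one_add_sq_rpow_neg_le hb h0 h1
  refine ⟨K * (((2 * Real.pi) ^ 2) ^ (1 - θ) * (18 * 4) ^ θ) * (2 * (2 / (1 - θ) + 2)), by
    have : 0 < 1 - θ := by linarith
    positivity, ?_⟩
  intro ω hω G hG hGi hGt hGb hfin
  have hSm := measurable_spaceTimeFourier hG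
  refine lintegral_le_of_tendsto_of_le
    (f := fun (n : ℕ) (z : ℝ × (ℝ × ℝ)) => ENNReal.ofReal ((1 + z.1 ^ 2) ^ (-b) *
      stripWeight θ (1 / ((n : ℝ) + 1)) ((n : ℝ) + 1) (1 / ((n : ℝ) + 1)) (planeRotation ω z.2)) *
        ‖spaceTimeFourier G z‖ₑ ^ 2) (fun n => ?_) (fun z => ?_) (fun n => ?_)
  · have h1 : Measurable fun z : ℝ × (ℝ × ℝ) =>
        stripWeight θ (1 / ((n : ℝ) + 1)) ((n : ℝ) + 1) (1 / ((n : ℝ) + 1)) (planeRotation ω z.2) :=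
      (measurable_stripWeight _ _ _ _).comp ((planeRotation ω).measurable.comp measurable_snd)
    fun_prop
  · refine ENNReal.Tendsto.mul_const ?_ (Or.inr (by finiteness))
    exact ENNReal.tendsto_ofReal ((tendsto_stripWeight _).const_mul _)
  · have hn : (0 : ℝ) < 1 / ((n : ℝ) + 1) := by positivity
    refine lintegral_weight_mul_enorm_sq_le (W := fun μ => (1 + μ ^ 2) ^ (-b))
      (w := fun k => stripWeight θ (1 / ((n : ℝ) + 1)) ((n : ℝ) + 1) (1 / ((n : ℝ) + 1)) (planeRotation ω k))
      (φ := fun k => phiNV k.1 k.2)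
      (n := fun t => (∫ v, ‖G t v‖ ^ (2 / (1 + θ))) ^ ((1 + θ) / 2)) h0 h1 (by positivity)
      (integrable_one_add_sq_rpow_neg hb) (fun μ => by positivity)
      ((measurePreserving_planeRotation ω).integrable_comp_of_integrable
        (integrable_stripWeight h0 hn hn))
      (fun k => stripWeight_nonneg hn _) (by unfold phiNV; fun_prop) hG hGi
      (measurable_integral_norm_rpow hG _ _) (fun t => by positivity) hfin ?_
    intro t s hts
    obtain ⟨l, hl, u, hu1, hu2⟩ := (hGb t).exists_common (hGb s)
    have hm : ∀ t, Measurable (G t) := fun t => hG.of_uncurry_left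
    have hts' : t - s ≠ 0 := sub_ne_zero.2 hts
    have h := norm_integral_stripWeight_le h0 h1 hn (show 1 / ((n : ℝ) + 1) ≤ (n : ℝ) + 1 by
      rw [div_le_iff₀ (by positivity)]; nlinarith [(Nat.cast_nonneg n : (0 : ℝ) ≤ n)]) hn hts' hω
      (hm t) (hm s) (hGt t) (hGt s) hl hu1 hu2
    have hpos : 0 < |t - s| := abs_pos.2 hts'
    refine (mul_le_mul (hK1 (t - s)) h (norm_nonneg _) hK).trans_eq ?_
    rw [show 18 * (4 / |t - s|) = 18 * 4 / |t - s| by ring, Real.div_rpow (by positivity) hpos.le,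
      Real.rpow_neg hpos.le, Real.mul_rpow (x := ∫ v, ‖G t v‖ ^ (2 / (1 + θ))) (by positivity) (by positivity)]
    ring

theorem exists_lintegral_unit_box_spaceTimeFourier_le (hb : 1 / 2 < b) (h0 : 0 < θ) (h1 : θ < 1) :
    ∃ C : ℝ, 0 ≤ C ∧ ∀ G : ℝ → ℝ × ℝ → ℂ,
      Measurable (Function.uncurry G) → Integrable (Function.uncurry G) →
      (∀ t, Integrable (G t)) → (∀ t, TwoSidedBounded (G t)) →
      ∫⁻ t, ENNReal.ofReal (((∫ v, ‖G t v‖ ^ (2 / (1 + θ))) ^ ((1 + θ) / 2)) ^ (2 / (2 - θ))) ≠ ⊤ →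
      ∫⁻ z : ℝ × (ℝ × ℝ), ENNReal.ofReal ((1 + z.1 ^ 2) ^ (-b) *
        (Metric.closedBall (0 : ℝ × ℝ) 1).indicator (fun _ => (1 : ℝ)) z.2) *
        ‖spaceTimeFourier G z‖ₑ ^ 2 ≤ ENNReal.ofReal C *
        (∫⁻ t, ENNReal.ofReal (((∫ v, ‖G t v‖ ^ (2 / (1 + θ))) ^ ((1 + θ) / 2)) ^ (2 / (2 - θ)))) ^
          (2 - θ) := by
  obtain ⟨K, hK, -, hK1⟩ := exists_norm_integral_one_add_sq_rpow_neg_le hb h0 h1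
  obtain ⟨L, hL, hL1⟩ := exists_norm_integral_unit_box_le h0 h1
  refine ⟨K * L * (2 * (2 / (1 - θ) + 2)), by
    have : 0 < 1 - θ := by linarith
    positivity, ?_⟩
  intro G hG hGi hGt hGb hfin
  refine lintegral_weight_mul_enorm_sq_le (W := fun μ => (1 + μ ^ 2) ^ (-b))
      (w := (Metric.closedBall (0 : ℝ × ℝ) 1).indicator (fun _ => (1 : ℝ)))
      (φ := fun k => phiNV k.1 k.2)
      (n := fun t => (∫ v, ‖G t v‖ ^ (2 / (1 + θ))) ^ ((1 + θ) / 2)) h0 h1 (by positivity)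
      (integrable_one_add_sq_rpow_neg hb) (fun μ => by positivity)
      integrable_indicator_unit_box
      (fun k => Set.indicator_nonneg (fun _ _ => zero_le_one) k) (by unfold phiNV; fun_prop) hG hGi
      (measurable_integral_norm_rpow hG _ _) (fun t => by positivity) hfin ?_
  intro t s hts
  obtain ⟨l, hl, u, hu1, hu2⟩ := (hGb t).exists_common (hGb s)
  have hm : ∀ t, Measurable (G t) := fun t => hG.of_uncurry_left
  have hts' : t - s ≠ 0 := sub_ne_zero.2 hts
  have h := hL1 (t - s) (hm t) (hm s) (hGt t) (hGt s) hl hu1 hu2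
  refine (mul_le_mul (hK1 (t - s) hts') h (norm_nonneg _) (by positivity)).trans_eq ?_
  rw [Real.mul_rpow (by positivity) (by positivity)]
  ring

end

theorem exists_circle_cube_eq_one {s : ℝ} (hs : s ^ 2 = 3) :
    ∃ ω : Circle, (ω : ℂ) ^ 3 = 1 ∧ (ω : ℂ).re = -1 / 2 ∧ (ω : ℂ).im = s / 2 := by
  have h : (⟨-1 / 2, s / 2⟩ : ℂ) ∈ Submonoid.unitSphere ℂ := by
    rw [Submonoid.unitSphere, Submonoid.mem_mk]
    simp only [Subsemigroup.mem_mk, mem_sphere_iff_norm, sub_zero]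
    rw [← sq_eq_sq₀ (norm_nonneg _) zero_le_one, ← Complex.normSq_eq_norm_sq, Complex.normSq_mk]
    linear_combination hs / 4
  refine ⟨⟨⟨-1 / 2, s / 2⟩, h⟩, ?_, rfl, rfl⟩
  change (⟨-1 / 2, s / 2⟩ : ℂ) ^ 3 = 1
  rw [pow_succ, pow_two]
  apply Complex.ext
  · simp only [Complex.mul_re, Complex.mul_im, Complex.one_re]
    linear_combination (3 / 8 : ℝ) * hs
  · simp only [Complex.mul_re, Complex.mul_im, Complex.one_im]
    linear_combination (-s / 8) * hs

theorem rpow_le_four_mul_rpow {θ N m : ℝ} (h0 : 0 < θ) (h1 : θ < 1) (hN : 1 ≤ N) (hm : 0 < m)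
    (hNm : N ≤ 4 * m ^ 2) : (1 + N) ^ (θ / 2) ≤ 4 * m ^ θ := by
  calc (1 + N) ^ (θ / 2) ≤ ((4 * m) ^ (2 : ℝ)) ^ (θ / 2) := by
        gcongr
        rw [Real.rpow_two]
        nlinarith
    _ = (4 * m) ^ θ := by rw [← Real.rpow_mul (by positivity)]; ring_nf
    _ = 4 ^ θ * m ^ θ := Real.mul_rpow (by positivity) hm.le
    _ ≤ 4 ^ (1 : ℝ) * m ^ θ := by gcongr; norm_num
    _ = 4 * m ^ θ := by rw [Real.rpow_one]

/-- Up to rotations by the cubic roots of unity, every high frequency has a large first coordinate. -/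
theorem exists_circle_weight_le : ∃ ω₁ ω₂ ω₃ : Circle,
    (ω₁ : ℂ) ^ 3 = 1 ∧ (ω₂ : ℂ) ^ 3 = 1 ∧ (ω₃ : ℂ) ^ 3 = 1 ∧
    ∀ θ : ℝ, 0 < θ → θ < 1 → ∀ k : ℝ × ℝ, (1 + (k.1 ^ 2 + k.2 ^ 2)) ^ (θ / 2) ≤
      4 * ((Metric.closedBall (0 : ℝ × ℝ) 1).indicator (fun _ => (1 : ℝ)) k +
        ((Set.Ioi 0 ×ˢ Set.univ).indicator (fun k : ℝ × ℝ => k.1 ^ θ) (planeRotation ω₁ k) +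
        ((Set.Ioi 0 ×ˢ Set.univ).indicator (fun k : ℝ × ℝ => k.1 ^ θ) (planeRotation ω₂ k) +
        (Set.Ioi 0 ×ˢ Set.univ).indicator (fun k : ℝ × ℝ => k.1 ^ θ) (planeRotation ω₃ k)))) := by
  have hs : √3 ^ 2 = (3 : ℝ) := Real.sq_sqrt (by norm_num)
  obtain ⟨ω₂, h2, h2r, h2i⟩ := exists_circle_cube_eq_one hs
  obtain ⟨ω₃, h3, h3r, h3i⟩ := exists_circle_cube_eq_one (s := -√3) (by rw [neg_sq, hs])
  refine ⟨1, ω₂, ω₃, by simp, h2, h3, fun θ h0 h1 k => ?_⟩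
  have hnn : ∀ k : ℝ × ℝ, 0 ≤ (Set.Ioi 0 ×ˢ Set.univ).indicator (fun k : ℝ × ℝ => k.1 ^ θ) k := by
    refine fun k => Set.indicator_nonneg (fun k hk => ?_) k
    have : 0 < k.1 := hk.1
    positivity
  have n1 := hnn (planeRotation 1 k)
  have n2 := hnn (planeRotation ω₂ k)
  have n3 := hnn (planeRotation ω₃ k)
  by_cases hk : k ∈ Metric.closedBall (0 : ℝ × ℝ) 1
  · rw [Set.indicator_of_mem hk]
    rw [mem_closedBall_zero_iff, Prod.norm_def, max_le_iff, Real.norm_eq_abs, Real.norm_eq_abs,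
      ← sq_le_one_iff_abs_le_one, ← sq_le_one_iff_abs_le_one] at hk
    have : (1 + (k.1 ^ 2 + k.2 ^ 2)) ^ (θ / 2) ≤ 4 := by
      calc _ ≤ (4 : ℝ) ^ (θ / 2) := by gcongr; linarith
        _ ≤ (4 : ℝ) ^ (1 : ℝ) := by gcongr <;> linarith
        _ = 4 := Real.rpow_one _
    linarith
  · rw [Set.indicator_of_notMem hk]
    rw [mem_closedBall_zero_iff, Prod.norm_def, max_le_iff, Real.norm_eq_abs, Real.norm_eq_abs,
      ← sq_le_one_iff_abs_le_one, ← sq_le_one_iff_abs_le_one, not_and_or, not_le, not_le] at hk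
    have hN : 1 ≤ k.1 ^ 2 + k.2 ^ 2 := by
      rcases hk with hk | hk <;> nlinarith [sq_nonneg k.1, sq_nonneg k.2]
    have key : ∀ ω : Circle, 0 < (planeRotation ω k).1 →
        k.1 ^ 2 + k.2 ^ 2 ≤ 4 * (planeRotation ω k).1 ^ 2 →
        (1 + (k.1 ^ 2 + k.2 ^ 2)) ^ (θ / 2) ≤ 4 *
          (Set.Ioi 0 ×ˢ Set.univ).indicator (fun k : ℝ × ℝ => k.1 ^ θ) (planeRotation ω k) := by
      intro ω hp hle
      rw [Set.indicator_of_mem (show planeRotation ω k ∈ Set.Ioi 0 ×ˢ Set.univ from ⟨hp, trivial⟩)]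
      exact rpow_le_four_mul_rpow h0 h1 hN hp hle
    have e1 : (planeRotation 1 k).1 = k.1 := by simp [planeRotation_apply]
    have e2 : (planeRotation ω₂ k).1 = -1 / 2 * k.1 - √3 / 2 * k.2 := by
      rw [planeRotation_apply, h2r, h2i]
    have e3 : (planeRotation ω₃ k).1 = -1 / 2 * k.1 + √3 / 2 * k.2 := by
      rw [planeRotation_apply, h3r, h3i]; ring
    have s0 : 0 < √3 := by positivity
    rcases lt_or_ge 0 k.1 with hx | hx
    · by_cases hA : k.2 ^ 2 ≤ 3 * k.1 ^ 2
      · have := key 1 (by rwa [e1]) (by rw [e1]; linarith)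
        linarith
      · rw [not_le] at hA
        rcases le_total 0 k.2 with hy | hy
        · have hb : √3 * k.1 < k.2 := by
            refine lt_of_pow_lt_pow_left₀ 2 hy ?_
            rw [mul_pow, hs]; exact hA
          have := key ω₃ (by rw [e3]; nlinarith) (by rw [e3]; nlinarith)
          linarith
        · have hb : √3 * k.1 < -k.2 := by
            refine lt_of_pow_lt_pow_left₀ 2 (by linarith) ?_
            rw [mul_pow, hs, neg_sq]; exact hA
          have := key ω₂ (by rw [e2]; nlinarith) (by rw [e2]; nlinarith)
          linarith
    · rcases le_total 0 k.2 with hy | hy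
      · have hp : 0 < -1 / 2 * k.1 + √3 / 2 * k.2 := by
          rcases hx.lt_or_eq with hx | hx
          · nlinarith [mul_nonneg s0.le hy]
          · have : 0 < k.2 := by
              rcases hy.lt_or_eq with h | h
              · exact h
              · rw [hx, ← h] at hN; norm_num at hN
            rw [hx]; nlinarith [mul_pos s0 this]
        have := key ω₃ (by rwa [e3]) (by rw [e3]; nlinarith [mul_nonneg s0.le hy, mul_nonneg (mul_nonneg s0.le hy) (neg_nonneg.2 hx)])
        linarith
      · have hy' : 0 ≤ -k.2 := by linarith
        have hp : 0 < -1 / 2 * k.1 - √3 / 2 * k.2 := by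
          rcases hx.lt_or_eq with hx | hx
          · nlinarith [mul_nonneg s0.le hy']
          · have : 0 < -k.2 := by
              rcases hy'.lt_or_eq with h | h
              · exact h
              · rw [hx, show k.2 = 0 by linarith] at hN; norm_num at hN
            rw [hx]; nlinarith [mul_pos s0 this]
        have := key ω₂ (by rwa [e2]) (by rw [e2]; nlinarith [mul_nonneg s0.le hy', mul_nonneg (mul_nonneg s0.le hy') (neg_nonneg.2 hx)])
        linarith

theorem exists_lintegral_spaceTimeFourier_le {b θ : ℝ} (hb : 1 / 2 < b) (h0 : 0 < θ) (h1 : θ < 1) :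
    ∃ C : ℝ, 0 ≤ C ∧ ∀ G : ℝ → ℝ × ℝ → ℂ,
      Measurable (Function.uncurry G) → Integrable (Function.uncurry G) →
      (∀ t, Integrable (G t)) → (∀ t, TwoSidedBounded (G t)) →
      ∫⁻ t, ENNReal.ofReal (((∫ v, ‖G t v‖ ^ (2 / (1 + θ))) ^ ((1 + θ) / 2)) ^ (2 / (2 - θ))) ≠ ⊤ →
      ∫⁻ z : ℝ × (ℝ × ℝ), ENNReal.ofReal ((1 + z.1 ^ 2) ^ (-b) *
        (1 + (z.2.1 ^ 2 + z.2.2 ^ 2)) ^ (θ / 2)) * ‖spaceTimeFourier G z‖ₑ ^ 2 ≤ ENNReal.ofReal C *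
        (∫⁻ t, ENNReal.ofReal (((∫ v, ‖G t v‖ ^ (2 / (1 + θ))) ^ ((1 + θ) / 2)) ^ (2 / (2 - θ)))) ^
          (2 - θ) := by
  obtain ⟨K, hK, hK1⟩ := exists_lintegral_unit_box_spaceTimeFourier_le hb h0 h1
  obtain ⟨L, hL, hL1⟩ := exists_lintegral_strip_spaceTimeFourier_le hb h0 h1
  obtain ⟨ω₁, ω₂, ω₃, hω₁, hω₂, hω₃, hω⟩ := exists_circle_weight_le
  refine ⟨4 * (K + (L + (L + L))), by positivity, fun G hG hGi hGt hGb hfin => ?_⟩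
  have hSm := measurable_spaceTimeFourier hG
  have H0 := hK1 G hG hGi hGt hGb hfin
  have H1 := hL1 ω₁ hω₁ G hG hGi hGt hGb hfin
  have H2 := hL1 ω₂ hω₂ G hG hGi hGt hGb hfin
  have H3 := hL1 ω₃ hω₃ G hG hGi hGt hGb hfin
  have m0 : Measurable ((Metric.closedBall (0 : ℝ × ℝ) 1).indicator (fun _ => (1 : ℝ))) :=
    measurable_const.indicator Metric.isClosed_closedBall.measurableSet
  have m1 : ∀ ω : Circle, Measurable fun z : ℝ × (ℝ × ℝ) =>
      (Set.Ioi 0 ×ˢ Set.univ).indicator (fun k : ℝ × ℝ => k.1 ^ θ) (planeRotation ω z.2) := fun ω =>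
    (Measurable.indicator (by fun_prop) (measurableSet_Ioi.prod .univ)).comp
      ((planeRotation ω).measurable.comp measurable_snd)
  have p0 : ∀ k, 0 ≤ (Metric.closedBall (0 : ℝ × ℝ) 1).indicator (fun _ => (1 : ℝ)) k :=
    fun k => Set.indicator_nonneg (fun _ _ => zero_le_one) k
  have p1 : ∀ k : ℝ × ℝ, 0 ≤ (Set.Ioi 0 ×ˢ Set.univ).indicator (fun k : ℝ × ℝ => k.1 ^ θ) k := by
    refine fun k => Set.indicator_nonneg (fun k hk => ?_) k
    have : 0 < k.1 := hk.1
    positivity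
  set T := (∫⁻ t, ENNReal.ofReal (((∫ v, ‖G t v‖ ^ (2 / (1 + θ))) ^ ((1 + θ) / 2)) ^ (2 / (2 - θ)))) ^
          (2 - θ)
  calc _ ≤ ∫⁻ z : ℝ × (ℝ × ℝ), ENNReal.ofReal 4 * (
        ENNReal.ofReal ((1 + z.1 ^ 2) ^ (-b) *
          (Metric.closedBall (0 : ℝ × ℝ) 1).indicator (fun _ => (1 : ℝ)) z.2) *
          ‖spaceTimeFourier G z‖ₑ ^ 2 + (
        ENNReal.ofReal ((1 + z.1 ^ 2) ^ (-b) *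
          (Set.Ioi 0 ×ˢ Set.univ).indicator (fun k : ℝ × ℝ => k.1 ^ θ) (planeRotation ω₁ z.2)) *
          ‖spaceTimeFourier G z‖ₑ ^ 2 + (
        ENNReal.ofReal ((1 + z.1 ^ 2) ^ (-b) *
          (Set.Ioi 0 ×ˢ Set.univ).indicator (fun k : ℝ × ℝ => k.1 ^ θ) (planeRotation ω₂ z.2)) *
          ‖spaceTimeFourier G z‖ₑ ^ 2 +
        ENNReal.ofReal ((1 + z.1 ^ 2) ^ (-b) *
          (Set.Ioi 0 ×ˢ Set.univ).indicator (fun k : ℝ × ℝ => k.1 ^ θ) (planeRotation ω₃ z.2)) *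
          ‖spaceTimeFourier G z‖ₑ ^ 2))) := by
        refine lintegral_mono fun z => ?_
        have w0 : (0 : ℝ) ≤ (1 + z.1 ^ 2) ^ (-b) := by positivity
        have q0 := mul_nonneg w0 (p0 z.2)
        have q1 := mul_nonneg w0 (p1 (planeRotation ω₁ z.2))
        have q2 := mul_nonneg w0 (p1 (planeRotation ω₂ z.2))
        have q3 := mul_nonneg w0 (p1 (planeRotation ω₃ z.2))
        beta_reduce
        rw [← add_mul, ← add_mul, ← add_mul, ← mul_assoc, ← ENNReal.ofReal_add q2 q3,
          ← ENNReal.ofReal_add q1 (add_nonneg q2 q3),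
          ← ENNReal.ofReal_add q0 (add_nonneg q1 (add_nonneg q2 q3)),
          ← ENNReal.ofReal_mul (by norm_num)]
        refine mul_le_mul_left (ENNReal.ofReal_le_ofReal ?_) _
        refine (mul_le_mul_of_nonneg_left (hω θ h0 h1 z.2) w0).trans_eq ?_
        ring
    _ ≤ ENNReal.ofReal 4 * (ENNReal.ofReal K * T + (ENNReal.ofReal L * T +
          (ENNReal.ofReal L * T + ENNReal.ofReal L * T))) := by
        have := m1 ω₁
        have := m1 ω₂
        rw [lintegral_const_mul' _ _ (by finiteness), lintegral_add_left (by fun_prop),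
          lintegral_add_left (by fun_prop), lintegral_add_left (by fun_prop)]
        gcongr
    _ = _ := by
        rw [ENNReal.ofReal_mul (by norm_num), ENNReal.ofReal_add hK (by positivity),
          ENNReal.ofReal_add hL (by positivity), ENNReal.ofReal_add hL hL]
        ring

/-- The Fourier multiplier in `transferFn`. -/
noncomputable def transferWeight (p b : ℝ) (w : ℝ × ℝ × ℝ) : ℝ :=
  √(1 + w.1 ^ 2 + w.2.1 ^ 2) ^ (1 / p) * √(1 + (w.2.2 - phiNV w.1 w.2.1) ^ 2) ^ (-b)

theorem transferWeight_nonneg (p b : ℝ) (w : ℝ × ℝ × ℝ) : 0 ≤ transferWeight p b w := by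
  unfold transferWeight; positivity

theorem measurable_transferWeight (p b : ℝ) : Measurable (transferWeight p b) := by
  unfold transferWeight phiNV; fun_prop

theorem transferWeight_sq (p b : ℝ) (w : ℝ × ℝ × ℝ) : transferWeight p b w ^ 2 =
    (1 + (w.2.2 - phiNV w.1 w.2.1) ^ 2) ^ (-b) * (1 + (w.1 ^ 2 + w.2.1 ^ 2)) ^ (2 / p / 2) := by
  have h : ∀ x s : ℝ, 0 ≤ x → (√x ^ s) ^ 2 = x ^ s := by
    intro x s hx
    rw [← Real.rpow_mul_natCast (Real.sqrt_nonneg _), mul_comm, Nat.cast_ofNat, Real.rpow_mul (Real.sqrt_nonneg _),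
      Real.rpow_two, Real.sq_sqrt hx]
  rw [transferWeight, mul_pow, h _ _ (by positivity), h _ _ (by positivity), mul_comm, ← add_assoc]
  congr 2
  ring

theorem transferFn_eq (p b : ℝ) (F : ℝ × ℝ × ℝ → ℂ) (t : ℝ) (v : ℝ × ℝ) :
    transferFn p b F t v = (2 * Real.pi : ℂ)⁻¹ ^ 3 * ∫ w : ℝ × ℝ × ℝ,
      Complex.exp (Complex.I * (v.1 * w.1 + v.2 * w.2.1 + t * w.2.2 : ℝ)) *
        ((transferWeight p b w : ℂ) * F w) := by
  rw [transferFn]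
  congr 1
  refine integral_congr_ae (ae_of_all _ fun w => ?_)
  simp only [transferWeight]
  push_cast
  ring

theorem norm_two_pi_inv_pow_le : ‖(2 * Real.pi : ℂ)⁻¹ ^ 3‖ ≤ 1 := by
  rw [norm_pow, norm_inv, norm_mul, Complex.norm_real, Real.norm_of_nonneg Real.pi_pos.le]
  refine pow_le_one₀ (by positivity) (inv_le_one_of_one_le₀ ?_)
  rw [Complex.norm_ofNat]
  linarith [Real.pi_gt_three]

theorem norm_exp_I_mul (r : ℝ) : ‖Complex.exp (Complex.I * (r : ℂ))‖ = 1 := by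
  rw [mul_comm, Complex.norm_exp_ofReal_mul_I]

theorem lintegral_comp_shear {h : ℝ × (ℝ × ℝ) → ENNReal} (hh : Measurable h) {φ : ℝ × ℝ → ℝ}
    (hφ : Measurable φ) :
    ∫⁻ w : ℝ × ℝ × ℝ, h (w.2.2 - φ (w.1, w.2.1), (w.1, w.2.1)) = ∫⁻ z, h z := by
  have h1 : Measurable fun w : ℝ × ℝ × ℝ => h (w.2.2 - φ (w.1, w.2.1), (w.1, w.2.1)) := by fun_prop
  have h2 : ∀ x : ℝ, Measurable fun w : ℝ × ℝ => h (w.2 - φ (x, w.1), (x, w.1)) := fun x => by fun_prop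
  rw [Measure.volume_eq_prod ℝ (ℝ × ℝ), lintegral_prod_symm h hh.aemeasurable,
    lintegral_prod _ h1.aemeasurable, Measure.volume_eq_prod ℝ ℝ,
    lintegral_prod _ (hh.lintegral_prod_left').aemeasurable]
  refine lintegral_congr fun x => ?_
  rw [lintegral_prod _ (h2 x).aemeasurable]
  refine lintegral_congr fun y => ?_
  exact lintegral_sub_right_eq_self (fun μ => h (μ, (x, y))) (φ (x, y))

section

variable {p b : ℝ} {F : ℝ × ℝ × ℝ → ℂ} {G : ℝ → ℝ × ℝ → ℂ}

theorem integral_transferFn_mul_conj (hF : Integrable fun w => (transferWeight p b w : ℂ) * F w)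
    (hGi : Integrable (Function.uncurry G)) :
    ∫ z : ℝ × (ℝ × ℝ), transferFn p b F z.1 z.2 * (starRingEnd ℂ) (G z.1 z.2) =
    (2 * Real.pi : ℂ)⁻¹ ^ 3 * ∫ w : ℝ × ℝ × ℝ, ((transferWeight p b w : ℂ) * F w) *
      (starRingEnd ℂ) (spaceTimeFourier G (w.2.2 - phiNV w.1 w.2.1, (w.1, w.2.1))) := by
  set e : ℝ × (ℝ × ℝ) → ℝ × ℝ × ℝ → ℂ := fun z w =>
    Complex.exp (Complex.I * (z.2.1 * w.1 + z.2.2 * w.2.1 + z.1 * w.2.2 : ℝ)) with he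
  have hint : Integrable (Function.uncurry fun z w => e z w *
      (((transferWeight p b w : ℂ) * F w) * (starRingEnd ℂ) (G z.1 z.2))) (volume.prod volume) := by
    have h1 : Integrable (fun x : (ℝ × (ℝ × ℝ)) × (ℝ × ℝ × ℝ) =>
        (starRingEnd ℂ) (Function.uncurry G x.1) * ((transferWeight p b x.2 : ℂ) * F x.2))
        (volume.prod volume) :=
      Integrable.mul_prod (f := fun z => (starRingEnd ℂ) (Function.uncurry G z))
        ((LinearIsometryEquiv.integrable_comp_iff Complex.conjLIE).2 hGi) hF
    refine h1.norm.mono' ?_ (ae_of_all _ fun x => ?_)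
    · have h2 : AEStronglyMeasurable (fun x : (ℝ × (ℝ × ℝ)) × (ℝ × ℝ × ℝ) => e x.1 x.2)
          (volume.prod volume) := Measurable.aestronglyMeasurable (by rw [he]; fun_prop)
      refine (h2.mul h1.aestronglyMeasurable).congr (ae_of_all _ fun x => ?_)
      simp only [Pi.mul_apply, Function.uncurry]
      ring
    · simp only [Function.uncurry, norm_mul, he, norm_exp_I_mul, one_mul]
      rw [mul_comm]
  have e1 : ∀ z : ℝ × (ℝ × ℝ), transferFn p b F z.1 z.2 * (starRingEnd ℂ) (G z.1 z.2) =
      (2 * Real.pi : ℂ)⁻¹ ^ 3 * ∫ w, e z w *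
      (((transferWeight p b w : ℂ) * F w) * (starRingEnd ℂ) (G z.1 z.2)) := by
    intro z
    rw [transferFn_eq, mul_assoc, ← integral_mul_const]
    simp_rw [mul_assoc]
    rfl
  simp_rw [e1]
  rw [integral_const_mul, integral_integral_swap hint]
  congr 1
  refine integral_congr_ae (ae_of_all _ fun w => ?_)
  beta_reduce
  have e2 : spaceTimeFourier G (w.2.2 - phiNV w.1 w.2.1, (w.1, w.2.1)) =
      ∫ z : ℝ × (ℝ × ℝ), (starRingEnd ℂ) (e z w) * G z.1 z.2 := by
    rw [Measure.volume_eq_prod ℝ (ℝ × ℝ), integral_prod, spaceTimeFourier]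
    · refine integral_congr_ae (ae_of_all _ fun t => ?_)
      simp only [planeFourier]
      rw [← integral_const_mul]
      refine integral_congr_ae (ae_of_all _ fun v => ?_)
      simp only [he]
      rw [← Complex.exp_conj, map_mul, Complex.conj_I, Complex.conj_ofReal, mul_left_comm,
        ← Complex.exp_add, mul_comm]
      congr 2
      push_cast
      ring
    · refine hGi.norm.mono' ?_ (ae_of_all _ fun z => ?_)
      · have h2 : AEStronglyMeasurable (fun z => (starRingEnd ℂ) (e z w)) (volume.prod volume) :=
          Measurable.aestronglyMeasurable (by rw [he]; fun_prop)
        exact h2.mul hGi.aestronglyMeasurable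
      · rw [norm_mul, RCLike.norm_conj, he, norm_exp_I_mul, one_mul]
        rfl
  rw [e2, ← integral_conj, ← integral_const_mul]
  refine integral_congr_ae (ae_of_all _ fun z => ?_)
  simp only [map_mul, Complex.conj_conj]
  ring

/-- Duality form of the estimate. -/
theorem exists_enorm_integral_transferFn_mul_conj_le {θ : ℝ} (hb : 1 / 2 < b) (h0 : 0 < 2 / p)
    (h1 : 2 / p < 1) (hθ : θ = 2 / p) : ∃ C : ℝ, 0 ≤ C ∧ ∀ F : ℝ × ℝ × ℝ → ℂ, Measurable F →
      Integrable (fun w => (transferWeight p b w : ℂ) * F w) → ∀ G : ℝ → ℝ × ℝ → ℂ,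
      Measurable (Function.uncurry G) → Integrable (Function.uncurry G) →
      (∀ t, Integrable (G t)) → (∀ t, TwoSidedBounded (G t)) →
      ∫⁻ t, ENNReal.ofReal (((∫ v, ‖G t v‖ ^ (2 / (1 + θ))) ^ ((1 + θ) / 2)) ^ (2 / (2 - θ))) ≠ ⊤ →
      ‖∫ z : ℝ × (ℝ × ℝ), transferFn p b F z.1 z.2 * (starRingEnd ℂ) (G z.1 z.2)‖ₑ ≤
        ENNReal.ofReal C * (∫⁻ w, ‖F w‖ₑ ^ (2 : ℝ)) ^ ((1 : ℝ) / 2) *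
        (∫⁻ t, ENNReal.ofReal (((∫ v, ‖G t v‖ ^ (2 / (1 + θ))) ^ ((1 + θ) / 2)) ^ (2 / (2 - θ)))) ^
          ((2 - θ) / 2) := by
  obtain ⟨K, hK, hK1⟩ := exists_lintegral_spaceTimeFourier_le hb h0 h1
  subst hθ
  refine ⟨√K, by positivity, fun F hFm hF G hG hGi hGt hGb hfin => ?_⟩
  have H := hK1 G hG hGi hGt hGb hfin
  have hSm := measurable_spaceTimeFourier hG
  set T := ∫⁻ t, ENNReal.ofReal (((∫ v, ‖G t v‖ ^ (2 / (1 + 2 / p))) ^ ((1 + 2 / p) / 2)) ^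
    (2 / (2 - 2 / p)))
  have hφ : Measurable fun k : ℝ × ℝ => phiNV k.1 k.2 := by unfold phiNV; fun_prop
  have hwm := measurable_transferWeight p b
  have hS2 : Measurable fun w : ℝ × ℝ × ℝ =>
      spaceTimeFourier G (w.2.2 - phiNV w.1 w.2.1, (w.1, w.2.1)) := by
    refine hSm.comp ?_
    unfold phiNV
    fun_prop
  have hsq : ∫⁻ w : ℝ × ℝ × ℝ, (ENNReal.ofReal (transferWeight p b w) *
      ‖spaceTimeFourier G (w.2.2 - phiNV w.1 w.2.1, (w.1, w.2.1))‖ₑ) ^ (2 : ℝ) ≤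
      ENNReal.ofReal K * T ^ (2 - 2 / p) := by
    refine le_trans (le_of_eq ?_) H
    refine Eq.trans ?_ (lintegral_comp_shear (h := fun z => ENNReal.ofReal ((1 + z.1 ^ 2) ^ (-b) *
      (1 + (z.2.1 ^ 2 + z.2.2 ^ 2)) ^ (2 / p / 2)) * ‖spaceTimeFourier G z‖ₑ ^ 2) (by fun_prop) hφ)
    refine lintegral_congr fun w => ?_
    rw [ENNReal.rpow_two, mul_pow, ← ENNReal.ofReal_pow (transferWeight_nonneg _ _ _),
      transferWeight_sq]
  rw [integral_transferFn_mul_conj hF hGi, enorm_mul]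
  calc _ ≤ 1 * ∫⁻ w : ℝ × ℝ × ℝ, ‖F w‖ₑ * (ENNReal.ofReal (transferWeight p b w) *
      ‖spaceTimeFourier G (w.2.2 - phiNV w.1 w.2.1, (w.1, w.2.1))‖ₑ) := by
        gcongr
        · rw [← ofReal_norm, ← ENNReal.ofReal_one]
          exact ENNReal.ofReal_le_ofReal norm_two_pi_inv_pow_le
        · refine (enorm_integral_le_lintegral_enorm _).trans_eq (lintegral_congr fun w => ?_)
          rw [enorm_mul, enorm_mul, RCLike.enorm_conj, ← ofReal_norm (transferWeight p b w : ℂ), Complex.norm_real,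
            Real.norm_of_nonneg (transferWeight_nonneg _ _ _)]
          ring
    _ ≤ (∫⁻ w, ‖F w‖ₑ ^ (2 : ℝ)) ^ ((1 : ℝ) / 2) *
        (ENNReal.ofReal K * T ^ (2 - 2 / p)) ^ ((1 : ℝ) / 2) := by
        rw [one_mul]
        refine (ENNReal.lintegral_mul_le_Lp_mul_Lq volume Real.HolderConjugate.two_two
          hFm.enorm.aemeasurable (by fun_prop)).trans ?_
        gcongr
    _ = _ := by
        rw [ENNReal.mul_rpow_of_nonneg _ _ (by norm_num), ← ENNReal.rpow_mul,
          ENNReal.ofReal_rpow_of_nonneg hK (by norm_num), ← Real.sqrt_eq_rpow, mul_one_div]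
        ring

end

theorem rpow_sub_one_mul_self {x s : ℝ} (hx : 0 ≤ x) (hs : s ≠ 0) : x ^ (s - 1) * x = x ^ s := by
  rcases hx.eq_or_lt with rfl | hx
  · rw [mul_zero, Real.zero_rpow hs]
  · rw [Real.rpow_sub_one hx.ne', div_mul_cancel₀ _ hx.ne']

theorem rpow_mul_self_rpow_rpow {p q : ℝ} (hp : 2 < p) (hpq : 2 / p + 2 / q = 1) {x : ℝ} (hx : 0 ≤ x) :
    (((x ^ (p / q - 1)) ^ (2 / (1 + 2 / p)) * x) ^ ((1 + 2 / p) / 2)) ^ (2 / (2 - 2 / p)) = x ^ (p / q) := by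
  have hp0 : 0 < p := by linarith
  have hθ : 2 / p < 1 := (div_lt_one hp0).2 hp
  have hq : 0 < q := by
    by_contra h
    have : 2 / q ≤ 0 := div_nonpos_of_nonneg_of_nonpos zero_le_two (not_lt.1 h)
    linarith
  have hpos : 0 < 2 / p := by positivity
  rcases hx.eq_or_lt with rfl | hx
  · have : 0 < 2 - 2 / p := by linarith
    rw [mul_zero, Real.zero_rpow (by positivity), Real.zero_rpow (by positivity),
      Real.zero_rpow (by positivity)]
  · rw [← Real.rpow_mul hx.le, ← Real.rpow_add_one hx.ne', ← Real.rpow_mul hx.le,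
      ← Real.rpow_mul hx.le]
    congr 1
    have e : q = 2 * p / (p - 2) := by
      rw [eq_div_iff (by linarith)]
      field_simp at hpq
      linarith
    have h1 : p - 2 ≠ 0 := by linarith
    have h2 : 2 * p - 2 ≠ 0 := by linarith
    have h3 : p + 2 ≠ 0 := by linarith
    have h4 : p - 1 ≠ 0 := by linarith
    subst e
    have e1 : 1 + 2 / p = (p + 2) / p := by field_simp
    have e2 : 2 - 2 / p = (2 * p - 2) / p := by field_simp
    rw [e1, e2]
    field_simp
    ring

/-- A function supported in a box, with values bounded above and below on its support. -/
structure IsBoxTruncated (f : ℝ → ℝ × ℝ → ℂ) (m : ℝ) : Prop where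
  measurable : Measurable (Function.uncurry f)
  abs_time_le : ∀ t v, f t v ≠ 0 → |t| ≤ m
  norm_le : ∀ t v, f t v ≠ 0 → ‖v‖ ≤ m
  le_norm_apply : ∀ t v, f t v ≠ 0 → 1 / m ≤ ‖f t v‖
  norm_apply_le : ∀ t v, f t v ≠ 0 → ‖f t v‖ ≤ m

namespace IsBoxTruncated

variable {f : ℝ → ℝ × ℝ → ℂ} {m : ℝ} {p q : ℝ}

theorem norm_rpow_le (h : IsBoxTruncated f m) (hm : 0 < m) (hq : 0 < q) (t : ℝ) (v : ℝ × ℝ) :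
    ‖f t v‖ ^ q ≤ (Metric.closedBall (0 : ℝ × ℝ) m).indicator (fun _ => m ^ q) v := by
  by_cases h0 : f t v = 0
  · rw [h0, norm_zero, Real.zero_rpow hq.ne']
    exact Set.indicator_nonneg (fun _ _ => by positivity) _
  · rw [Set.indicator_of_mem (mem_closedBall_zero_iff.2 (h.norm_le t v h0))]
    exact Real.rpow_le_rpow (norm_nonneg _) (h.norm_apply_le t v h0) hq.le

theorem integrable_box (m c : ℝ) :
    Integrable ((Metric.closedBall (0 : ℝ × ℝ) m).indicator fun _ => c) :=
  (integrable_indicator_iff Metric.isClosed_closedBall.measurableSet).2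
    (integrableOn_const (isCompact_closedBall _ _).measure_lt_top.ne)

theorem integrable_norm_rpow (h : IsBoxTruncated f m) (hm : 0 < m) (hq : 0 < q) (t : ℝ) :
    Integrable fun v => ‖f t v‖ ^ q := by
  refine (integrable_box m (m ^ q)).mono' ?_ (ae_of_all _ fun v => ?_)
  · exact (h.measurable.of_uncurry_left.norm.pow_const q).aestronglyMeasurable
  · rw [Real.norm_of_nonneg (by positivity)]
    exact h.norm_rpow_le hm hq t v

theorem integrable_integral_norm_rpow (h : IsBoxTruncated f m) (hm : 0 < m) (hq : 0 < q)
    {s : ℝ} (hs : 0 < s) : Integrable fun t => (∫ v, ‖f t v‖ ^ q) ^ s := by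
  set D := ∫ v, (Metric.closedBall (0 : ℝ × ℝ) m).indicator (fun _ => m ^ q) v
  have hD : Integrable ((Set.Icc (-m) m).indicator fun _ : ℝ => D ^ s) :=
    (integrable_indicator_iff measurableSet_Icc).2 (integrableOn_const (by simp))
  refine hD.mono' (measurable_integral_norm_rpow h.measurable q s).aestronglyMeasurable
    (ae_of_all _ fun t => ?_)
  have hM0 : 0 ≤ ∫ v, ‖f t v‖ ^ q := by positivity
  rw [Real.norm_of_nonneg (by positivity)]
  by_cases ht : t ∈ Set.Icc (-m) m
  · rw [Set.indicator_of_mem ht]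
    exact Real.rpow_le_rpow hM0 (integral_mono (h.integrable_norm_rpow hm hq t) (integrable_box m _)
      (h.norm_rpow_le hm hq t)) hs.le
  · rw [Set.indicator_of_notMem ht]
    have : ∀ v, f t v = 0 := fun v => by
      by_contra h0
      exact ht (abs_le.1 (h.abs_time_le t v h0))
    simp [this, Real.zero_rpow hq.ne', Real.zero_rpow hs.ne']

/-- The dual function for the mixed Lebesgue norm. -/
noncomputable def dual (f : ℝ → ℝ × ℝ → ℂ) (p q : ℝ) (t : ℝ) (v : ℝ × ℝ) : ℂ :=
  (((∫ v, ‖f t v‖ ^ q) ^ (p / q - 1) * ‖f t v‖ ^ (q - 2) : ℝ) : ℂ) * f t v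

theorem norm_dual (hq : 2 < q) (t : ℝ) (v : ℝ × ℝ) :
    ‖dual f p q t v‖ = (∫ v, ‖f t v‖ ^ q) ^ (p / q - 1) * ‖f t v‖ ^ (q - 1) := by
  have h0 : 0 ≤ ∫ v, ‖f t v‖ ^ q := by positivity
  rw [dual, norm_mul, Complex.norm_real, Real.norm_of_nonneg (by positivity), mul_assoc,
    show q - 2 = q - 1 - 1 by ring, rpow_sub_one_mul_self (norm_nonneg _) (by linarith)]

theorem measurable_dual (h : IsBoxTruncated f m) : Measurable (Function.uncurry (dual f p q)) := by
  have h1 := (measurable_integral_norm_rpow h.measurable q (p / q - 1)).comp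
    (measurable_fst : Measurable (Prod.fst : ℝ × (ℝ × ℝ) → ℝ))
  exact (Complex.measurable_ofReal.comp (h1.mul (h.measurable.norm.pow_const (q - 2)))).mul h.measurable

theorem norm_dual_le (h : IsBoxTruncated f m) (hm : 0 < m) (hq : 2 < q) (t : ℝ) (v : ℝ × ℝ) :
    ‖dual f p q t v‖ ≤ (∫ v, ‖f t v‖ ^ q) ^ (p / q - 1) * m * ‖f t v‖ ^ q := by
  have h0 : 0 ≤ ∫ v, ‖f t v‖ ^ q := by positivity
  rw [norm_dual hq, mul_assoc]
  refine mul_le_mul_of_nonneg_left ?_ (by positivity)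
  by_cases hf : f t v = 0
  · rw [hf, norm_zero, Real.zero_rpow (by linarith), Real.zero_rpow (by linarith), mul_zero]
  · rw [← rpow_sub_one_mul_self (norm_nonneg (f t v)) (by linarith : q ≠ 0)]
    have h1 := h.le_norm_apply t v hf
    rw [div_le_iff₀ hm] at h1
    have : 0 ≤ ‖f t v‖ ^ (q - 1) := by positivity
    nlinarith

theorem integrable_dual_apply (h : IsBoxTruncated f m) (hm : 0 < m) (hq : 2 < q) (t : ℝ) :
    Integrable (dual f p q t) :=
  ((h.integrable_norm_rpow hm (by linarith) t).const_mul _).mono'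
    h.measurable_dual.of_uncurry_left.aestronglyMeasurable
    (ae_of_all _ fun v => h.norm_dual_le hm hq t v)

theorem integrable_dual (h : IsBoxTruncated f m) (hm : 0 < m) (hp : 0 < p) (hq : 2 < q) :
    Integrable (Function.uncurry (dual f p q)) := by
  have hq0 : 0 < q := by linarith
  refine (integrable_prod_iff h.measurable_dual.aestronglyMeasurable).2
    ⟨ae_of_all _ fun t => h.integrable_dual_apply hm hq t, ?_⟩
  refine ((h.integrable_integral_norm_rpow hm hq0 (div_pos hp hq0)).const_mul m).mono'
    (h.measurable_dual.norm.stronglyMeasurable.integral_prod_right' (ν := volume)).aestronglyMeasurable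
    (ae_of_all _ fun t => ?_)
  have h0 : 0 ≤ ∫ v, ‖f t v‖ ^ q := by positivity
  rw [Real.norm_of_nonneg (by positivity), ← rpow_sub_one_mul_self h0 (div_pos hp hq0).ne',
    ← mul_assoc, mul_comm m, ← integral_const_mul]
  exact integral_mono (h.integrable_dual_apply hm hq t).norm
    ((h.integrable_norm_rpow hm hq0 t).const_mul _) (h.norm_dual_le hm hq t)

theorem twoSidedBounded_dual (h : IsBoxTruncated f m) (hm : 0 < m) (hq : 2 < q) (t : ℝ) :
    TwoSidedBounded (dual f p q t) := by
  have h0 : 0 ≤ (∫ v, ‖f t v‖ ^ q) ^ (p / q - 1) := by positivity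
  rcases h0.eq_or_lt with h1 | h1
  · exact ⟨1, one_pos, 0, fun v => Or.inl (by rw [dual, ← h1]; simp)⟩
  · refine ⟨(∫ v, ‖f t v‖ ^ q) ^ (p / q - 1) * (1 / m) ^ (q - 1), by positivity,
      (∫ v, ‖f t v‖ ^ q) ^ (p / q - 1) * m ^ (q - 1), fun v => ?_⟩
    by_cases hf : f t v = 0
    · left; rw [dual, hf, mul_zero]
    · right
      rw [norm_dual hq]
      exact ⟨mul_le_mul_of_nonneg_left (Real.rpow_le_rpow (by positivity) (h.le_norm_apply t v hf)
        (by linarith)) h0, mul_le_mul_of_nonneg_left (Real.rpow_le_rpow (norm_nonneg _)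
        (h.norm_apply_le t v hf) (by linarith)) h0⟩

theorem rpow_integral_norm_dual_rpow (hp : 2 < p) (hq : 2 < q) (hpq : 2 / p + 2 / q = 1) (t : ℝ) :
    ((∫ v, ‖dual f p q t v‖ ^ (2 / (1 + 2 / p))) ^ ((1 + 2 / p) / 2)) ^ (2 / (2 - 2 / p)) =
      (∫ v, ‖f t v‖ ^ q) ^ (p / q) := by
  have h0 : 0 ≤ ∫ v, ‖f t v‖ ^ q := by positivity
  rw [← rpow_mul_self_rpow_rpow hp hpq h0, ← integral_const_mul]
  congr 3
  funext v
  rw [norm_dual hq, Real.mul_rpow (by positivity) (by positivity), ← Real.rpow_mul (norm_nonneg _)]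
  congr 2
  have hp0 : 0 < p := by linarith
  have : 1 + 2 / p ≠ 0 := by positivity
  have h2 : 2 / p = 1 - 2 / q := by linarith
  rw [h2] at this ⊢
  field_simp
  rw [div_eq_one_iff_eq (by linarith)]
  ring

theorem mul_conj_dual {u : ℂ} (hq : 2 < q) (t : ℝ) (v : ℝ × ℝ) (hu : f t v = 0 ∨ f t v = u) :
    u * (starRingEnd ℂ) (dual f p q t v) =
      (((∫ v, ‖f t v‖ ^ q) ^ (p / q - 1) * ‖f t v‖ ^ q : ℝ) : ℂ) := by
  have e : ‖f t v‖ ^ q = ‖f t v‖ ^ (q - 2) * ‖f t v‖ ^ 2 := by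
    rw [← rpow_sub_one_mul_self (norm_nonneg (f t v)) (by linarith : q ≠ 0),
      ← rpow_sub_one_mul_self (norm_nonneg (f t v)) (by linarith : q - 1 ≠ 0)]
    ring_nf
  have e2 : u * (starRingEnd ℂ) (f t v) = ((‖f t v‖ ^ 2 : ℝ) : ℂ) := by
    rcases hu with hu | hu
    · rw [hu]; simp
    · rw [← hu, Complex.mul_conj, Complex.normSq_eq_norm_sq]
  rw [dual, map_mul, Complex.conj_ofReal, mul_left_comm, e2, e]
  push_cast
  ring

theorem lintegral_le_of_dual {u : ℝ → ℝ × ℝ → ℂ} (h : IsBoxTruncated f m) (hm : 0 < m)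
    (hu : ∀ t v, f t v = 0 ∨ f t v = u t v)
    (hp : 2 < p) (hq : 2 < q) (hpq : 2 / p + 2 / q = 1) {B : ENNReal}
    (H : ∀ G : ℝ → ℝ × ℝ → ℂ,
      Measurable (Function.uncurry G) → Integrable (Function.uncurry G) →
      (∀ t, Integrable (G t)) → (∀ t, TwoSidedBounded (G t)) →
      ∫⁻ t, ENNReal.ofReal (((∫ v, ‖G t v‖ ^ (2 / (1 + 2 / p))) ^ ((1 + 2 / p) / 2)) ^
        (2 / (2 - 2 / p))) ≠ ⊤ →
      ‖∫ z : ℝ × (ℝ × ℝ), u z.1 z.2 * (starRingEnd ℂ) (G z.1 z.2)‖ₑ ≤ B *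
        (∫⁻ t, ENNReal.ofReal (((∫ v, ‖G t v‖ ^ (2 / (1 + 2 / p))) ^ ((1 + 2 / p) / 2)) ^
          (2 / (2 - 2 / p)))) ^ ((2 - 2 / p) / 2)) :
    (∫⁻ t, ENNReal.ofReal ((∫ v, ‖f t v‖ ^ q) ^ (p / q))) ^ (1 / p) ≤ B := by
  have hq0 : 0 < q := by linarith
  have hp0 : 0 < p := by linarith
  have hMi := h.integrable_integral_norm_rpow hm hq0 (div_pos hp0 hq0)
  have hGi := h.integrable_dual hm hp0 hq
  have hM0 : ∀ t, 0 ≤ ∫ v, ‖f t v‖ ^ q := fun t => by positivity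
  have hX : ∫⁻ t, ENNReal.ofReal ((∫ v, ‖f t v‖ ^ q) ^ (p / q)) ≠ ⊤ :=
    hMi.lintegral_lt_top.ne
  have h1 := H (dual f p q) h.measurable_dual hGi (h.integrable_dual_apply hm hq)
    (h.twoSidedBounded_dual hm hq)
  simp_rw [rpow_integral_norm_dual_rpow hp hq hpq, fun z : ℝ × (ℝ × ℝ) => mul_conj_dual (p := p) hq z.1 z.2 (hu z.1 z.2)] at h1
  have h2 := h1 hX
  have hprod : Integrable fun z : ℝ × (ℝ × ℝ) =>
      (∫ v, ‖f z.1 v‖ ^ q) ^ (p / q - 1) * ‖f z.1 z.2‖ ^ q := by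
    refine (hGi.norm.const_mul m).mono' ?_ (ae_of_all _ fun z => ?_)
    · exact (((measurable_integral_norm_rpow h.measurable q (p / q - 1)).comp measurable_fst).mul
        (h.measurable.norm.pow_const q)).aestronglyMeasurable
    · have := hM0 z.1
      rw [Real.norm_of_nonneg (by positivity), Function.uncurry, norm_dual hq,
        ← rpow_sub_one_mul_self (norm_nonneg (f z.1 z.2)) hq0.ne']
      have h3 : ‖f z.1 z.2‖ ≤ m := by
        by_cases hf : f z.1 z.2 = 0
        · rw [hf, norm_zero]; exact hm.le
        · exact h.norm_apply_le _ _ hf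
      have h4 : 0 ≤ (∫ v, ‖f z.1 v‖ ^ q) ^ (p / q - 1) * ‖f z.1 z.2‖ ^ (q - 1) := by positivity
      nlinarith
  have h5 : ∫ z : ℝ × (ℝ × ℝ), (((∫ v, ‖f z.1 v‖ ^ q) ^ (p / q - 1) * ‖f z.1 z.2‖ ^ q : ℝ) : ℂ) =
      ((∫ t, (∫ v, ‖f t v‖ ^ q) ^ (p / q) : ℝ) : ℂ) := by
    rw [integral_complex_ofReal, Measure.volume_eq_prod ℝ (ℝ × ℝ), integral_prod _ hprod]
    congr 2
    funext t
    dsimp only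
    rw [integral_const_mul, rpow_sub_one_mul_self (hM0 t) (div_pos hp0 hq0).ne']
  rw [h5, ← ofReal_norm, Complex.norm_real, Real.norm_of_nonneg (by positivity),
    ofReal_integral_eq_lintegral_ofReal hMi (ae_of_all _ fun t => by have := hM0 t; positivity)] at h2
  set X := ∫⁻ t, ENNReal.ofReal ((∫ v, ‖f t v‖ ^ q) ^ (p / q))
  rcases eq_or_ne X 0 with hX0 | hX0
  · rw [hX0, ENNReal.zero_rpow_of_pos (by positivity)]
    exact bot_le
  · have h6 : X = X ^ (1 / p) * X ^ ((2 - 2 / p) / 2) := by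
      rw [← ENNReal.rpow_add _ _ hX0 hX, show 1 / p + (2 - 2 / p) / 2 = 1 by field_simp; ring,
        ENNReal.rpow_one]
    have h7 : X ^ (1 / p) * X ^ ((2 - 2 / p) / 2) ≤ B * X ^ ((2 - 2 / p) / 2) := h6.symm.le.trans h2
    refine (ENNReal.mul_le_mul_iff_left ?_ ?_).1 h7
    · simp [ENNReal.rpow_eq_zero_iff, hX0, hX]
    · simp [ENNReal.rpow_eq_top_iff, hX0, hX]

end IsBoxTruncated

/-- Truncation of a function to a box, keeping only its moderate values. -/
noncomputable def boxTruncation (u : ℝ → ℝ × ℝ → ℂ) (m : ℝ) (t : ℝ) (v : ℝ × ℝ) : ℂ :=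
  {z : ℝ × (ℝ × ℝ) | |z.1| ≤ m ∧ ‖z.2‖ ≤ m ∧ 1 / m ≤ ‖u z.1 z.2‖ ∧ ‖u z.1 z.2‖ ≤ m}.indicator
    (Function.uncurry u) (t, v)

theorem mem_of_boxTruncation_ne_zero {u : ℝ → ℝ × ℝ → ℂ} {m t : ℝ} {v : ℝ × ℝ} (h : boxTruncation u m t v ≠ 0) :
    (|t| ≤ m ∧ ‖v‖ ≤ m ∧ 1 / m ≤ ‖u t v‖ ∧ ‖u t v‖ ≤ m) ∧ boxTruncation u m t v = u t v := by
  have h1 := Set.mem_of_indicator_ne_zero h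
  exact ⟨h1, Set.indicator_of_mem h1 _⟩

theorem boxTruncation_eq {u : ℝ → ℝ × ℝ → ℂ} {m t : ℝ} {v : ℝ × ℝ}
    (h : |t| ≤ m ∧ ‖v‖ ≤ m ∧ 1 / m ≤ ‖u t v‖ ∧ ‖u t v‖ ≤ m) : boxTruncation u m t v = u t v :=
  Set.indicator_of_mem (s := {z : ℝ × (ℝ × ℝ) | |z.1| ≤ m ∧ ‖z.2‖ ≤ m ∧ 1 / m ≤ ‖u z.1 z.2‖ ∧ ‖u z.1 z.2‖ ≤ m})
    (a := (t, v)) h (Function.uncurry u)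

theorem isBoxTruncated_boxTruncation {u : ℝ → ℝ × ℝ → ℂ} (hu : Measurable (Function.uncurry u)) (m : ℝ) :
    IsBoxTruncated (boxTruncation u m) m where
  measurable := by
    have h1 : Measurable fun z : ℝ × (ℝ × ℝ) => ‖u z.1 z.2‖ := hu.norm
    refine hu.indicator (MeasurableSet.inter ?_ (MeasurableSet.inter ?_ (MeasurableSet.inter ?_ ?_)))
    · exact measurableSet_le (f := fun z : ℝ × (ℝ × ℝ) => |z.1|) (by fun_prop) measurable_const
    · exact measurableSet_le (f := fun z : ℝ × (ℝ × ℝ) => ‖z.2‖) (by fun_prop) measurable_const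
    · exact measurableSet_le measurable_const h1
    · exact measurableSet_le h1 measurable_const
  abs_time_le _ _ h := (mem_of_boxTruncation_ne_zero h).1.1
  norm_le _ _ h := (mem_of_boxTruncation_ne_zero h).1.2.1
  le_norm_apply _ _ h := by
    rw [(mem_of_boxTruncation_ne_zero h).2]; exact (mem_of_boxTruncation_ne_zero h).1.2.2.1
  norm_apply_le _ _ h := by
    rw [(mem_of_boxTruncation_ne_zero h).2]; exact (mem_of_boxTruncation_ne_zero h).1.2.2.2

theorem lintegral_rpow_le_of_boxTruncation {u : ℝ → ℝ × ℝ → ℂ} (hu : Measurable (Function.uncurry u))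
    {p q : ℝ} (hp : 0 < p) (hq : 0 < q) {B : ENNReal}
    (h : ∀ m : ℝ, 0 < m →
      (∫⁻ t, ENNReal.ofReal ((∫ v, ‖boxTruncation u m t v‖ ^ q) ^ (p / q))) ^ (1 / p) ≤ B) :
    (∫⁻ t, (∫⁻ v, ‖u t v‖ₑ ^ q) ^ (p / q)) ^ (1 / p) ≤ B := by
  have hbt := isBoxTruncated_boxTruncation hu
  have hm : ∀ n : ℕ, (0 : ℝ) < n + 1 := fun n => by positivity
  have hmeas : ∀ m, Measurable (Function.uncurry fun t v => ‖boxTruncation u m t v‖ₑ ^ q) :=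
    fun m => (hbt m).measurable.enorm.pow_const q
  have e : ∀ (n : ℕ) t, ENNReal.ofReal ((∫ v, ‖boxTruncation u (n + 1) t v‖ ^ q) ^ (p / q)) =
      (∫⁻ v, ‖boxTruncation u (n + 1) t v‖ₑ ^ q) ^ (p / q) := by
    intro n t
    rw [← ENNReal.ofReal_rpow_of_nonneg (by positivity) (by positivity),
      ofReal_integral_eq_lintegral_ofReal ((hbt _).integrable_norm_rpow (hm n) hq t)
        (ae_of_all _ fun v => by positivity)]
    congr 2
    funext v
    rw [← ENNReal.ofReal_rpow_of_nonneg (norm_nonneg _) hq.le, ofReal_norm]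
  have hmono : ∀ t v, Monotone fun n : ℕ => ‖boxTruncation u (n + 1) t v‖ₑ ^ q := by
    intro t v n k hnk
    by_cases h0 : boxTruncation u (n + 1) t v = 0
    · simp [h0, ENNReal.zero_rpow_of_pos hq]
    · obtain ⟨⟨h1, h2, h3, h4⟩, h5⟩ := mem_of_boxTruncation_ne_zero h0
      have hle : (n : ℝ) + 1 ≤ k + 1 := by gcongr
      have h6 : 1 / ((k : ℝ) + 1) ≤ 1 / ((n : ℝ) + 1) := by gcongr
      beta_reduce
      rw [h5, boxTruncation_eq ⟨h1.trans hle, h2.trans hle, h6.trans h3, h4.trans hle⟩]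
  have ht1 : Filter.Tendsto (fun n : ℕ => 1 / ((n : ℝ) + 1)) Filter.atTop (nhds 0) :=
    tendsto_one_div_add_atTop_nhds_zero_nat
  have ht2 : Filter.Tendsto (fun n : ℕ => (n : ℝ) + 1) Filter.atTop Filter.atTop :=
    Filter.tendsto_atTop_add_const_right _ _ tendsto_natCast_atTop_atTop
  have htend : ∀ t v, Filter.Tendsto (fun n : ℕ => ‖boxTruncation u (n + 1) t v‖ₑ ^ q)
      Filter.atTop (nhds (‖u t v‖ₑ ^ q)) := by
    intro t v
    by_cases h0 : u t v = 0
    · have : ∀ m, boxTruncation u m t v = 0 := by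
        intro m
        by_contra h1
        exact h1 ((mem_of_boxTruncation_ne_zero h1).2.trans h0)
      simp [this, h0]
    · refine tendsto_const_nhds.congr' ?_
      filter_upwards [ht1.eventually_le_const (norm_pos_iff.2 h0), ht2.eventually_ge_atTop |t|,
        ht2.eventually_ge_atTop ‖v‖, ht2.eventually_ge_atTop ‖u t v‖] with n h1 h2 h3 h4
      rw [boxTruncation_eq ⟨h2, h3, h1, h4⟩]
  rw [one_div, ENNReal.rpow_inv_le_iff hp]
  refine lintegral_le_of_tendsto_of_le
    (f := fun (n : ℕ) t => (∫⁻ v, ‖boxTruncation u (n + 1) t v‖ₑ ^ q) ^ (p / q))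
    (fun n => ((hmeas _).lintegral_prod_right').pow_const _) (fun t => ?_) (fun n => ?_)
  · refine (ENNReal.continuous_rpow_const.tendsto _).comp ?_
    exact lintegral_tendsto_of_tendsto_of_monotone
      (fun n => (hmeas _).of_uncurry_left.aemeasurable)
      (ae_of_all _ fun v => hmono t v) (ae_of_all _ fun v => htend t v)
  · have := h (n + 1) (hm n)
    simp_rw [e] at this
    rwa [one_div, ENNReal.rpow_inv_le_iff hp] at this

theorem measurable_transferFn {p b : ℝ} {F : ℝ × ℝ × ℝ → ℂ} (hF : Measurable F) :
    Measurable (Function.uncurry (transferFn p b F)) := by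
  have hw := measurable_transferWeight p b
  have h : Measurable (Function.uncurry fun (z : ℝ × (ℝ × ℝ)) (w : ℝ × ℝ × ℝ) =>
      Complex.exp (Complex.I * (z.2.1 * w.1 + z.2.2 * w.2.1 + z.1 * w.2.2 : ℝ)) *
        ((transferWeight p b w : ℂ) * F w)) := by
    unfold Function.uncurry
    fun_prop
  have e : Function.uncurry (transferFn p b F) = fun z => (2 * Real.pi : ℂ)⁻¹ ^ 3 * ∫ w : ℝ × ℝ × ℝ,
      Complex.exp (Complex.I * (z.2.1 * w.1 + z.2.2 * w.2.1 + z.1 * w.2.2 : ℝ)) *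
        ((transferWeight p b w : ℂ) * F w) := funext fun z => transferFn_eq p b F z.1 z.2
  rw [e]
  exact h.stronglyMeasurable.integral_prod_right.measurable.const_mul _

theorem transferWeight_le {p b : ℝ} (hp : 1 ≤ p) (hb : 0 ≤ b) (w : ℝ × ℝ × ℝ) :
    transferWeight p b w ≤ 1 + 2 * ‖w‖ := by
  have h1 : |w.1| ≤ ‖w‖ := norm_fst_le w
  have h2 : |w.2.1| ≤ ‖w‖ := (norm_fst_le w.2).trans (norm_snd_le w)
  have h3 : 1 ≤ √(1 + w.1 ^ 2 + w.2.1 ^ 2) := Real.one_le_sqrt.2 (by nlinarith [sq_nonneg w.1, sq_nonneg w.2.1])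
  have h4 : √(1 + w.1 ^ 2 + w.2.1 ^ 2) ≤ 1 + 2 * ‖w‖ := by
    rw [Real.sqrt_le_left (by positivity), ← sq_abs w.1, ← sq_abs w.2.1]
    nlinarith [abs_nonneg w.1, abs_nonneg w.2.1]
  have h5 : 1 ≤ √(1 + (w.2.2 - phiNV w.1 w.2.1) ^ 2) :=
    Real.one_le_sqrt.2 (by nlinarith [sq_nonneg (w.2.2 - phiNV w.1 w.2.1)])
  have h6 : √(1 + w.1 ^ 2 + w.2.1 ^ 2) ^ (1 / p) ≤ √(1 + w.1 ^ 2 + w.2.1 ^ 2) := by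
    have := Real.rpow_le_rpow_of_exponent_le h3 ((div_le_one (by linarith)).2 hp)
    rwa [Real.rpow_one] at this
  have h7 : √(1 + (w.2.2 - phiNV w.1 w.2.1) ^ 2) ^ (-b) ≤ 1 :=
    Real.rpow_le_one_of_one_le_of_nonpos h5 (by linarith)
  calc transferWeight p b w ≤ (1 + 2 * ‖w‖) * 1 :=
        mul_le_mul (h6.trans h4) h7 (by positivity) (by positivity)
    _ = _ := mul_one _

theorem integrable_transferWeight_mul {p b : ℝ} (hp : 1 ≤ p) (hb : 0 ≤ b)
    (F : SchwartzMap (ℝ × ℝ × ℝ) ℂ) : Integrable fun w => (transferWeight p b w : ℂ) * F w := by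
  have : (volume : Measure (ℝ × ℝ)).IsAddHaarMeasure :=
    inferInstanceAs (volume.prod volume : Measure (ℝ × ℝ)).IsAddHaarMeasure
  have : (volume : Measure (ℝ × ℝ × ℝ)).IsAddHaarMeasure :=
    inferInstanceAs (volume.prod volume : Measure (ℝ × (ℝ × ℝ))).IsAddHaarMeasure
  have h0 := F.integrable_pow_mul (volume : Measure (ℝ × ℝ × ℝ)) 0
  have h1 := F.integrable_pow_mul (volume : Measure (ℝ × ℝ × ℝ)) 1
  refine (h0.add (h1.const_mul 2)).mono' ?_ (ae_of_all _ fun w => ?_)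
  · exact ((Complex.measurable_ofReal.comp (measurable_transferWeight p b)).mul
      F.continuous.measurable).aestronglyMeasurable
  · rw [norm_mul, Complex.norm_real, Real.norm_of_nonneg (transferWeight_nonneg _ _ _)]
    refine (mul_le_mul_of_nonneg_right (transferWeight_le hp hb w) (norm_nonneg _)).trans_eq ?_
    simp only [Pi.add_apply]
    ring

/-- Transferred Strichartz-type estimate `‖u‖_{L^p_t L^q_{xy}} ≲ ‖F‖_{L²}` for the
function `u` with space-time Fourier transform `⟨(ξ,η)⟩^{1/p}⟨τ−φ(ξ,η)⟩^{−b}F(ξ,η,τ)`,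
where `p > 2`, `2/p + 2/q = 1` and `b > 1/2`. -/
theorem transferred_strichartz (p q b : ℝ) (hp : 2 < p) (hpq : 2 / p + 2 / q = 1)
    (hb : 1 / 2 < b) :
    ∃ C > (0 : ℝ), ∀ F : SchwartzMap (ℝ × ℝ × ℝ) ℂ,
      (∫⁻ t : ℝ, (∫⁻ v : ℝ × ℝ, (‖transferFn p b F t v‖₊ : ENNReal) ^ q) ^ (p / q))
          ^ (1 / p)
        ≤ ENNReal.ofReal C *
          (∫⁻ w : ℝ × ℝ × ℝ, (‖F w‖₊ : ENNReal) ^ (2 : ℝ)) ^ ((1 : ℝ) / 2) := by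
  have hp0 : 0 < p := by linarith
  have h0 : 0 < 2 / p := by positivity
  have h1 : 2 / p < 1 := (div_lt_one hp0).2 hp
  have hq0 : 0 < q := by
    by_contra h
    have : 2 / q ≤ 0 := div_nonpos_of_nonneg_of_nonpos zero_le_two (not_lt.1 h)
    linarith
  have hq : 2 < q := by
    have : 2 / q < 1 := by linarith
    exact (div_lt_one hq0).1 this
  obtain ⟨C, hC, H⟩ := exists_enorm_integral_transferFn_mul_conj_le (p := p) hb h0 h1 rfl
  refine ⟨C + 1, by linarith, fun F => ?_⟩
  have hFm : Measurable F := F.continuous.measurable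
  have hum : Measurable (Function.uncurry (transferFn p b F)) := measurable_transferFn hFm
  have hFi := integrable_transferWeight_mul (p := p) (b := b) (by linarith) (by linarith) F
  calc _ ≤ ENNReal.ofReal C * (∫⁻ w, ‖F w‖ₑ ^ (2 : ℝ)) ^ ((1 : ℝ) / 2) := by
        refine lintegral_rpow_le_of_boxTruncation hum hp0 hq0 fun m hm => ?_
        refine (isBoxTruncated_boxTruncation hum m).lintegral_le_of_dual hm (fun t v => ?_)
          hp hq hpq (H F hFm hFi)
        exact or_iff_not_imp_left.2 fun h => (mem_of_boxTruncation_ne_zero h).2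
    _ ≤ _ := by
        refine mul_le_mul_left (ENNReal.ofReal_le_ofReal (by linarith)) _
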